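/- For every positive integer p there exist rational numbers q1, q2, q3, q4, q5 such that ∫_0^∞ z^(4p+1)/(cos z + cosh z)^3 dz = q1·Γ(1/4)^(8p−4)/π^(2p−1) + q2·Γ(1/4)^(8p+4)/π^(2p+3) + q3·Γ(1/4)^(8p+4)/π^(2p+2) + q4·Γ(1/4)^(8p+4)/π^(2p+1) + q5·Γ(1/4)^(8p+12)/π^(2p+7). -/

import Mathlib

open Real

namespace BerndtIntegral

/-- `φ` decays at least like `exp (-|t|)` away from the origin. -/
def ExpDecay (φ : ℝ → ℝ) : Prop :=
  ∀ δ > 0, ∃ C, ∀ t, δ ≤ |t| → |φ t| ≤ C * exp (-|t|)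

/-- The shifted integers `n + θ` avoid the punctured interval `(-1/2, 1/2)`. -/
def Spaced (θ : ℝ) : Prop := ∀ n : ℤ, (n : ℝ) + θ = 0 ∨ 1 / 2 ≤ |(n : ℝ) + θ|

lemma spaced_zero : Spaced 0 := by
  intro n
  rcases eq_or_ne n 0 with rfl | hn
  · left; simp
  · right
    have : (1 : ℝ) ≤ |(n : ℝ)| := by exact_mod_cast Int.one_le_abs hn
    rw [add_zero]; linarith

lemma half_le_abs (n : ℤ) : 1 / 2 ≤ |(n : ℝ) + 1 / 2| := by
  rcases le_or_gt 0 n with hn | hn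
  · have : (0 : ℝ) ≤ n := by exact_mod_cast hn
    exact le_trans (by linarith) (le_abs_self _)
  · have : (n : ℝ) ≤ -1 := by exact_mod_cast (by omega : n ≤ -1)
    exact le_trans (by linarith) (neg_le_abs _)

lemma spaced_half : Spaced (1 / 2) := fun n => Or.inr (half_le_abs n)

lemma pow_le_mul_exp (k : ℕ) {a x : ℝ} (ha : 0 < a) (hx : 0 ≤ x) :
    x ^ k ≤ (k.factorial / a ^ k) * exp (a * x) := by
  have h := Real.pow_div_factorial_le_exp (a * x) (by positivity) k
  rw [div_le_iff₀ (by positivity), mul_pow] at h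
  rw [div_mul_eq_mul_div, le_div_iff₀ (by positivity)]
  linarith

lemma summable_exp_neg_abs {a : ℝ} (ha : 0 < a) :
    Summable fun n : ℤ => exp (-(a * |(n : ℝ)|)) := by
  have h : Summable fun n : ℕ => exp (-(a * (n : ℝ))) := by
    have h1 : Summable fun n : ℕ => (exp (-a)) ^ n :=
      summable_geometric_of_lt_one (exp_pos _).le (by rw [exp_lt_one_iff]; linarith)
    refine h1.congr fun n => ?_
    rw [← Real.exp_nat_mul]; congr 1; ring
  rw [summable_int_iff_summable_nat_and_neg]
  constructor
  · simpa using h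
  · simpa using h

lemma summable_pow_mul_exp (θ : ℝ) (k : ℕ) {δ : ℝ} (hδ : 0 < δ) :
    Summable fun n : ℤ => |(n : ℝ) + θ| ^ k * exp (-(δ * |(n : ℝ) + θ|)) := by
  have h2 : 0 < δ / 2 := by positivity
  refine Summable.of_nonneg_of_le (fun n => by positivity) (fun n => ?_)
    ((summable_exp_neg_abs h2).mul_left
      ((k.factorial / (δ / 2) ^ k) * exp (δ / 2 * |θ|)))
  have h := pow_le_mul_exp k h2 (abs_nonneg ((n : ℝ) + θ))
  have h3 : |(n : ℝ)| ≤ |(n : ℝ) + θ| + |θ| := by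
    have := abs_sub ((n : ℝ) + θ) θ
    simpa using this
  calc |(n : ℝ) + θ| ^ k * exp (-(δ * |(n : ℝ) + θ|))
      ≤ ((k.factorial / (δ / 2) ^ k) * exp (δ / 2 * |(n : ℝ) + θ|))
          * exp (-(δ * |(n : ℝ) + θ|)) := by gcongr
    _ = (k.factorial / (δ / 2) ^ k) * exp (-(δ / 2 * |(n : ℝ) + θ|)) := by
        rw [mul_assoc, ← Real.exp_add]; congr 2; ring
    _ ≤ (k.factorial / (δ / 2) ^ k) * exp (δ / 2 * |θ| + -(δ / 2 * |(n : ℝ)|)) := by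
        gcongr
        nlinarith
    _ = _ := by rw [Real.exp_add]; ring

lemma ExpDecay.exists_bound {φ : ℝ → ℝ} (hφ : ExpDecay φ) {θ : ℝ} (hθ : Spaced θ)
    {δ : ℝ} (hδ : 0 < δ) :
    ∃ C, 0 ≤ C ∧ ∀ (n : ℤ) (h : ℝ), δ ≤ h →
      |φ (((n : ℝ) + θ) * h)| ≤ C * exp (-(δ * |(n : ℝ) + θ|)) := by
  obtain ⟨C, hC⟩ := hφ (δ / 2) (by positivity)
  refine ⟨max C |φ 0|, le_trans (abs_nonneg _) (le_max_right _ _), fun n h hh => ?_⟩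
  rcases hθ n with h0 | h1
  · simp [h0]
  · have hh0 : 0 < h := hδ.trans_le hh
    have h2 : |((n : ℝ) + θ) * h| = |(n : ℝ) + θ| * h := by
      rw [abs_mul, abs_of_pos hh0]
    refine (hC _ ?_).trans ?_
    · rw [h2]; nlinarith
    · rw [h2]
      refine mul_le_mul (le_max_left _ _) (exp_le_exp.mpr ?_) (exp_pos _).le
        (le_trans (abs_nonneg _) (le_max_right _ _))
      nlinarith [abs_nonneg ((n : ℝ) + θ)]

lemma ExpDecay.summable {φ : ℝ → ℝ} (hφ : ExpDecay φ) {θ : ℝ} (hθ : Spaced θ)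
    {h : ℝ} (hh : 0 < h) {b : ℤ → ℝ} {k : ℕ} (hb : ∀ n : ℤ, |b n| ≤ |(n : ℝ) + θ| ^ k) :
    Summable fun n : ℤ => b n * φ (((n : ℝ) + θ) * h) := by
  obtain ⟨C, hC0, hC⟩ := hφ.exists_bound hθ hh
  refine Summable.of_norm_bounded ((summable_pow_mul_exp θ k hh).mul_left C) fun n => ?_
  rw [Real.norm_eq_abs, abs_mul]
  calc _ ≤ |(n : ℝ) + θ| ^ k * (C * exp (-(h * |(n : ℝ) + θ|))) :=
        mul_le_mul (hb n) (hC n h le_rfl) (abs_nonneg _) (by positivity)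
    _ = _ := by ring

lemma ExpDecay.hasDerivAt_tsum {φ ψ : ℝ → ℝ} (hφ : ExpDecay φ) (hψ : ExpDecay ψ)
    (hd : ∀ t, t ≠ 0 → HasDerivAt φ (ψ t) t) {θ : ℝ} (hθ : Spaced θ)
    {b : ℤ → ℝ} {k : ℕ} (hb : ∀ n : ℤ, |b n| ≤ |(n : ℝ) + θ| ^ k) {h : ℝ} (hh : 0 < h) :
    HasDerivAt (fun h => ∑' n : ℤ, b n * φ (((n : ℝ) + θ) * h))
      (∑' n : ℤ, b n * (((n : ℝ) + θ) * ψ (((n : ℝ) + θ) * h))) h := by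
  have h2 : 0 < h / 2 := by positivity
  obtain ⟨C, hC0, hC⟩ := hψ.exists_bound hθ h2
  refine hasDerivAt_tsum_of_isPreconnected (t := Set.Ioi (h / 2)) (y₀ := h)
    (g := fun n h => b n * φ (((n : ℝ) + θ) * h))
    (g' := fun n h => b n * (((n : ℝ) + θ) * ψ (((n : ℝ) + θ) * h)))
    ((summable_pow_mul_exp θ (k + 1) h2).mul_left C) isOpen_Ioi isPreconnected_Ioi ?_ ?_
    (by simp [hh]) (hφ.summable hθ hh hb) (by simp [hh])
  · intro n y hy
    have hy0 : 0 < y := h2.trans hy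
    rcases hθ n with h0 | h1
    · simp only [h0, zero_mul, mul_zero]
      exact hasDerivAt_const _ _
    · have hne : (n : ℝ) + θ ≠ 0 := by
        intro h0; rw [h0] at h1; norm_num at h1
      have := (hd (((n : ℝ) + θ) * y) (mul_ne_zero hne hy0.ne')).comp y
        ((hasDerivAt_id y).const_mul ((n : ℝ) + θ))
      simp only [mul_one] at this
      rw [mul_comm ((n : ℝ) + θ) (ψ _)]
      exact this.const_mul (b n)
  · intro n y hy
    rw [Real.norm_eq_abs, abs_mul, abs_mul]
    calc _ ≤ |(n : ℝ) + θ| ^ k * (|(n : ℝ) + θ| * (C * exp (-(h / 2 * |(n : ℝ) + θ|)))) := by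
          gcongr
          · exact hb n
          · exact hC n y (le_of_lt hy)
      _ = _ := by ring

/-- The sine series with coefficients `a` and frequencies `n + θ`. -/
noncomputable def sinSeries (θ : ℝ) (a : ℤ → ℝ) (x : ℝ) : ℝ :=
  ∑' n : ℤ, a n * sin (((n : ℝ) + θ) * x)

/-- The cosine series with coefficients `a` and frequencies `n + θ`. -/
noncomputable def cosSeries (θ : ℝ) (a : ℤ → ℝ) (x : ℝ) : ℝ :=
  ∑' n : ℤ, a n * cos (((n : ℝ) + θ) * x)

/-- Rapidly decreasing coefficients. -/
def Rapid (θ : ℝ) (a : ℤ → ℝ) : Prop :=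
  ∀ k : ℕ, Summable fun n : ℤ => |(n : ℝ) + θ| ^ k * |a n|

lemma Rapid.mul_freq {θ : ℝ} {a : ℤ → ℝ} (ha : Rapid θ a) :
    Rapid θ fun n => ((n : ℝ) + θ) * a n := by
  intro k
  refine (ha (k + 1)).congr fun n => ?_
  rw [abs_mul]; ring

lemma Rapid.abs_summable {θ : ℝ} {a : ℤ → ℝ} (ha : Rapid θ a) : Summable fun n => |a n| := by
  simpa using ha 0

lemma Rapid.summable_mul {θ : ℝ} {a : ℤ → ℝ} (ha : Rapid θ a) {b : ℤ → ℝ}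
    (hb : ∀ n, |b n| ≤ 1) : Summable fun n => a n * b n :=
  Summable.of_norm_bounded ha.abs_summable fun n => by
    rw [Real.norm_eq_abs, abs_mul]
    exact mul_le_of_le_one_right (abs_nonneg _) (hb n)

lemma ExpDecay.rapid {φ : ℝ → ℝ} (hφ : ExpDecay φ) {θ : ℝ} (hθ : Spaced θ)
    {h : ℝ} (hh : 0 < h) {b : ℤ → ℝ} {k : ℕ} (hb : ∀ n : ℤ, |b n| ≤ |(n : ℝ) + θ| ^ k) :
    Rapid θ fun n : ℤ => b n * φ (((n : ℝ) + θ) * h) := by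
  intro j
  have := (hφ.summable hθ hh (b := fun n => |(n : ℝ) + θ| ^ j * b n) (k := j + k) ?_).abs
  · refine this.congr fun n => ?_
    simp only [abs_mul, abs_pow, abs_abs]; ring
  · intro n
    rw [abs_mul, abs_pow, abs_abs, pow_add]
    gcongr
    exact hb n

lemma Rapid.hasDerivAt_sinSeries {θ : ℝ} {a : ℤ → ℝ} (ha : Rapid θ a) (x : ℝ) :
    HasDerivAt (sinSeries θ a) (cosSeries θ (fun n => ((n : ℝ) + θ) * a n) x) x := by
  refine hasDerivAt_tsum (y₀ := 0) (g := fun (n : ℤ) x => a n * sin (((n : ℝ) + θ) * x))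
    (g' := fun (n : ℤ) x => ((n : ℝ) + θ) * a n * cos (((n : ℝ) + θ) * x))
    (ha 1) ?_ ?_ ?_ x
  · intro n y
    have := (((hasDerivAt_id y).const_mul ((n : ℝ) + θ)).sin).const_mul (a n)
    refine this.congr_deriv ?_
    simp; ring
  · intro n y
    rw [Real.norm_eq_abs, abs_mul, abs_mul, pow_one]
    exact mul_le_of_le_one_right (by positivity) (abs_cos_le_one _)
  · exact ha.summable_mul fun n => abs_sin_le_one _

lemma Rapid.hasDerivAt_cosSeries {θ : ℝ} {a : ℤ → ℝ} (ha : Rapid θ a) (x : ℝ) :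
    HasDerivAt (cosSeries θ a) (-sinSeries θ (fun n => ((n : ℝ) + θ) * a n) x) x := by
  have := hasDerivAt_tsum (y₀ := 0) (g := fun (n : ℤ) x => a n * cos (((n : ℝ) + θ) * x))
    (g' := fun (n : ℤ) x => -(((n : ℝ) + θ) * a n * sin (((n : ℝ) + θ) * x)))
    (ha 1) ?_ ?_ ?_ x
  · rw [tsum_neg] at this
    exact this
  · intro n y
    have := (((hasDerivAt_id y).const_mul ((n : ℝ) + θ)).cos).const_mul (a n)
    refine this.congr_deriv ?_
    simp; ring
  · intro n y
    rw [Real.norm_eq_abs, abs_neg, abs_mul, abs_mul, pow_one]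
    exact mul_le_of_le_one_right (by positivity) (abs_sin_le_one _)
  · exact ha.summable_mul fun n => abs_cos_le_one _

/-- The exponential series with coefficients `a` and frequencies `n + θ`. -/
noncomputable def expSeries (θ : ℝ) (a : ℤ → ℝ) (x : ℝ) : ℂ :=
  ∑' n : ℤ, (a n : ℂ) * Complex.exp ((((n : ℝ) + θ) * x : ℝ) * Complex.I)

lemma expSeries_eq {θ : ℝ} {a : ℤ → ℝ} (ha : Summable fun n => |a n|) (x : ℝ) :
    expSeries θ a x = cosSeries θ a x + sinSeries θ a x * Complex.I := by
  have hc : Summable fun n : ℤ => a n * cos (((n : ℝ) + θ) * x) :=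
    Summable.of_norm_bounded ha fun n => by
      rw [Real.norm_eq_abs, abs_mul]
      exact mul_le_of_le_one_right (abs_nonneg _) (abs_cos_le_one _)
  have hs : Summable fun n : ℤ => a n * sin (((n : ℝ) + θ) * x) :=
    Summable.of_norm_bounded ha fun n => by
      rw [Real.norm_eq_abs, abs_mul]
      exact mul_le_of_le_one_right (abs_nonneg _) (abs_sin_le_one _)
  unfold expSeries cosSeries sinSeries
  rw [Complex.ofReal_tsum, Complex.ofReal_tsum, ← tsum_mul_right, ← Summable.tsum_add]
  · refine tsum_congr fun n => ?_
    rw [Complex.exp_mul_I]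
    push_cast; ring
  · exact_mod_cast hc
  · refine Summable.mul_right _ ?_
    exact_mod_cast hs

lemma norm_exp_freq (y : ℝ) : ‖Complex.exp ((y : ℝ) * Complex.I)‖ = 1 :=
  Complex.norm_exp_ofReal_mul_I y

lemma summable_norm_expTerm {θ : ℝ} {a : ℤ → ℝ} (ha : Summable fun n => |a n|) (x : ℝ) :
    Summable fun n : ℤ => ‖(a n : ℂ) * Complex.exp ((((n : ℝ) + θ) * x : ℝ) * Complex.I)‖ := by
  refine ha.congr fun n => ?_
  rw [norm_mul, norm_exp_freq, mul_one, Complex.norm_real, Real.norm_eq_abs]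

/-- Products of exponential series are computed by convolving coefficients. -/
lemma expSeries_mul {θ η : ℝ} {a b : ℤ → ℝ} (ha : Summable fun n => |a n|)
    (hb : Summable fun n => |b n|) (x : ℝ) :
    expSeries θ a x * expSeries η b x =
      expSeries (θ + η) (fun N => ∑' n : ℤ, a (N - n) * b n) x := by
  have h1 := summable_norm_expTerm (θ := θ) ha x
  have h2 := summable_norm_expTerm (θ := η) hb x
  unfold expSeries
  rw [tsum_mul_tsum_of_summable_norm h1 h2]
  have hs := summable_mul_of_summable_norm h1 h2
  let e : ℤ × ℤ ≃ ℤ × ℤ :=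
    { toFun := fun p => (p.1 - p.2, p.2)
      invFun := fun p => (p.1 + p.2, p.2)
      left_inv := fun p => by simp
      right_inv := fun p => by simp }
  rw [← e.tsum_eq]
  rw [← e.summable_iff] at hs
  refine (Summable.tsum_prod hs).trans ?_
  refine tsum_congr fun N => ?_
  rw [Complex.ofReal_tsum, ← tsum_mul_right]
  refine tsum_congr fun n => ?_
  simp only [e, Function.comp, Equiv.coe_fn_mk, Complex.ofReal_mul]
  rw [mul_mul_mul_comm, ← Complex.exp_add]
  congr 2
  push_cast; ring

/-- The hyperbolic secant. -/
noncomputable def sech (t : ℝ) : ℝ := (cosh t)⁻¹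

/-- The hyperbolic cosecant, with value `0` at `0`. -/
noncomputable def csch (t : ℝ) : ℝ := (sinh t)⁻¹

/-- The hyperbolic cotangent, with value `0` at `0`. -/
noncomputable def coth (t : ℝ) : ℝ := cosh t / sinh t

lemma sech_pos (t : ℝ) : 0 < sech t := inv_pos.mpr (cosh_pos t)

lemma sech_le_one (t : ℝ) : sech t ≤ 1 := inv_le_one_of_one_le₀ (one_le_cosh t)

lemma sech_neg (t : ℝ) : sech (-t) = sech t := by simp [sech]

lemma csch_neg (t : ℝ) : csch (-t) = -csch t := by simp [csch, inv_neg]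

lemma coth_neg (t : ℝ) : coth (-t) = -coth t := by simp [coth, div_neg]

lemma csch_zero : csch 0 = 0 := by simp [csch]

lemma coth_zero : coth 0 = 0 := by simp [coth]

lemma sinh_ne_zero' {t : ℝ} (ht : t ≠ 0) : sinh t ≠ 0 := by
  simpa using ht

lemma tanh_sq_add_sech_sq (t : ℝ) : tanh t ^ 2 + sech t ^ 2 = 1 := by
  rw [tanh_eq_sinh_div_cosh, sech]
  have := cosh_pos t
  field_simp
  have := cosh_sq t
  linarith

lemma abs_tanh_le_one (t : ℝ) : |tanh t| ≤ 1 := by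
  rw [← sq_le_one_iff_abs_le_one]
  nlinarith [tanh_sq_add_sech_sq t, sq_nonneg (sech t)]

lemma hasDerivAt_sech (t : ℝ) : HasDerivAt sech (-(sech t * tanh t)) t := by
  refine ((hasDerivAt_cosh t).inv (cosh_pos t).ne').congr_deriv ?_
  rw [tanh_eq_sinh_div_cosh, sech]
  have := cosh_pos t
  field_simp

lemma hasDerivAt_tanh (t : ℝ) : HasDerivAt tanh (sech t ^ 2) t := by
  have h := (hasDerivAt_sinh t).div (hasDerivAt_cosh t) (cosh_pos t).ne'
  have e : tanh = fun t => sinh t / cosh t := funext tanh_eq_sinh_div_cosh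
  rw [e]
  refine h.congr_deriv ?_
  rw [sech]
  have := cosh_pos t
  have := cosh_sq t
  field_simp
  linarith

lemma hasDerivAt_csch {t : ℝ} (ht : t ≠ 0) : HasDerivAt csch (-(csch t * coth t)) t := by
  have h0 := sinh_ne_zero' ht
  refine ((hasDerivAt_sinh t).inv h0).congr_deriv ?_
  rw [coth, csch]
  field_simp

lemma sech_le_two_exp (t : ℝ) : sech t ≤ 2 * exp (-|t|) := by
  rw [sech, ← cosh_abs, cosh_eq, exp_neg, inv_le_iff_one_le_mul₀ (by positivity)]
  have : 0 < exp |t| := exp_pos _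
  field_simp
  nlinarith [inv_pos.mpr this]

lemma expDecay_of_le_sech {φ : ℝ → ℝ} {K : ℝ} (h : ∀ t, |φ t| ≤ K * sech t) : ExpDecay φ := by
  intro δ _
  have hK : 0 ≤ K := by
    have h1 := (abs_nonneg _).trans (h 0)
    exact nonneg_of_mul_nonneg_left h1 (sech_pos 0)
  exact ⟨K * 2, fun t _ => (h t).trans (by nlinarith [sech_le_two_exp t])⟩

lemma expDecay_sech : ExpDecay sech :=
  expDecay_of_le_sech (K := 1) fun t => by rw [abs_of_pos (sech_pos t), one_mul]

lemma abs_csch_le {δ : ℝ} (hδ : 0 < δ) {t : ℝ} (ht : δ ≤ |t|) :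
    |csch t| ≤ 2 / (1 - exp (-(2 * δ))) * exp (-|t|) := by
  have h1 : exp (-(2 * δ)) < 1 := by rw [exp_lt_one_iff]; linarith
  have h2 : (0 : ℝ) < 1 - exp (-(2 * δ)) := by linarith
  rw [csch, abs_inv, abs_sinh, sinh_eq]
  have h3 : exp (-|t|) ≤ exp (-(2 * δ)) * exp |t| := by
    rw [← Real.exp_add]; exact exp_le_exp.mpr (by linarith)
  have h4 : 0 < exp |t| := exp_pos _
  have h5 : (1 - exp (-(2 * δ))) / 2 * exp |t| ≤ (exp |t| - exp (-|t|)) / 2 := by nlinarith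
  calc ((exp |t| - exp (-|t|)) / 2)⁻¹ ≤ ((1 - exp (-(2 * δ))) / 2 * exp |t|)⁻¹ := by gcongr
    _ = _ := by rw [mul_inv, inv_div, ← Real.exp_neg]

lemma expDecay_csch : ExpDecay csch :=
  fun _ hδ => ⟨_, fun _ ht => abs_csch_le hδ ht⟩

lemma abs_coth_le (t : ℝ) : |coth t| ≤ 1 + |csch t| := by
  rcases eq_or_ne t 0 with rfl | ht
  · simp [coth]; positivity
  have h0 : 0 < |sinh t| := abs_pos.mpr (sinh_ne_zero' ht)
  rw [coth, csch, abs_div, abs_inv, div_le_iff₀ h0, add_mul, inv_mul_cancel₀ h0.ne',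
    abs_of_pos (cosh_pos t)]
  nlinarith [cosh_sq t, sq_abs (sinh t), cosh_pos t]

lemma expDecay_csch_mul_coth : ExpDecay fun t => -(csch t * coth t) := by
  intro δ hδ
  set C := 2 / (1 - exp (-(2 * δ))) with hC
  have hC0 : 0 ≤ C := by
    have h1 : exp (-(2 * δ)) < 1 := by rw [exp_lt_one_iff]; linarith
    exact div_nonneg (by norm_num) (by linarith)
  refine ⟨C * (1 + C), fun t ht => ?_⟩
  have h1 := abs_csch_le hδ ht
  rw [← hC] at h1
  have h2 : exp (-|t|) ≤ 1 := by simp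
  have h3 : |coth t| ≤ 1 + C := (abs_coth_le t).trans (by nlinarith)
  rw [abs_neg, abs_mul]
  calc |csch t| * |coth t| ≤ (C * exp (-|t|)) * (1 + C) := by gcongr
    _ = _ := by ring

lemma expDecay_sech_mul_tanh : ExpDecay fun t => -(sech t * tanh t) :=
  expDecay_of_le_sech (K := 1) fun t => by
    rw [abs_neg, abs_mul, abs_of_pos (sech_pos t), mul_comm]
    exact mul_le_mul_of_nonneg_right (abs_tanh_le_one t) (sech_pos t).le

lemma sech_mul_sech {a b : ℝ} (h : a + b ≠ 0) :
    sech a * sech b = csch (a + b) * (tanh a + tanh b) := by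
  have h0 := sinh_ne_zero' h
  rw [csch, sech, sech, tanh_eq_sinh_div_cosh, tanh_eq_sinh_div_cosh]
  have := cosh_pos a
  have := cosh_pos b
  field_simp
  rw [sinh_add]; ring

lemma coth_add_tanh {a b : ℝ} (h : a ≠ 0) :
    coth a + tanh b = cosh (a + b) * (csch a * sech b) := by
  have h0 := sinh_ne_zero' h
  rw [csch, sech, coth, tanh_eq_sinh_div_cosh]
  have := cosh_pos b
  field_simp
  rw [cosh_add]

lemma tanh_sub_tanh (a b : ℝ) : tanh a - tanh b = sinh (a - b) * (sech a * sech b) := by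
  rw [sech, sech, tanh_eq_sinh_div_cosh, tanh_eq_sinh_div_cosh]
  have := cosh_pos a
  have := cosh_pos b
  field_simp
  rw [sinh_sub]

open Filter Topology in
lemma tendsto_tanh_atTop : Tendsto tanh atTop (𝓝 1) := by
  have h : ∀ t, tanh t = 1 - exp (-t) * sech t := by
    intro t
    rw [tanh_eq_sinh_div_cosh, sech, sinh_eq, cosh_eq]
    have := exp_pos t
    have := exp_pos (-t)
    field_simp
    ring
  have h1 : Tendsto (fun t => exp (-t) * sech t) atTop (𝓝 0) := by
    refine squeeze_zero (fun t => ?_) (fun t => ?_) (tendsto_exp_neg_atTop_nhds_zero)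
    · exact mul_nonneg (exp_pos _).le (sech_pos t).le
    · exact mul_le_of_le_one_right (exp_pos _).le (sech_le_one t)
  have := h1.const_sub 1
  rw [sub_zero] at this
  exact this.congr fun t => (h t).symm

open Filter Topology in
lemma tendsto_tanh_atBot : Tendsto tanh atBot (𝓝 (-1)) := by
  have := (tendsto_tanh_atTop.comp tendsto_neg_atBot_atTop).neg
  refine this.congr fun t => ?_
  simp

lemma tanh_mono' {a b : ℝ} (h : a ≤ b) : tanh a ≤ tanh b := by
  have := tanh_sub_tanh b a
  have h1 : 0 ≤ sinh (b - a) := by simpa using h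
  have := mul_nonneg h1 (mul_pos (sech_pos b) (sech_pos a)).le
  linarith

open Filter Topology in
lemma hasSum_tanh_step {h : ℝ} (hh : 0 < h) (θ : ℝ) :
    HasSum (fun n : ℤ => tanh (((n : ℝ) + 1 + θ) * h) - tanh (((n : ℝ) + θ) * h)) 2 := by
  have hpos : Tendsto (fun n : ℕ => tanh (((n : ℝ) + θ) * h)) atTop (𝓝 1) :=
    tendsto_tanh_atTop.comp ((tendsto_atTop_add_const_right _ θ
      tendsto_natCast_atTop_atTop).atTop_mul_const hh)
  have hneg : Tendsto (fun n : ℕ => tanh ((-(n : ℝ) + θ) * h)) atTop (𝓝 (-1)) := by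
    refine tendsto_tanh_atBot.comp ?_
    refine Tendsto.atBot_mul_const hh (tendsto_atBot_add_const_right _ θ ?_)
    exact tendsto_neg_atTop_atBot.comp tendsto_natCast_atTop_atTop
  have e : (2 : ℝ) = (1 - tanh (θ * h)) + (tanh (θ * h) - (-1)) := by ring
  rw [e]
  refine HasSum.of_nat_of_neg_add_one ?_ ?_
  · rw [hasSum_iff_tendsto_nat_of_nonneg]
    · have := hpos.sub_const (tanh (θ * h))
      refine this.congr fun n => ?_
      have := Finset.sum_range_sub (fun n : ℕ => tanh (((n : ℝ) + θ) * h)) n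
      push_cast at this ⊢
      rw [this]; simp
    · intro n
      exact sub_nonneg.mpr (tanh_mono' (by push_cast; nlinarith))
  · rw [hasSum_iff_tendsto_nat_of_nonneg]
    · have := hneg.const_sub (tanh (θ * h))
      refine this.congr fun n => ?_
      have := Finset.sum_range_sub' (fun n : ℕ => tanh ((-(n : ℝ) + θ) * h)) n
      simp only [Nat.cast_zero, neg_zero, zero_add] at this
      rw [← this]
      refine Finset.sum_congr rfl fun i _ => ?_
      push_cast
      congr 3; ring
    · intro n
      exact sub_nonneg.mpr (tanh_mono' (by push_cast; nlinarith))

lemma hasSum_tanh_step_neg {h : ℝ} (hh : 0 < h) (y : ℝ) :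
    HasSum (fun n : ℤ => tanh ((y + 1 - n) * h) - tanh ((y - n) * h)) 2 := by
  have := (Equiv.neg ℤ).hasSum_iff.mpr (hasSum_tanh_step hh y)
  convert this using 2 with n
  simp only [Function.comp, Equiv.neg_apply]
  push_cast
  congr 3 <;> ring

lemma hasSum_int_of_step {d : ℤ → ℤ → ℝ} {s : ℤ → ℝ} (h0 : HasSum (d 0) (s 0))
    (hd : ∀ M, HasSum (fun n => d (M + 1) n - d M n) (s (M + 1) - s M)) (M : ℤ) :
    HasSum (d M) (s M) := by
  induction M using Int.induction_on with
  | zero => exact h0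
  | succ i ih =>
    have := ih.add (hd i)
    simpa using this
  | pred i ih =>
    have := ih.sub (hd (-i - 1))
    simpa using this

lemma hasSum_tanh_add {h : ℝ} (hh : 0 < h) (M : ℤ) :
    HasSum (fun n : ℤ => tanh (((M : ℝ) - n - 1 / 2) * h) + tanh (((n : ℝ) + 1 / 2) * h))
      (2 * M) := by
  refine hasSum_int_of_step (s := fun M => 2 * (M : ℝ))
    (d := fun M n => tanh (((M : ℝ) - n - 1 / 2) * h) + tanh (((n : ℝ) + 1 / 2) * h)) ?_ ?_ M
  · have : ∀ n : ℤ, tanh ((((0 : ℤ) : ℝ) - n - 1 / 2) * h) + tanh (((n : ℝ) + 1 / 2) * h) = 0 := by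
      intro n
      have : (((0 : ℤ) : ℝ) - n - 1 / 2) * h = -(((n : ℝ) + 1 / 2) * h) := by push_cast; ring
      rw [this, tanh_neg]; ring
    simp only [this]
    exact (by simp : (0 : ℝ) = 2 * ((0 : ℤ) : ℝ)) ▸ hasSum_zero
  · intro M
    have := hasSum_tanh_step_neg hh ((M : ℝ) - 1 / 2)
    convert this using 1
    · funext n
      push_cast
      have e1 : ((M : ℝ) + 1 - n - 1 / 2) * h = ((M : ℝ) - 1 / 2 + 1 - n) * h := by ring
      have e2 : ((M : ℝ) - n - 1 / 2) * h = ((M : ℝ) - 1 / 2 - n) * h := by ring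
      rw [e1, e2]; ring
    · push_cast; ring

lemma summable_pow_mul_coth_add_tanh {h : ℝ} (hh : 0 < h) (k : ℕ) :
    Summable fun n : ℤ => (n : ℝ) ^ k * (coth (n * h) + tanh ((1 / 2 - n) * h)) := by
  have h1 : Summable fun n : ℤ => (n : ℝ) ^ k * csch (n * h) := by
    have := expDecay_csch.summable spaced_zero hh (b := fun n : ℤ => (n : ℝ) ^ k) (k := k)
      (fun n => by simp)
    simpa using this
  have h2 : Summable fun n : ℤ => if n = 0 then (0 : ℝ) ^ k * tanh (1 / 2 * h) else 0 :=
    (hasSum_ite_eq (0 : ℤ) _).summable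
  have h3 : Summable fun n : ℤ =>
      cosh (1 / 2 * h) * ((n : ℝ) ^ k * csch (n * h) * sech ((1 / 2 - n) * h)) := by
    refine Summable.mul_left _ (Summable.of_norm_bounded h1.abs fun n => ?_)
    rw [Real.norm_eq_abs, abs_mul _ (sech _), abs_of_pos (sech_pos _)]
    exact mul_le_of_le_one_right (abs_nonneg _) (sech_le_one _)
  refine (h3.add h2).congr fun n => ?_
  split_ifs with hn
  · subst hn; simp [csch_zero, coth_zero]
  · have hn' : (n : ℝ) * h ≠ 0 := mul_ne_zero (by exact_mod_cast hn) hh.ne'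
    rw [coth_add_tanh hn']
    have : (n : ℝ) * h + (1 / 2 - n) * h = 1 / 2 * h := by ring
    rw [this]; ring

lemma hasSum_coth_add_tanh {h : ℝ} (hh : 0 < h) (N : ℤ) :
    HasSum (fun n : ℤ => coth (n * h) + tanh (((N : ℝ) + 1 / 2 - n) * h)) (2 * N + 1) := by
  have step : ∀ M : ℤ, HasSum (fun n : ℤ => (coth (n * h) +
      tanh ((((M + 1 : ℤ) : ℝ) + 1 / 2 - n) * h)) -
      (coth (n * h) + tanh (((M : ℝ) + 1 / 2 - n) * h))) 2 := by
    intro M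
    convert hasSum_tanh_step_neg hh ((M : ℝ) + 1 / 2) using 2 with n
    push_cast
    have e1 : ((M : ℝ) + 1 + 1 / 2 - n) * h = ((M : ℝ) + 1 / 2 + 1 - n) * h := by ring
    rw [e1]; ring
  refine hasSum_int_of_step (s := fun N => 2 * (N : ℝ) + 1)
    (d := fun N n => coth (n * h) + tanh (((N : ℝ) + 1 / 2 - n) * h)) ?_ ?_ N
  · have hs := (summable_pow_mul_coth_add_tanh hh 0).hasSum
    simp only [pow_zero, one_mul] at hs
    set R := ∑' n : ℤ, (coth (n * h) + tanh ((1 / 2 - n) * h))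
    have h1 : HasSum (fun n : ℤ => coth (n * h) + tanh (((0 : ℤ) + 1 / 2 - n : ℝ) * h)) R := by
      simpa using hs
    have h2 := h1.sub (step (-1))
    have h3 := (Equiv.neg ℤ).hasSum_iff.mpr h1.neg
    have e : HasSum (fun n : ℤ => coth (n * h) + tanh (((0 : ℤ) + 1 / 2 - n : ℝ) * h) -
      ((coth (n * h) +
      tanh ((((-1 + 1 : ℤ) : ℝ) + 1 / 2 - n) * h)) -
      (coth (n * h) + tanh ((((-1 : ℤ) : ℝ) + 1 / 2 - n) * h)))) (-R) := by
      refine (congrArg (HasSum · (-R)) (funext fun n => ?_)).mpr h3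
      simp only [Function.comp, Equiv.neg_apply]
      push_cast
      have e1 : (0 + 1 / 2 - -(n : ℝ)) * h = -((-1 + 1 / 2 - (n : ℝ)) * h) := by ring
      rw [e1, tanh_neg, neg_mul, coth_neg]
      ring
    have : R = 1 := by linarith [h2.unique e]
    rw [this] at h1
    simpa using h1
  · intro M
    convert step M using 1
    push_cast; ring

/-- The constant in the evaluation of `∑ n (coth (n h) + tanh ((ν - n) h))`. -/
noncomputable def rho (h : ℝ) : ℝ :=
  ∑' n : ℤ, (n : ℝ) * (coth (n * h) + tanh ((1 / 2 - n) * h)) - 1 / 4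

lemma hasSum_mul_tanh_step {h : ℝ} (hh : 0 < h) :
    HasSum (fun k : ℤ => (k : ℝ) * (tanh (((k : ℝ) + 1 + 1 / 2) * h)
      - tanh (((k : ℝ) + 1 / 2) * h))) (-2) := by
  set e : ℤ → ℝ := fun k => tanh (((k : ℝ) + 1 + 1 / 2) * h) - tanh (((k : ℝ) + 1 / 2) * h)
    with he
  have h0 : HasSum e 2 := hasSum_tanh_step hh (1 / 2)
  have hs : Summable fun k : ℤ => (k : ℝ) * e k := by
    have h1 := (expDecay_sech.summable spaced_half hh (b := fun n : ℤ => (n : ℝ) / 2) (k := 1)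
      (fun n => ?_))
    · refine Summable.of_norm_bounded (h1.abs.mul_left (2 * |sinh h|)) fun k => ?_
      rw [he]
      simp only
      rw [tanh_sub_tanh, Real.norm_eq_abs]
      have : ((k : ℝ) + 1 + 1 / 2) * h - (k + 1 / 2) * h = h := by ring
      rw [this]
      simp only [abs_mul, abs_div, abs_two]
      have h2 : |sech (((k : ℝ) + 1 + 1 / 2) * h)| ≤ 1 := by
        rw [abs_of_pos (sech_pos _)]; exact sech_le_one _
      have h3 : 0 ≤ |(k : ℝ)| * |sinh h| * |sech (((k : ℝ) + 1 / 2) * h)| := by positivity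
      nlinarith
    · rw [pow_one, abs_div, abs_two]
      have := half_le_abs n
      have h3 : |(n : ℝ)| ≤ |(n : ℝ) + 1 / 2| + 1 / 2 := by
        have := abs_sub ((n : ℝ) + 1 / 2) (1 / 2)
        rw [add_sub_cancel_right] at this
        rwa [abs_of_pos (by norm_num : (0 : ℝ) < 1 / 2)] at this
      linarith
  have h1 := hs.hasSum
  set T := ∑' k : ℤ, (k : ℝ) * e k
  have h2 := (Equiv.subLeft (-2 : ℤ)).hasSum_iff.mpr h1
  have h3 : HasSum (fun k : ℤ => -2 * e k - k * e k) T := by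
    convert h2 using 2 with k
    simp only [Function.comp, Equiv.subLeft_apply, he]
    push_cast
    have e1 : ((-2 : ℝ) - k + 1 + 1 / 2) * h = -((k + 1 / 2) * h) := by ring
    have e2 : ((-2 : ℝ) - k + 1 / 2) * h = -((k + 1 + 1 / 2) * h) := by ring
    rw [e1, e2, tanh_neg, tanh_neg]; ring
  have h4 := h3.unique ((h0.mul_left (-2)).sub h1)
  have : T = -2 := by linarith
  rwa [this] at h1

lemma hasSum_mul_coth_add_tanh {h : ℝ} (hh : 0 < h) (N : ℤ) :
    HasSum (fun n : ℤ => n * (coth (n * h) + tanh (((N : ℝ) + 1 / 2 - n) * h)))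
      (((N : ℝ) + 1 / 2) ^ 2 + rho h) := by
  refine hasSum_int_of_step (s := fun N => ((N : ℝ) + 1 / 2) ^ 2 + rho h)
    (d := fun N n => n * (coth (n * h) + tanh (((N : ℝ) + 1 / 2 - n) * h))) ?_ ?_ N
  · have hs := (summable_pow_mul_coth_add_tanh hh 1).hasSum
    simp only [pow_one] at hs
    convert hs using 2
    · simp
    · unfold rho; push_cast; ring
  · intro M
    have h1 := ((hasSum_tanh_step hh (1 / 2)).mul_left (M : ℝ)).sub (hasSum_mul_tanh_step hh)
    have h2 := (Equiv.subLeft M).hasSum_iff.mpr h1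
    convert h2 using 1
    · rfl
    · funext n
      simp only [Function.comp, Equiv.subLeft_apply]
      push_cast
      have e1 : ((M : ℝ) - n + 1 + 1 / 2) * h = (M + 1 + 1 / 2 - n) * h := by ring
      have e2 : ((M : ℝ) - n + 1 / 2) * h = (M + 1 / 2 - n) * h := by ring
      rw [e1, e2]; ring
    · push_cast; ring

/-- The sign `(-1) ^ n`. -/
noncomputable def sgn (n : ℤ) : ℝ := (-1) ^ n

lemma sgn_add (m n : ℤ) : sgn (m + n) = sgn m * sgn n := zpow_add₀ (by norm_num) m n

lemma sgn_one : sgn 1 = -1 := by simp [sgn]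

lemma sgn_zero : sgn 0 = 1 := by simp [sgn]

lemma abs_sgn (n : ℤ) : |sgn n| = 1 := by simp [sgn, abs_zpow]

lemma sgn_neg (n : ℤ) : sgn (-n) = sgn n := by
  rw [sgn, sgn, zpow_neg, ← inv_zpow]; norm_num

lemma sgn_sub (m n : ℤ) : sgn (m - n) = sgn m * sgn n := by
  rw [sub_eq_add_neg, sgn_add, sgn_neg]

lemma sgn_mul_self (n : ℤ) : sgn n * sgn n = 1 := by
  rw [← sgn_sub, sub_self, sgn_zero]

/-- The coefficients `(-1) ^ n sech ((n + 1/2) h)`. -/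
noncomputable def sechCoeff (h : ℝ) (n : ℤ) : ℝ := sgn n * sech (((n : ℝ) + 1 / 2) * h)

/-- The coefficients `(-1) ^ n csch (n h)`. -/
noncomputable def cschCoeff (h : ℝ) (n : ℤ) : ℝ := sgn n * csch (((n : ℝ) + 0) * h)

lemma rapid_sechCoeff {h : ℝ} (hh : 0 < h) : Rapid (1 / 2) (sechCoeff h) :=
  expDecay_sech.rapid spaced_half hh (k := 0) fun n => by simp [abs_sgn]

lemma rapid_cschCoeff {h : ℝ} (hh : 0 < h) : Rapid 0 (cschCoeff h) :=
  expDecay_csch.rapid spaced_zero hh (k := 0) fun n => by simp [abs_sgn]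

lemma freq_neg (n : ℤ) : (((-1 - n : ℤ) : ℝ) + 1 / 2) = -((n : ℝ) + 1 / 2) := by
  push_cast; ring

lemma sechCoeff_neg (h : ℝ) (n : ℤ) : sechCoeff h (-1 - n) = -sechCoeff h n := by
  rw [sechCoeff, freq_neg, neg_mul, sech_neg, sgn_sub, sgn_neg, sgn_one, sechCoeff]; ring

lemma cschCoeff_neg (h : ℝ) (n : ℤ) : cschCoeff h (-n) = -cschCoeff h n := by
  rw [cschCoeff, cschCoeff, sgn_neg]
  push_cast
  rw [add_zero, add_zero, neg_mul, csch_neg]; ring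

lemma cschCoeff_zero (h : ℝ) : cschCoeff h 0 = 0 := by simp [cschCoeff, csch_zero]

lemma tsum_eq_zero_of_odd {F : ℤ → ℝ} (e : ℤ ≃ ℤ) (h : ∀ n, F (e n) = -F n) :
    ∑' n, F n = 0 := by
  have h1 : ∑' n, F n = -∑' n, F n := by
    conv_lhs => rw [← e.tsum_eq]
    rw [← tsum_neg]
    exact tsum_congr h
  linarith

lemma cosSeries_half_eq_zero {a : ℤ → ℝ} (h : ∀ n, a (-1 - n) = -a n) (x : ℝ) :
    cosSeries (1 / 2) a x = 0 :=
  tsum_eq_zero_of_odd (Equiv.subLeft (-1)) fun n => by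
    rw [Equiv.subLeft_apply, freq_neg, h, neg_mul (a n), neg_mul, cos_neg]

lemma cosSeries_zero_eq_zero {a : ℤ → ℝ} (h : ∀ n, a (-n) = -a n) (x : ℝ) :
    cosSeries 0 a x = 0 :=
  tsum_eq_zero_of_odd (Equiv.neg ℤ) fun n => by
    rw [Equiv.neg_apply, h]
    push_cast
    rw [add_zero, add_zero, neg_mul (a n), neg_mul (n : ℝ), cos_neg]

lemma sinSeries_zero_eq_zero {a : ℤ → ℝ} (h : ∀ n, a (-n) = a n) (x : ℝ) :
    sinSeries 0 a x = 0 :=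
  tsum_eq_zero_of_odd (Equiv.neg ℤ) fun n => by
    rw [Equiv.neg_apply, h]
    push_cast
    rw [add_zero, add_zero, neg_mul, sin_neg, mul_neg]

lemma summable_expTerm {θ : ℝ} {a : ℤ → ℝ} (ha : Summable fun n => |a n|) (x : ℝ) :
    Summable fun n : ℤ => (a n : ℂ) * Complex.exp ((((n : ℝ) + θ) * x : ℝ) * Complex.I) :=
  (summable_norm_expTerm ha x).of_norm

lemma expSeries_lincomb {θ : ℝ} {a b : ℤ → ℝ} (ha : Summable fun n => |a n|)
    (hb : Summable fun n => |b n|) (r s : ℝ) (x : ℝ) :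
    expSeries θ (fun n => r * a n + s * b n) x
      = r * expSeries θ a x + s * expSeries θ b x := by
  unfold expSeries
  rw [← tsum_mul_left, ← tsum_mul_left, ← Summable.tsum_add
    ((summable_expTerm ha x).mul_left _) ((summable_expTerm hb x).mul_left _)]
  refine tsum_congr fun n => ?_
  push_cast; ring

lemma expSeries_ite (S x : ℝ) : expSeries 0 (fun n => if n = 0 then S else 0) x = S := by
  unfold expSeries
  rw [tsum_eq_single 0]
  · simp
  · intro n hn; simp [hn]

lemma expSeries_shift (θ : ℝ) (a : ℤ → ℝ) (x : ℝ) :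
    expSeries (θ + 1) a x = expSeries θ (fun n => a (n - 1)) x := by
  unfold expSeries
  rw [← (Equiv.subRight (1 : ℤ)).tsum_eq]
  refine tsum_congr fun n => ?_
  simp only [Equiv.subRight_apply]
  push_cast
  congr 4; ring

/-- `∑ sech² ((n + 1/2) h)`. -/
noncomputable def sechSqSum (h : ℝ) : ℝ := ∑' n : ℤ, sech (((n : ℝ) + 1 / 2) * h) ^ 2

lemma expSeries_sechCoeff {h : ℝ} (hh : 0 < h) (x : ℝ) :
    expSeries (1 / 2) (sechCoeff h) x = sinSeries (1 / 2) (sechCoeff h) x * Complex.I := by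
  rw [expSeries_eq (rapid_sechCoeff hh).abs_summable, cosSeries_half_eq_zero (sechCoeff_neg h)]
  simp

lemma expSeries_cschCoeff {h : ℝ} (hh : 0 < h) (x : ℝ) :
    expSeries 0 (cschCoeff h) x = sinSeries 0 (cschCoeff h) x * Complex.I := by
  rw [expSeries_eq (rapid_cschCoeff hh).abs_summable, cosSeries_zero_eq_zero (cschCoeff_neg h)]
  simp

lemma expSeries_mul_cschCoeff {h : ℝ} (hh : 0 < h) (x : ℝ) :
    expSeries 0 (fun n => ((n : ℝ) + 0) * cschCoeff h n) x
      = cosSeries 0 (fun n => ((n : ℝ) + 0) * cschCoeff h n) x := by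
  rw [expSeries_eq (rapid_cschCoeff hh).mul_freq.abs_summable, sinSeries_zero_eq_zero]
  · simp
  · intro n
    rw [cschCoeff_neg]; push_cast; ring

lemma sechCoeff_conv {h : ℝ} (hh : 0 < h) (N : ℤ) :
    ∑' n : ℤ, sechCoeff h (N - 1 - n) * sechCoeff h n =
      (-2) * (((N : ℝ) + 0) * cschCoeff h N) + (-1) * (if N = 0 then sechSqSum h else 0) := by
  have key : ∀ n : ℤ, sechCoeff h (N - 1 - n) * sechCoeff h n = -sgn N *
      (sech (((N : ℝ) - n - 1 / 2) * h) * sech (((n : ℝ) + 1 / 2) * h)) := by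
    intro n
    rw [sechCoeff, sechCoeff, sgn_sub, sgn_sub, sgn_one]
    push_cast
    have : ((N : ℝ) - 1 - n + 1 / 2) * h = (N - n - 1 / 2) * h := by ring
    rw [this]
    linear_combination (-sgn N * sech (((N : ℝ) - n - 1 / 2) * h) *
      sech (((n : ℝ) + 1 / 2) * h)) * sgn_mul_self n
  rw [tsum_congr key, tsum_mul_left]
  split_ifs with hN
  · subst hN
    rw [cschCoeff_zero, sgn_zero, sechSqSum]
    have : ∀ n : ℤ, sech ((((0 : ℤ) : ℝ) - n - 1 / 2) * h) * sech (((n : ℝ) + 1 / 2) * h)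
        = sech (((n : ℝ) + 1 / 2) * h) ^ 2 := by
      intro n
      have : (((0 : ℤ) : ℝ) - n - 1 / 2) * h = -((n + 1 / 2) * h) := by push_cast; ring
      rw [this, sech_neg, sq]
    rw [tsum_congr this]; simp
  · have hN' : (N : ℝ) ≠ 0 := by exact_mod_cast hN
    have : ∀ n : ℤ, sech (((N : ℝ) - n - 1 / 2) * h) * sech (((n : ℝ) + 1 / 2) * h)
        = csch (N * h) * (tanh (((N : ℝ) - n - 1 / 2) * h) + tanh (((n : ℝ) + 1 / 2) * h)) := by
      intro n
      have e : ((N : ℝ) - n - 1 / 2) * h + ((n : ℝ) + 1 / 2) * h = N * h := by ring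
      rw [sech_mul_sech (by rw [e]; exact mul_ne_zero hN' hh.ne'), e]
    rw [tsum_congr this, tsum_mul_left, (hasSum_tanh_add hh N).tsum_eq, cschCoeff]
    simp only [add_zero]; ring

lemma mixed_term {h : ℝ} (hh : 0 < h) (N n : ℤ) (hn : n ≠ 0) :
    sechCoeff h (N - n) * cschCoeff h n = sechCoeff h N *
      (coth (n * h) + tanh (((N : ℝ) + 1 / 2 - n) * h)) := by
  have hn' : (n : ℝ) * h ≠ 0 := mul_ne_zero (by exact_mod_cast hn) hh.ne'
  rw [coth_add_tanh hn']
  have e : (n : ℝ) * h + (N + 1 / 2 - n) * h = (N + 1 / 2) * h := by ring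
  have e2 : (((N - n : ℤ) : ℝ) + 1 / 2) * h = (N + 1 / 2 - n) * h := by push_cast; ring
  have h1 : sech (((N : ℝ) + 1 / 2) * h) * cosh ((N + 1 / 2) * h) = 1 := by
    rw [sech, inv_mul_cancel₀ (cosh_pos _).ne']
  rw [e, sechCoeff, e2, cschCoeff, sechCoeff, sgn_sub, add_zero]
  linear_combination (sgn N * sech (((N : ℝ) + 1 / 2 - n) * h) * csch (n * h)) *
    (sgn_mul_self n) - (sgn N * sech (((N : ℝ) + 1 / 2 - n) * h) * csch (n * h)) * h1

lemma mixed_conv_freq {h : ℝ} (hh : 0 < h) (N : ℤ) :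
    ∑' n : ℤ, sechCoeff h (N - n) * (((n : ℝ) + 0) * cschCoeff h n) =
      1 * (((N : ℝ) + 1 / 2) * (((N : ℝ) + 1 / 2) * sechCoeff h N)) +
        rho h * sechCoeff h N := by
  have key : ∀ n : ℤ, sechCoeff h (N - n) * (((n : ℝ) + 0) * cschCoeff h n) =
      sechCoeff h N * (n * (coth (n * h) + tanh (((N : ℝ) + 1 / 2 - n) * h))) := by
    intro n
    rcases eq_or_ne n 0 with rfl | hn
    · simp
    · have := mixed_term hh N n hn
      rw [add_zero]
      linear_combination (n : ℝ) * this
  rw [tsum_congr key, tsum_mul_left, (hasSum_mul_coth_add_tanh hh N).tsum_eq]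
  ring

lemma mixed_conv {h : ℝ} (hh : 0 < h) (N : ℤ) :
    ∑' n : ℤ, sechCoeff h (N - n) * cschCoeff h n =
      2 * (((N : ℝ) + 1 / 2) * sechCoeff h N) +
        (-1) * (sechCoeff h N * tanh (((N : ℝ) + 1 / 2) * h)) := by
  have key : ∀ n : ℤ, sechCoeff h (N - n) * cschCoeff h n =
      sechCoeff h N * ((coth (n * h) + tanh (((N : ℝ) + 1 / 2 - n) * h)) -
        if n = 0 then tanh (((N : ℝ) + 1 / 2) * h) else 0) := by
    intro n
    split_ifs with hn
    · subst hn; simp [cschCoeff_zero, coth_zero]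
    · rw [mixed_term hh N n hn, sub_zero]
  rw [tsum_congr key, tsum_mul_left,
    ((hasSum_coth_add_tanh hh N).sub (hasSum_ite_eq (0 : ℤ) _)).tsum_eq]
  ring

lemma rapid_sechCoeff_mul_tanh {h : ℝ} (hh : 0 < h) :
    Rapid (1 / 2) fun n => sechCoeff h n * tanh (((n : ℝ) + 1 / 2) * h) := by
  intro k
  refine Summable.of_nonneg_of_le (fun n => by positivity) (fun n => ?_) (rapid_sechCoeff hh k)
  rw [abs_mul]
  gcongr
  exact mul_le_of_le_one_right (abs_nonneg _) (abs_tanh_le_one _)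

theorem sinSeries_sq {h : ℝ} (hh : 0 < h) (x : ℝ) :
    sinSeries (1 / 2) (sechCoeff h) x ^ 2 =
      sechSqSum h + 2 * cosSeries 0 (fun n => ((n : ℝ) + 0) * cschCoeff h n) x := by
  have hs := (rapid_sechCoeff hh).abs_summable
  have h1 := expSeries_mul (θ := 1 / 2) (η := 1 / 2) hs hs x
  have e : (1 / 2 + 1 / 2 : ℝ) = 0 + 1 := by norm_num
  rw [e, expSeries_shift, expSeries_sechCoeff hh] at h1
  simp only [sechCoeff_conv hh] at h1
  rw [expSeries_lincomb (rapid_cschCoeff hh).mul_freq.abs_summable ?_, expSeries_ite,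
    expSeries_mul_cschCoeff hh] at h1
  · have h2 : ((sinSeries (1 / 2) (sechCoeff h) x ^ 2 : ℝ) : ℂ) = ((sechSqSum h +
        2 * cosSeries 0 (fun n => ((n : ℝ) + 0) * cschCoeff h n) x : ℝ) : ℂ) := by
      push_cast at h1 ⊢
      linear_combination -h1 + (sinSeries (1 / 2) (sechCoeff h) x : ℂ) ^ 2 * Complex.I_sq
    exact_mod_cast h2
  · refine summable_of_ne_finset_zero (s := {0}) fun n hn => ?_
    simp at hn; simp [hn]

theorem sinSeries_mul_cosSeries {h : ℝ} (hh : 0 < h) (x : ℝ) :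
    sinSeries (1 / 2) (sechCoeff h) x * cosSeries 0 (fun n => ((n : ℝ) + 0) * cschCoeff h n) x =
      sinSeries (1 / 2) (fun n => ((n : ℝ) + 1 / 2) * (((n : ℝ) + 1 / 2) * sechCoeff h n)) x
        + rho h * sinSeries (1 / 2) (sechCoeff h) x := by
  have hs := (rapid_sechCoeff hh).abs_summable
  have hs2 := (rapid_sechCoeff hh).mul_freq.mul_freq.abs_summable
  have h1 := expSeries_mul (θ := 1 / 2) (η := 0) hs (rapid_cschCoeff hh).mul_freq.abs_summable x
  rw [add_zero, expSeries_sechCoeff hh, expSeries_mul_cschCoeff hh] at h1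
  simp only [mixed_conv_freq hh] at h1
  rw [expSeries_lincomb hs2 hs, expSeries_sechCoeff hh, expSeries_eq hs2,
    cosSeries_half_eq_zero] at h1
  · have h2 := congrArg Complex.im h1
    simpa using h2
  · intro n
    rw [freq_neg, sechCoeff_neg]; ring

theorem sinSeries_mul_sinSeries {h : ℝ} (hh : 0 < h) (x : ℝ) :
    sinSeries (1 / 2) (sechCoeff h) x * sinSeries 0 (cschCoeff h) x =
      cosSeries (1 / 2) (fun n => sechCoeff h n * tanh (((n : ℝ) + 1 / 2) * h)) x
       - 2 * cosSeries (1 / 2) (fun n => ((n : ℝ) + 1 / 2) * sechCoeff h n) x := by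
  have hs := (rapid_sechCoeff hh).abs_summable
  have hs2 := (rapid_sechCoeff hh).mul_freq.abs_summable
  have hs3 := (rapid_sechCoeff_mul_tanh hh).abs_summable
  have h1 := expSeries_mul (θ := 1 / 2) (η := 0) hs (rapid_cschCoeff hh).abs_summable x
  rw [add_zero, expSeries_sechCoeff hh, expSeries_cschCoeff hh] at h1
  simp only [mixed_conv hh] at h1
  rw [expSeries_lincomb hs2 hs3, expSeries_eq hs2, expSeries_eq hs3] at h1
  have h2 := congrArg Complex.re h1
  simp at h2 ⊢
  linarith

/-- The lattice sums `∑ (-1) ^ n ν ^ k φ (ν h)` over half-integers `ν = n + 1/2`. -/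
noncomputable def moment (k : ℕ) (φ : ℝ → ℝ) (h : ℝ) : ℝ :=
  ∑' n : ℤ, sgn n * ((n : ℝ) + 1 / 2) ^ k * φ (((n : ℝ) + 1 / 2) * h)

lemma hasDerivAt_moment {φ ψ : ℝ → ℝ} (hφ : ExpDecay φ) (hψ : ExpDecay ψ)
    (hd : ∀ t, HasDerivAt φ (ψ t) t) (k : ℕ) {h : ℝ} (hh : 0 < h) :
    HasDerivAt (moment k φ) (moment (k + 1) ψ h) h := by
  have := hφ.hasDerivAt_tsum hψ (fun t _ => hd t) spaced_half
    (b := fun n : ℤ => sgn n * ((n : ℝ) + 1 / 2) ^ k) (k := k)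
    (fun n => by rw [abs_mul, abs_sgn, one_mul, abs_pow]) hh
  refine this.congr_deriv (tsum_congr fun n => ?_)
  ring

/-- The elliptic sine series `f`. -/
noncomputable def ellF (h : ℝ) : ℝ → ℝ := sinSeries (1 / 2) (sechCoeff h)

/-- The derivative of `ellF h`. -/
noncomputable def ellF1 (h : ℝ) : ℝ → ℝ :=
  cosSeries (1 / 2) fun n => ((n : ℝ) + 1 / 2) * sechCoeff h n

/-- The zeta-like sine series with hyperbolic cosecant coefficients. -/
noncomputable def ellW (h : ℝ) : ℝ → ℝ := sinSeries 0 (cschCoeff h)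

/-- The first moment of the hyperbolic secant. -/
noncomputable def ellA (h : ℝ) : ℝ := moment 1 sech h

/-- The linear coefficient in the differential equation satisfied by `ellF h`. -/
noncomputable def ellB (h : ℝ) : ℝ := rho h + sechSqSum h / 2

lemma sin_freq_two_pi (n : ℤ) : sin (((n : ℝ) + 1 / 2) * (2 * π)) = 0 := by
  have : ((n : ℝ) + 1 / 2) * (2 * π) = ((2 * n + 1 : ℤ) : ℝ) * π := by push_cast; ring
  rw [this, sin_int_mul_pi]

lemma sin_int_two_pi (n : ℤ) : sin (((n : ℝ) + 0) * (2 * π)) = 0 := by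
  have : ((n : ℝ) + 0) * (2 * π) = ((2 * n : ℤ) : ℝ) * π := by push_cast; ring
  rw [this, sin_int_mul_pi]

lemma sinSeries_at_zero (θ : ℝ) (a : ℤ → ℝ) : sinSeries θ a 0 = 0 := by simp [sinSeries]

lemma cosSeries_at_zero (θ : ℝ) (a : ℤ → ℝ) : cosSeries θ a 0 = ∑' n, a n := by
  simp [cosSeries]

lemma sinSeries_half_two_pi (a : ℤ → ℝ) : sinSeries (1 / 2) a (2 * π) = 0 := by
  simp only [sinSeries, sin_freq_two_pi, mul_zero, tsum_zero]

lemma sinSeries_zero_two_pi (a : ℤ → ℝ) : sinSeries 0 a (2 * π) = 0 := by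
  simp only [sinSeries, sin_int_two_pi, mul_zero, tsum_zero]

lemma ellF_zero (h : ℝ) : ellF h 0 = 0 := sinSeries_at_zero _ _

lemma ellW_zero (h : ℝ) : ellW h 0 = 0 := sinSeries_at_zero _ _

lemma ellF1_zero (h : ℝ) : ellF1 h 0 = ellA h := by
  rw [ellF1, cosSeries_at_zero, ellA, moment]
  exact tsum_congr fun n => by rw [sechCoeff]; ring

lemma hasDerivAt_ellF {h : ℝ} (hh : 0 < h) (x : ℝ) : HasDerivAt (ellF h) (ellF1 h x) x :=
  (rapid_sechCoeff hh).hasDerivAt_sinSeries x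

lemma hasDerivAt_ellF1 {h : ℝ} (hh : 0 < h) (x : ℝ) :
    HasDerivAt (ellF1 h) (ellB h * ellF h x - ellF h x ^ 3 / 2) x := by
  refine ((rapid_sechCoeff hh).mul_freq.hasDerivAt_cosSeries x).congr_deriv ?_
  have h1 := sinSeries_sq hh x
  have h2 := sinSeries_mul_cosSeries hh x
  rw [ellB, ellF]
  linear_combination h2 + sinSeries (1 / 2) (sechCoeff h) x / 2 * h1

lemma hasDerivAt_ellW {h : ℝ} (hh : 0 < h) (x : ℝ) :
    HasDerivAt (ellW h) ((ellF h x ^ 2 - sechSqSum h) / 2) x := by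
  refine ((rapid_cschCoeff hh).hasDerivAt_sinSeries x).congr_deriv ?_
  have h1 := sinSeries_sq hh x
  rw [ellF]
  linear_combination - (1 / 2 : ℝ) * h1

lemma eq_of_hasDerivAt_zero {g : ℝ → ℝ} (hg : ∀ x, HasDerivAt g 0 x) (x y : ℝ) : g x = g y :=
  is_const_of_deriv_eq_zero (fun x => (hg x).differentiableAt) (fun x => (hg x).deriv) x y

lemma ellF1_sq {h : ℝ} (hh : 0 < h) (x : ℝ) :
    ellF1 h x ^ 2 = ellA h ^ 2 + ellB h * ellF h x ^ 2 - ellF h x ^ 4 / 4 := by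
  have key : ∀ x, HasDerivAt
      (fun x => ellF1 h x ^ 2 - ellB h * ellF h x ^ 2 + ellF h x ^ 4 / 4) 0 x := by
    intro x
    have h1 := hasDerivAt_ellF hh x
    have h2 := hasDerivAt_ellF1 hh x
    refine (((h2.pow 2).sub ((h1.pow 2).const_mul (ellB h))).add
      ((h1.pow 4).div_const 4)).congr_deriv ?_
    push_cast; ring
  have := eq_of_hasDerivAt_zero key x 0
  simp only [ellF_zero, ellF1_zero] at this
  linarith

/-- The `h`-derivative of `ellF`, expressed through `ellF`, `ellF1` and `ellW`. -/
noncomputable def ellFh (h x : ℝ) : ℝ :=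
  ellF1 h x * ellW h x + (2 * ellB h - sechSqSum h / 2) * ellF h x - ellF h x ^ 3 / 2

lemma ellFh_eq {h : ℝ} (hh : 0 < h) (x : ℝ) :
    ellFh h x = -sinSeries (1 / 2) (fun n => ((n : ℝ) + 1 / 2) *
      (sechCoeff h n * tanh (((n : ℝ) + 1 / 2) * h))) x := by
  have h1 := (rapid_sechCoeff_mul_tanh hh).hasDerivAt_cosSeries x
  have h2 : cosSeries (1 / 2) (fun n => sechCoeff h n * tanh (((n : ℝ) + 1 / 2) * h)) =
      fun x => ellF h x * ellW h x + 2 * ellF1 h x := by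
    funext y
    have := sinSeries_mul_sinSeries hh y
    rw [ellF, ellW, ellF1]; linarith
  rw [h2] at h1
  have h3 := ((hasDerivAt_ellF hh x).mul (hasDerivAt_ellW hh x)).add
    ((hasDerivAt_ellF1 hh x).const_mul 2)
  have h4 := h1.unique h3
  rw [h4, ellFh]; ring

lemma hasDerivAt_ellF_param {h : ℝ} (hh : 0 < h) (x : ℝ) :
    HasDerivAt (fun h => ellF h x) (ellFh h x) h := by
  have := expDecay_sech.hasDerivAt_tsum expDecay_sech_mul_tanh (fun t _ => hasDerivAt_sech t)
    spaced_half (b := fun n : ℤ => sgn n * sin (((n : ℝ) + 1 / 2) * x)) (k := 0)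
    (fun n => by rw [abs_mul, abs_sgn, one_mul, pow_zero]; exact abs_sin_le_one _) hh
  rw [ellFh_eq hh, sinSeries, ← tsum_neg]
  refine (this.congr_deriv (tsum_congr fun n => ?_)).congr_of_eventuallyEq
    (Filter.Eventually.of_forall fun h => tsum_congr fun n => ?_)
  · rw [sechCoeff]; ring
  · rw [sechCoeff]; ring

lemma hasDerivAt_ellA_moment {h : ℝ} (hh : 0 < h) (k : ℕ) :
    HasDerivAt (moment k sech) (-∑' n : ℤ, ((n : ℝ) + 1 / 2) ^ (k + 1) *
      (sechCoeff h n * tanh (((n : ℝ) + 1 / 2) * h))) h := by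
  refine (hasDerivAt_moment expDecay_sech expDecay_sech_mul_tanh hasDerivAt_sech k hh).congr_deriv
    ?_
  rw [moment, ← tsum_neg]
  exact tsum_congr fun n => by rw [sechCoeff]; ring

/-- The first three `x`-derivatives of `ellFh h`. -/
lemma ellFh_derivs {h : ℝ} (hh : 0 < h) :
    (-∑' n : ℤ, ((n : ℝ) + 1 / 2) ^ 2 * (sechCoeff h n * tanh (((n : ℝ) + 1 / 2) * h)) =
      (2 * ellB h - sechSqSum h) * ellA h) ∧
    (∑' n : ℤ, ((n : ℝ) + 1 / 2) ^ 4 * (sechCoeff h n * tanh (((n : ℝ) + 1 / 2) * h)) =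
      2 * ellA h * ellB h ^ 2 - 2 * ellA h * ellB h * sechSqSum h - 2 * ellA h ^ 3) := by
  set A := ellA h
  set B := ellB h with hB
  set S := sechSqSum h with hS
  have hr := rapid_sechCoeff_mul_tanh hh
  have d1 := fun x => (hr.mul_freq.hasDerivAt_sinSeries x).neg
  have d2 := fun x => (hr.mul_freq.mul_freq.hasDerivAt_cosSeries x).neg
  have d3 := fun x => hr.mul_freq.mul_freq.mul_freq.hasDerivAt_sinSeries x
  simp only [neg_neg] at d2
  have e0 : (fun x => ellF1 h x * ellW h x + (2 * B - S / 2) * ellF h x - ellF h x ^ 3 / 2) =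
      -sinSeries (1 / 2) (fun n => ((n : ℝ) + 1 / 2) *
      (sechCoeff h n * tanh (((n : ℝ) + 1 / 2) * h))) := funext (ellFh_eq hh)
  rw [← e0] at d1
  have e1 : ∀ x, -cosSeries (1 / 2) (fun n => ((n : ℝ) + 1 / 2) * (((n : ℝ) + 1 / 2) *
      (sechCoeff h n * tanh (((n : ℝ) + 1 / 2) * h)))) x =
      (B * ellF h x - ellF h x ^ 3 / 2) * ellW h x + (2 * B - S) * ellF1 h x
        - ellF h x ^ 2 * ellF1 h x := by
    intro x
    have f0 := hasDerivAt_ellF hh x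
    have f1 := hasDerivAt_ellF1 hh x
    have w0 := hasDerivAt_ellW hh x
    rw [(d1 x).unique (((f1.mul w0).add (f0.const_mul (2 * B - S / 2))).sub
      ((f0.pow 3).div_const 2))]
    rw [← hB, ← hS]; push_cast; ring
  rw [funext (f := -cosSeries (1 / 2) _) e1] at d2
  have e2 : ∀ x, sinSeries (1 / 2) (fun n => ((n : ℝ) + 1 / 2) * (((n : ℝ) + 1 / 2) *
      (((n : ℝ) + 1 / 2) * (sechCoeff h n * tanh (((n : ℝ) + 1 / 2) * h))))) x =
      (B * ellF1 h x - 3 / 2 * ellF h x ^ 2 * ellF1 h x) * ellW h x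
        + (B * ellF h x - ellF h x ^ 3 / 2) * ((ellF h x ^ 2 - S) / 2)
        + (2 * B - S) * (B * ellF h x - ellF h x ^ 3 / 2)
        - 2 * ellF h x * ellF1 h x ^ 2 - ellF h x ^ 2 * (B * ellF h x - ellF h x ^ 3 / 2) := by
    intro x
    have f0 := hasDerivAt_ellF hh x
    have f1 := hasDerivAt_ellF1 hh x
    have w0 := hasDerivAt_ellW hh x
    rw [(d2 x).unique ((((((f0.const_mul B).sub ((f0.pow 3).div_const 2)).mul w0).add
      (f1.const_mul (2 * B - S))).sub ((f0.pow 2).mul f1)))]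
    simp only [Pi.sub_apply, Pi.pow_apply]
    rw [← hB, ← hS]; push_cast; ring
  rw [funext e2] at d3
  constructor
  · have := e1 0
    rw [cosSeries_at_zero, ellF_zero, ellW_zero, ellF1_zero] at this
    refine (congrArg Neg.neg (tsum_congr fun n => ?_)).trans (this.trans (by ring))
    ring
  · have f0 := hasDerivAt_ellF hh 0
    have f1 := hasDerivAt_ellF1 hh 0
    have w0 := hasDerivAt_ellW hh 0
    have p := (f0.const_mul B).sub ((f0.pow 3).div_const 2)
    have := (d3 0).unique ((((((f1.const_mul B).sub
      (((f0.pow 2).const_mul (3 / 2)).mul f1)).mul w0).add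
      (p.mul (((f0.pow 2).sub_const S).div_const 2))).add
      (p.const_mul (2 * B - S))).sub ((f0.const_mul 2).mul (f1.pow 2)) |>.sub
      ((f0.pow 2).mul p))
    rw [cosSeries_at_zero] at this
    simp only [Pi.sub_apply, Pi.pow_apply, Pi.mul_apply, ellF_zero, ellW_zero, ellF1_zero] at this
    refine (tsum_congr fun n => ?_).trans (this.trans ?_)
    · ring
    · rw [← hB, ← hS]; push_cast; ring

lemma hasDerivAt_ellA {h : ℝ} (hh : 0 < h) :
    HasDerivAt ellA ((2 * ellB h - sechSqSum h) * ellA h) h :=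
  (hasDerivAt_ellA_moment hh 1).congr_deriv (ellFh_derivs hh).1

lemma moment_three {h : ℝ} (hh : 0 < h) : moment 3 sech h = -(ellA h * ellB h) := by
  have h1 := (rapid_sechCoeff hh).mul_freq.mul_freq.hasDerivAt_sinSeries 0
  have e : sinSeries (1 / 2) (fun n => ((n : ℝ) + 1 / 2) * (((n : ℝ) + 1 / 2) * sechCoeff h n))
      = fun x => -(ellB h * ellF h x - ellF h x ^ 3 / 2) := by
    funext x
    have := ((rapid_sechCoeff hh).mul_freq.hasDerivAt_cosSeries x).unique
      (hasDerivAt_ellF1 hh x)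
    linarith
  rw [e] at h1
  have f0 := hasDerivAt_ellF hh 0
  have h2 := h1.unique (((f0.const_mul (ellB h)).sub ((f0.pow 3).div_const 2)).neg)
  rw [cosSeries_at_zero, ellF_zero, ellF1_zero] at h2
  rw [moment]
  refine (tsum_congr fun n => ?_).trans (h2.trans (by push_cast; ring))
  rw [sechCoeff]; ring

lemma hasDerivAt_ellB {h : ℝ} (hh : 0 < h) (hA : ellA h ≠ 0) :
    HasDerivAt ellB (-(sechSqSum h * ellB h) - 2 * ellA h ^ 2) h := by
  have hA' := hasDerivAt_ellA hh
  have h1 := ((hasDerivAt_ellA_moment hh 3).neg).div hA' hA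
  have h2 : ellB =ᶠ[nhds h] fun h => (-moment 3 sech h) / ellA h := by
    filter_upwards [lt_mem_nhds hh, hA'.continuousAt.eventually_ne hA] with y hy hy2
    rw [moment_three hy]; field_simp
  refine (h1.congr_of_eventuallyEq h2).congr_deriv ?_
  simp only [Pi.neg_apply]
  rw [moment_three hh, neg_neg, (ellFh_derivs hh).2]
  field_simp; ring

lemma expDecay_sech_sq : ExpDecay fun t => sech t ^ 2 :=
  expDecay_of_le_sech (K := 1) fun t => by
    rw [abs_of_nonneg (sq_nonneg _), one_mul, sq]
    exact mul_le_of_le_one_left (sech_pos t).le (sech_le_one t)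

lemma expDecay_sech_sq_deriv : ExpDecay fun t => 2 * sech t * (-(sech t * tanh t)) :=
  expDecay_of_le_sech (K := 2) fun t => by
    rw [abs_mul, abs_mul, abs_neg, abs_mul, abs_two, abs_of_pos (sech_pos t)]
    have h1 := sech_pos t
    have h2 : sech t * |tanh t| ≤ 1 := mul_le_one₀ (sech_le_one t) (abs_nonneg _) (abs_tanh_le_one t)
    nlinarith

lemma hasDerivAt_sechSqSum {h : ℝ} (hh : 0 < h) :
    HasDerivAt sechSqSum (-2 * ellA h ^ 2 - sechSqSum h ^ 2 / 2) h := by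
  have hd := expDecay_sech_sq.hasDerivAt_tsum expDecay_sech_sq_deriv
    (fun t _ => ((hasDerivAt_sech t).pow 2).congr_deriv (by push_cast; ring)) spaced_half
    (b := fun _ => 1) (k := 0) (fun n => by simp) hh
  simp only [one_mul] at hd
  set Sd := ∑' n : ℤ, ((n : ℝ) + 1 / 2) * (2 * sech (((n : ℝ) + 1 / 2) * h) *
    (-(sech (((n : ℝ) + 1 / 2) * h) * tanh (((n : ℝ) + 1 / 2) * h)))) with hSd
  have hd' : HasDerivAt sechSqSum Sd h := hd
  set v : ℤ → ℝ := fun n => (sgn n * n) *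
    (fun t => -(csch t * coth t)) (((n : ℝ) + 0) * h) with hv
  have hvr : Rapid 0 v := expDecay_csch_mul_coth.rapid spaced_zero hh (k := 1)
    (fun n => by rw [abs_mul, abs_sgn]; simp)
  have hW : ∀ x, HasDerivAt (fun h => cosSeries 0 (fun n => ((n : ℝ) + 0) * cschCoeff h n) x)
      (cosSeries 0 (fun n => ((n : ℝ) + 0) * v n) x) h := by
    intro x
    have := expDecay_csch.hasDerivAt_tsum expDecay_csch_mul_coth (fun t ht => hasDerivAt_csch ht)
      spaced_zero (b := fun n : ℤ => sgn n * (n * cos (((n : ℝ) + 0) * x))) (k := 1)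
      (fun n => by
        rw [abs_mul, abs_sgn, one_mul, pow_one, abs_mul, add_zero]
        exact mul_le_of_le_one_right (abs_nonneg _) (abs_cos_le_one _)) hh
    refine (this.congr_deriv (tsum_congr fun n => ?_)).congr_of_eventuallyEq
      (Filter.Eventually.of_forall fun h => tsum_congr fun n => ?_)
    · simp only [hv]; ring
    · simp only [cschCoeff]; ring
  have hR : ∀ x, 2 * ellF h x * ellFh h x =
      Sd + 2 * cosSeries 0 (fun n => ((n : ℝ) + 0) * v n) x := by
    intro x
    have h1 := (hasDerivAt_ellF_param hh x).pow 2
    have h2 := hd'.add ((hW x).const_mul 2)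
    have h3 : (fun h => ellF h x ^ 2) =ᶠ[nhds h] fun h => sechSqSum h +
        2 * cosSeries 0 (fun n => ((n : ℝ) + 0) * cschCoeff h n) x := by
      filter_upwards [lt_mem_nhds hh] with y hy
      exact sinSeries_sq hy x
    have h4 := (h2.congr_of_eventuallyEq h3).unique h1
    push_cast at h4
    linarith
  set K := Sd + 2 * ellA h ^ 2 + sechSqSum h ^ 2 / 2 with hK
  have key : ∀ x, HasDerivAt (fun x => K * x + 2 * sinSeries 0 v x -
      (ellF h x ^ 2 * ellW h x + 2 * (ellF h x * ellF1 h x) - sechSqSum h * ellW h x)) 0 x := by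
    intro x
    have f0 := hasDerivAt_ellF hh x
    have f1 := hasDerivAt_ellF1 hh x
    have w0 := hasDerivAt_ellW hh x
    refine (((((hasDerivAt_id x).const_mul K).add
      ((hvr.hasDerivAt_sinSeries x).const_mul 2))).sub
      ((((f0.pow 2).mul w0).add ((f0.mul f1).const_mul 2)).sub
        (w0.const_mul (sechSqSum h)))).congr_deriv ?_
    have e1 := ellF1_sq hh x
    have e2 := hR x
    rw [ellFh] at e2
    simp only [Pi.pow_apply]
    push_cast
    linear_combination -e2 - 2 * e1 + hK
  have := eq_of_hasDerivAt_zero key (2 * π) 0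
  simp only [sinSeries_zero_two_pi, sinSeries_at_zero, ellF, ellW,
    sinSeries_half_two_pi] at this
  have hK0 : K = 0 := by
    have hpi := pi_pos
    have : K * (2 * π) = 0 := by linarith
    rcases mul_eq_zero.mp this with h0 | h0
    · exact h0
    · linarith
  refine hd'.congr_deriv ?_
  linarith

/-- Rational combinations of monomials of degree `d` in `ellA`, `ellB`, `sechSqSum`, of degree at
most `j` in `sechSqSum`, and whose degree outside `ellA` has the parity of `ε`. -/
noncomputable def gradedSpan (d j ε : ℕ) : Submodule ℚ (ℝ → ℝ) :=
  Submodule.span ℚ {g | ∃ a b e : ℕ, a + b + e = d ∧ e ≤ j ∧ (b + e) % 2 = ε % 2 ∧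
    g = fun h => ellA h ^ a * ellB h ^ b * sechSqSum h ^ e}

lemma monomial_mem {d j ε a b e : ℕ} (h1 : a + b + e = d) (h2 : e ≤ j)
    (h3 : (b + e) % 2 = ε % 2) :
    (fun h => ellA h ^ a * ellB h ^ b * sechSqSum h ^ e) ∈ gradedSpan d j ε :=
  Submodule.subset_span ⟨a, b, e, h1, h2, h3, rfl⟩

lemma gradedSpan_deriv {d j ε : ℕ} {g : ℝ → ℝ} (hg : g ∈ gradedSpan d j ε) :
    ∃ g' ∈ gradedSpan (d + 1) (j + 1) (ε + 1),
      ∀ h > 0, ellA h ≠ 0 → HasDerivAt g (g' h) h := by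
  induction hg using Submodule.span_induction with
  | mem g hg =>
    obtain ⟨a, b, e, h1, h2, h3, rfl⟩ := hg
    have m1 : (fun h => ellA h ^ a * ellB h ^ (b + 1) * sechSqSum h ^ e) ∈
        gradedSpan (d + 1) (j + 1) (ε + 1) := monomial_mem (by omega) (by omega) (by omega)
    have m2 : (fun h => ellA h ^ a * ellB h ^ b * sechSqSum h ^ (e + 1)) ∈
        gradedSpan (d + 1) (j + 1) (ε + 1) := monomial_mem (by omega) (by omega) (by omega)
    have m3 : (b : ℚ) • (fun h => ellA h ^ (a + 2) * ellB h ^ (b - 1) * sechSqSum h ^ e) ∈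
        gradedSpan (d + 1) (j + 1) (ε + 1) := by
      rcases Nat.eq_zero_or_pos b with rfl | hb
      · simp
      · exact Submodule.smul_mem _ _ (monomial_mem (by omega) (by omega) (by omega))
    have m4 : (e : ℚ) • (fun h => ellA h ^ (a + 2) * ellB h ^ b * sechSqSum h ^ (e - 1)) ∈
        gradedSpan (d + 1) (j + 1) (ε + 1) := by
      rcases Nat.eq_zero_or_pos e with rfl | he
      · simp
      · exact Submodule.smul_mem _ _ (monomial_mem (by omega) (by omega) (by omega))
    refine ⟨_, add_mem (add_mem (add_mem (Submodule.smul_mem _ (2 * a : ℚ) m1)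
      (Submodule.smul_mem _ (-(a + b + e / 2) : ℚ) m2)) (Submodule.smul_mem _ (-2 : ℚ) m3))
      (Submodule.smul_mem _ (-2 : ℚ) m4), fun h hh hA => ?_⟩
    refine ((((hasDerivAt_ellA hh).pow a).mul ((hasDerivAt_ellB hh hA).pow b)).mul
      ((hasDerivAt_sechSqSum hh).pow e)).congr_deriv ?_
    simp only [Pi.add_apply, Pi.smul_apply, Rat.smul_def, Pi.mul_apply, Pi.pow_apply]
    have e1 : (a : ℝ) * ellA h ^ (a - 1) * ellA h = a * ellA h ^ a := by
      cases a <;> simp [pow_succ]; ring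
    have e2 : (b : ℝ) * ellB h ^ (b - 1) * ellB h = b * ellB h ^ b := by
      cases b <;> simp [pow_succ]; ring
    have e3 : (e : ℝ) * sechSqSum h ^ (e - 1) * sechSqSum h = e * sechSqSum h ^ e := by
      cases e <;> simp [pow_succ]; ring
    push_cast
    linear_combination (2 * ellB h - sechSqSum h) * ellB h ^ b * sechSqSum h ^ e * e1
      - sechSqSum h * ellA h ^ a * sechSqSum h ^ e * e2
      - sechSqSum h / 2 * ellA h ^ a * ellB h ^ b * e3
  | zero => exact ⟨0, zero_mem _, fun h _ _ => hasDerivAt_const h 0⟩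
  | add x y _ _ hx hy =>
    obtain ⟨x', hx', hx⟩ := hx
    obtain ⟨y', hy', hy⟩ := hy
    exact ⟨_, add_mem hx' hy', fun h hh hA => (hx h hh hA).add (hy h hh hA)⟩
  | smul r x _ hx =>
    obtain ⟨x', hx', hx⟩ := hx
    refine ⟨_, Submodule.smul_mem _ r hx', fun h hh hA => ?_⟩
    have := (hx h hh hA).const_mul (r : ℝ)
    simp only [Pi.smul_apply, Rat.smul_def]
    exact this.congr_of_eventuallyEq (Filter.Eventually.of_forall fun y => by
      simp [Rat.smul_def])

lemma gradedSpan_eval {d j ε : ℕ} {g : ℝ → ℝ} (hg : g ∈ gradedSpan d j ε) {h : ℝ}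
    (hB : ellB h = 0) :
    g h ∈ Submodule.span ℚ {y : ℝ | ∃ i e : ℕ, i + e = d ∧ e ≤ j ∧ e % 2 = ε % 2 ∧
      y = ellA h ^ i * sechSqSum h ^ e} := by
  induction hg using Submodule.span_induction with
  | mem g hg =>
    obtain ⟨a, b, e, h1, h2, h3, rfl⟩ := hg
    rcases Nat.eq_zero_or_pos b with rfl | hb
    · exact Submodule.subset_span ⟨a, e, by omega, h2, by omega, by simp⟩
    · simp [hB, hb.ne']
  | zero => exact zero_mem _
  | add x y _ _ hx hy => exact add_mem hx hy
  | smul r x _ hx => exact Submodule.smul_mem _ r hx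

/-- Rational combinations of `ellA ^ (2 a) * ellB ^ b * ellF ^ (2 k + 1)` with
`2 a + b + k = l`. -/
noncomputable def oddSpan (l : ℕ) : Submodule ℚ (ℝ → ℝ → ℝ) :=
  Submodule.span ℚ {g | ∃ a b k : ℕ, 2 * a + b + k = l ∧
    g = fun h x => ellA h ^ (2 * a) * ellB h ^ b * ellF h x ^ (2 * k + 1)}

lemma oddMonomial_mem {l a b k : ℕ} (h1 : 2 * a + b + k = l) :
    (fun h x => ellA h ^ (2 * a) * ellB h ^ b * ellF h x ^ (2 * k + 1)) ∈ oddSpan l :=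
  Submodule.subset_span ⟨a, b, k, h1, rfl⟩

lemma oddSpan_deriv {l : ℕ} {g : ℝ → ℝ → ℝ} (hg : g ∈ oddSpan l) :
    ∃ g1 g2 : ℝ → ℝ → ℝ, g2 ∈ oddSpan (l + 1) ∧ (fun h => g1 h 0) ∈ gradedSpan (l + 1) 0 l ∧
      ∀ h > 0, ∀ x, HasDerivAt (g h) (g1 h x) x ∧ HasDerivAt (g1 h) (g2 h x) x := by
  induction hg using Submodule.span_induction with
  | mem g hg =>
    obtain ⟨a, b, k, h1, rfl⟩ := hg
    have m1 : (k : ℚ) • (fun h x => ellA h ^ (2 * (a + 1)) * ellB h ^ b *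
        ellF h x ^ (2 * (k - 1) + 1)) ∈ oddSpan (l + 1) := by
      rcases Nat.eq_zero_or_pos k with rfl | hk
      · simp
      · exact Submodule.smul_mem _ _ (oddMonomial_mem (by omega))
    have m2 : (fun h x => ellA h ^ (2 * a) * ellB h ^ (b + 1) * ellF h x ^ (2 * k + 1)) ∈
        oddSpan (l + 1) := oddMonomial_mem (by omega)
    have m3 : (fun h x => ellA h ^ (2 * a) * ellB h ^ b * ellF h x ^ (2 * (k + 1) + 1)) ∈
        oddSpan (l + 1) := oddMonomial_mem (by omega)
    refine ⟨fun h x => ellA h ^ (2 * a) * ellB h ^ b * ((2 * k + 1) * ellF h x ^ (2 * k)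
      * ellF1 h x), _, add_mem (add_mem (Submodule.smul_mem _ (2 * (2 * k + 1) : ℚ) m1)
      (Submodule.smul_mem _ ((2 * k + 1) ^ 2 : ℚ) m2))
      (Submodule.smul_mem _ (-((2 * k + 1) * (k + 1) / 2) : ℚ) m3), ?_, fun h hh x => ?_⟩
    · rcases Nat.eq_zero_or_pos k with rfl | hk
      · have := monomial_mem (d := l + 1) (j := 0) (ε := l) (a := 2 * a + 1) (b := b) (e := 0)
          (by omega) (by omega) (by omega)
        convert this using 2 with h
        simp only [ellF1_zero]; simp; ring
      · have : (fun h => ellA h ^ (2 * a) * ellB h ^ b * ((2 * (k : ℝ) + 1) *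
            ellF h 0 ^ (2 * k) * ellF1 h 0)) = 0 := by
          funext h; simp [ellF_zero, hk.ne']
        rw [this]; exact zero_mem _
    · have f0 := hasDerivAt_ellF hh x
      have f1 := hasDerivAt_ellF1 hh x
      constructor
      · refine ((f0.pow (2 * k + 1)).const_mul (ellA h ^ (2 * a) * ellB h ^ b)).congr_deriv ?_
        push_cast; simp
      · refine ((((f0.pow (2 * k)).const_mul (2 * (k : ℝ) + 1)).mul f1).const_mul
          (ellA h ^ (2 * a) * ellB h ^ b)).congr_deriv ?_
        simp only [Pi.add_apply, Pi.smul_apply, Rat.smul_def, Pi.pow_apply]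
        push_cast
        have e1 : (k : ℝ) * ellF h x ^ (2 * k - 1) = k * ellF h x ^ (2 * (k - 1) + 1) := by
          rcases Nat.eq_zero_or_pos k with rfl | hk
          · simp
          · rw [show 2 * k - 1 = 2 * (k - 1) + 1 by omega]
        have e2 : (k : ℝ) * ellF h x ^ (2 * (k - 1) + 1) * ellF h x = k * ellF h x ^ (2 * k) := by
          rcases Nat.eq_zero_or_pos k with rfl | hk
          · simp
          · rw [mul_assoc, ← pow_succ, show 2 * (k - 1) + 1 + 1 = 2 * k by omega]
        have e3 := ellF1_sq hh x
        linear_combination ellA h ^ (2 * a) * ellB h ^ b * (2 * k + 1) * (2 *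
          ellF1 h x ^ 2 * e1 + 2 * k * ellF h x ^ (2 * (k - 1) + 1) * e3
          + 2 * (ellB h * ellF h x - ellF h x ^ 3 / 4) * e2)
  | zero =>
    refine ⟨0, 0, zero_mem _, zero_mem _, fun h _ x => ⟨?_, ?_⟩⟩
    · exact hasDerivAt_const x 0
    · exact hasDerivAt_const x 0
  | add x y _ _ hx hy =>
    obtain ⟨x1, x2, hx2, hx1, hx⟩ := hx
    obtain ⟨y1, y2, hy2, hy1, hy⟩ := hy
    exact ⟨x1 + y1, x2 + y2, add_mem hx2 hy2, add_mem hx1 hy1, fun h hh t =>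
      ⟨(hx h hh t).1.add (hy h hh t).1, (hx h hh t).2.add (hy h hh t).2⟩⟩
  | smul r x _ hx =>
    obtain ⟨x1, x2, hx2, hx1, hx⟩ := hx
    refine ⟨r • x1, r • x2, Submodule.smul_mem _ _ hx2, Submodule.smul_mem _ r hx1,
      fun h hh t => ⟨?_, ?_⟩⟩
    · exact (hx h hh t).1.const_smul r
    · exact (hx h hh t).2.const_smul r

lemma rapid_pow_sechCoeff {h : ℝ} (hh : 0 < h) (k : ℕ) :
    Rapid (1 / 2) fun n => ((n : ℝ) + 1 / 2) ^ k * sechCoeff h n := by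
  induction k with
  | zero => simpa using rapid_sechCoeff hh
  | succ k ih =>
    have := ih.mul_freq
    convert this using 2 with n
    ring

lemma sinSeries_mem_oddSpan (l : ℕ) : ∃ g ∈ oddSpan l, ∀ h > 0, ∀ x,
    sinSeries (1 / 2) (fun n => ((n : ℝ) + 1 / 2) ^ (2 * l) * sechCoeff h n) x = g h x := by
  induction l with
  | zero =>
    refine ⟨_, oddMonomial_mem (a := 0) (b := 0) (k := 0) rfl, fun h hh x => ?_⟩
    simp [ellF]
  | succ l ih =>
    obtain ⟨g, hg, hg'⟩ := ih
    obtain ⟨g1, g2, hg2, -, hd⟩ := oddSpan_deriv hg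
    refine ⟨-g2, neg_mem hg2, fun h hh x => ?_⟩
    have d1 := fun x => (rapid_pow_sechCoeff hh (2 * l)).hasDerivAt_sinSeries x
    rw [funext (hg' h hh)] at d1
    have e1 := funext fun x => (d1 x).unique (hd h hh x).1
    have d2 := (rapid_pow_sechCoeff hh (2 * l)).mul_freq.hasDerivAt_cosSeries x
    rw [show cosSeries (1 / 2) (fun n : ℤ => ((n : ℝ) + 1 / 2) *
      (((n : ℝ) + 1 / 2) ^ (2 * l) * sechCoeff h n)) = g1 h from e1] at d2
    have e2 := d2.unique (hd h hh x).2
    simp only [Pi.neg_apply]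
    rw [← e2, neg_neg]
    congr 1
    funext n
    ring

/-- The lattice sum is, off the zeros of `ellA`, an element of `gradedSpan d j ε`. -/
def MomentMem (k : ℕ) (φ : ℝ → ℝ) (d j ε : ℕ) : Prop :=
  ∃ g ∈ gradedSpan d j ε, ∀ h > 0, ellA h ≠ 0 → moment k φ h = g h

lemma momentMem_sech (l : ℕ) : MomentMem (2 * l + 1) sech (l + 1) 0 l := by
  obtain ⟨g, hg, hg'⟩ := sinSeries_mem_oddSpan l
  obtain ⟨g1, g2, -, hg1, hd⟩ := oddSpan_deriv hg
  refine ⟨_, hg1, fun h hh _ => ?_⟩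
  have d1 := (rapid_pow_sechCoeff hh (2 * l)).hasDerivAt_sinSeries 0
  rw [funext (hg' h hh)] at d1
  have := d1.unique (hd h hh 0).1
  rw [cosSeries_at_zero] at this
  rw [← this, moment]
  exact tsum_congr fun n => by rw [sechCoeff]; ring

lemma MomentMem.deriv {k : ℕ} {φ ψ : ℝ → ℝ} {d j ε : ℕ} (hm : MomentMem k φ d j ε)
    (hφ : ExpDecay φ) (hψ : ExpDecay ψ) (hd : ∀ t, HasDerivAt φ (ψ t) t) :
    MomentMem (k + 1) ψ (d + 1) (j + 1) (ε + 1) := by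
  obtain ⟨g, hg, hg'⟩ := hm
  obtain ⟨g', hg1, hgd⟩ := gradedSpan_deriv hg
  refine ⟨g', hg1, fun h hh hA => ?_⟩
  have e : moment k φ =ᶠ[nhds h] g := by
    filter_upwards [lt_mem_nhds hh, (hasDerivAt_ellA hh).continuousAt.eventually_ne hA] with y h1 h2
    exact hg' y h1 h2
  exact (hasDerivAt_moment hφ hψ hd k hh).unique ((hgd h hh hA).congr_of_eventuallyEq e)

/-- The successive derivatives of the hyperbolic secant, up to order four. -/
noncomputable def sechD : ℕ → ℝ → ℝ
  | 0 => sech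
  | 1 => fun t => -(sech t * tanh t)
  | 2 => fun t => sech t - 2 * sech t ^ 3
  | 3 => fun t => -(sech t * tanh t) + 6 * (sech t ^ 3 * tanh t)
  | 4 => fun t => sech t - 20 * sech t ^ 3 + 24 * sech t ^ 5
  | _ => 0

lemma hasDerivAt_sechD {j : ℕ} (hj : j < 4) (t : ℝ) :
    HasDerivAt (sechD j) (sechD (j + 1) t) t := by
  have h1 := hasDerivAt_sech t
  have h2 := hasDerivAt_tanh t
  have h3 := tanh_sq_add_sech_sq t
  interval_cases j
  · exact h1
  · refine (h1.mul h2).neg.congr_deriv ?_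
    simp only [sechD]
    linear_combination sech t * h3
  · refine (h1.sub ((h1.pow 3).const_mul 2)).congr_deriv ?_
    simp only [sechD]; push_cast; ring
  · refine ((h1.mul h2).neg.add (((h1.pow 3).mul h2).const_mul 6)).congr_deriv ?_
    simp only [sechD, Pi.pow_apply]; push_cast
    linear_combination (sech t - 18 * sech t ^ 3) * h3

lemma expDecay_sechD (j : ℕ) : ExpDecay (sechD j) := by
  have hs := fun t => sech_pos t
  have h1 : ∀ t, sech t ^ 2 ≤ 1 := fun t => pow_le_one₀ (hs t).le (sech_le_one t)
  match j with
  | 0 => exact expDecay_sech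
  | 1 => exact expDecay_sech_mul_tanh
  | 2 =>
    refine expDecay_of_le_sech (K := 2) fun t => ?_
    have e : sechD 2 t = sech t * (1 - 2 * sech t ^ 2) := by simp only [sechD]; ring
    rw [e, abs_mul, abs_of_pos (hs t), mul_comm]
    refine mul_le_mul_of_nonneg_right (abs_le.mpr ?_) (hs t).le
    have := h1 t; have := sq_nonneg (sech t)
    constructor <;> linarith
  | 3 =>
    refine expDecay_of_le_sech (K := 7) fun t => ?_
    have e : sechD 3 t = sech t * ((6 * sech t ^ 2 - 1) * tanh t) := by simp only [sechD]; ring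
    rw [e, abs_mul, abs_of_pos (hs t), mul_comm]
    refine mul_le_mul_of_nonneg_right ?_ (hs t).le
    rw [abs_mul]
    refine (mul_le_of_le_one_right (abs_nonneg _) (abs_tanh_le_one t)).trans (abs_le.mpr ?_)
    have := h1 t; have := sq_nonneg (sech t)
    constructor <;> linarith
  | 4 =>
    refine expDecay_of_le_sech (K := 25) fun t => ?_
    have e : sechD 4 t = sech t * (1 - 20 * sech t ^ 2 + 24 * (sech t ^ 2) ^ 2) := by
      simp only [sechD]; ring
    rw [e, abs_mul, abs_of_pos (hs t), mul_comm]
    refine mul_le_mul_of_nonneg_right (abs_le.mpr ?_) (hs t).le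
    have := h1 t; have := sq_nonneg (sech t)
    constructor <;> nlinarith
  | _ + 5 => exact expDecay_of_le_sech (K := 0) fun t => by simp [sechD]

lemma momentMem_sechD (l j : ℕ) (hj : j ≤ 4) :
    MomentMem (2 * l + 1 + j) (sechD j) (l + 1 + j) j (l + j) := by
  induction j with
  | zero => exact momentMem_sech l
  | succ j ih =>
    have := (ih (by omega)).deriv (expDecay_sechD j) (expDecay_sechD (j + 1))
      (hasDerivAt_sechD (by omega))
    exact this

lemma moment_sechD_mem_span (l j : ℕ) (hj : j ≤ 4) (hA : ellA π ≠ 0) (hB : ellB π = 0) :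
    moment (2 * l + 1 + j) (sechD j) π ∈ Submodule.span ℚ {y : ℝ | ∃ i e : ℕ, i + e = l + 1 + j ∧
      e ≤ j ∧ e % 2 = (l + j) % 2 ∧ y = ellA π ^ i * sechSqSum π ^ e} := by
  obtain ⟨g, hg, hg'⟩ := momentMem_sechD l j hj
  rw [hg' π pi_pos hA]
  exact gradedSpan_eval hg hB

lemma tsum_int_eq_two_mul {F : ℤ → ℝ} (hF : Summable F) (h : ∀ n, F (-1 - n) = F n) :
    ∑' n : ℤ, F n = 2 * ∑' n : ℕ, F n := by
  have h1 : ∀ n : ℕ, F (-((n : ℤ) + 1)) = F n := fun n => by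
    rw [← h n]; congr 1; ring
  have h2 : Summable fun n : ℕ => F n := hF.comp_injective Nat.cast_injective
  rw [tsum_of_nat_of_neg_add_one h2 (by simpa only [h1] using h2)]
  simp only [h1]
  ring

lemma abs_cos_odd_mul_le (n : ℕ) (θ : ℝ) :
    |cos ((2 * n + 1) * θ)| ≤ (2 * n + 1) * |cos θ| := by
  induction n with
  | zero => simp
  | succ n ih =>
    have e : cos ((2 * ((n + 1 : ℕ) : ℝ) + 1) * θ)
        = 2 * (cos ((2 * n + 2) * θ) * cos θ) - cos ((2 * n + 1) * θ) := by
      have e1 : (2 * ((n + 1 : ℕ) : ℝ) + 1) * θ = (2 * n + 2) * θ + θ := by push_cast; ring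
      have e2 : (2 * (n : ℝ) + 1) * θ = (2 * n + 2) * θ - θ := by ring
      rw [e1, e2, cos_add, cos_sub]
      ring
    rw [e]
    have h3 : |cos ((2 * n + 2) * θ) * cos θ| ≤ |cos θ| := by
      rw [abs_mul]
      exact mul_le_of_le_one_left (abs_nonneg _) (abs_cos_le_one _)
    calc _ ≤ |2 * (cos ((2 * n + 2) * θ) * cos θ)| + |cos ((2 * n + 1) * θ)| := abs_sub _ _
      _ ≤ 2 * |cos θ| + (2 * n + 1) * |cos θ| := by
          rw [abs_mul, abs_two]; linarith
      _ = _ := by push_cast; ring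

lemma twenty_lt_exp_pi : 20 < exp π := by
  have h1 : exp 3 = exp 1 ^ 3 := by rw [← exp_nat_mul]; norm_num
  have h2 := exp_one_gt_d9
  have h3 : exp 3 ≤ exp π := exp_le_exp.mpr pi_gt_three.le
  have h4 : (2.7182818283 : ℝ) ^ 3 ≤ exp 1 ^ 3 := by gcongr
  have h5 : (20 : ℝ) < 2.7182818283 ^ 3 := by norm_num
  linarith

lemma sech_half_pi_le (n : ℕ) :
    sech (((n : ℝ) + 1 / 2) * π) ≤ 21 / 20 * (1 / 20) ^ n * sech (1 / 2 * π) := by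
  have hE := twenty_lt_exp_pi
  have h1 : exp (((n : ℝ) + 1 / 2) * π) = exp π ^ n * exp (1 / 2 * π) := by
    rw [← exp_nat_mul, ← exp_add]; ring_nf
  have h2 : exp (1 / 2 * π) * exp (1 / 2 * π) = exp π := by rw [← exp_add]; ring_nf
  have h3 : exp (-(1 / 2 * π)) * exp (1 / 2 * π) = 1 := by rw [← exp_add]; simp
  have h4 : (20 : ℝ) ^ n ≤ exp π ^ n := by gcongr
  have hc : cosh (1 / 2 * π) ≤ 21 / 20 * (exp (1 / 2 * π) / 2) := by
    rw [cosh_eq]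
    have : exp (-(1 / 2 * π)) ≤ exp (1 / 2 * π) / 20 := by
      rw [le_div_iff₀ (by norm_num)]
      nlinarith [exp_pos (1 / 2 * π), exp_pos (-(1 / 2 * π))]
    linarith
  have hd : exp π ^ n * (exp (1 / 2 * π) / 2) ≤ cosh (((n : ℝ) + 1 / 2) * π) := by
    rw [cosh_eq, h1]
    linarith [exp_pos (-(((n : ℝ) + 1 / 2) * π))]
  rw [sech, sech, one_div_pow, ← div_eq_mul_inv, mul_one_div, div_div, inv_eq_one_div,
    div_le_div_iff₀ (cosh_pos _) (by positivity), one_mul]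
  have h5 : (20 : ℝ) ^ n * (exp (1 / 2 * π) / 2) ≤ cosh (((n : ℝ) + 1 / 2) * π) :=
    le_trans (by gcongr) hd
  calc (20 : ℝ) ^ n * cosh (1 / 2 * π)
      ≤ 20 ^ n * (21 / 20 * (exp (1 / 2 * π) / 2)) := by gcongr
    _ ≤ _ := by linarith

lemma odd_sq_le (n : ℕ) : (2 * (n : ℝ) + 1) ^ 2 ≤ 9 ^ n := by
  have h : 2 * (n : ℝ) + 1 ≤ 3 ^ n := by
    have := one_add_mul_le_pow (a := (2 : ℝ)) (by norm_num) n
    norm_num at this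
    linarith
  calc _ ≤ ((3 : ℝ) ^ n) ^ 2 := by gcongr
    _ = 9 ^ n := by rw [← pow_mul, mul_comm, pow_mul]; norm_num

lemma ellF1_pi_eq (x : ℝ) : ellF1 π x = 2 * ∑' n : ℕ,
    (-1) ^ n * (((n : ℝ) + 1 / 2) * sech (((n : ℝ) + 1 / 2) * π) * cos (((n : ℝ) + 1 / 2) * x)) := by
  rw [ellF1, cosSeries, tsum_int_eq_two_mul]
  · congr 1
    refine tsum_congr fun n => ?_
    simp only [sechCoeff, sgn, Int.cast_natCast, zpow_natCast]
    ring
  · exact (rapid_sechCoeff pi_pos).mul_freq.summable_mul fun n => abs_cos_le_one _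
  · intro n
    rw [freq_neg, sechCoeff_neg, neg_mul _ x, cos_neg]
    ring

lemma ellF1_pi_pos {x : ℝ} (hx : x ∈ Set.Ico 0 π) : 0 < ellF1 π x := by
  rw [ellF1_pi_eq]
  have hcos : 0 < cos (x / 2) :=
    cos_pos_of_mem_Ioo ⟨by linarith [hx.1, pi_pos], by linarith [hx.2]⟩
  set c := 1 / 2 * sech (1 / 2 * π) * cos (x / 2) with hc
  have hc0 : 0 < c := by have := sech_pos (1 / 2 * π); positivity
  set T : ℕ → ℝ := fun n => (-1) ^ n *
    (((n : ℝ) + 1 / 2) * sech (((n : ℝ) + 1 / 2) * π) * cos (((n : ℝ) + 1 / 2) * x)) with hT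
  have hb : ∀ n, |T n| ≤ c * (21 / 20) * (9 / 20) ^ n := fun n => by
    have h1 := abs_cos_odd_mul_le n (x / 2)
    have e1 : (2 * (n : ℝ) + 1) * (x / 2) = ((n : ℝ) + 1 / 2) * x := by ring
    rw [e1, abs_of_pos hcos] at h1
    have h2 := sech_half_pi_le n
    have h3 := odd_sq_le n
    have h4 := sech_pos (1 / 2 * π)
    have h5 := sech_pos (((n : ℝ) + 1 / 2) * π)
    simp only [hT, abs_mul, abs_pow, abs_neg, abs_one, one_pow, one_mul]
    rw [abs_of_pos h5, abs_of_pos (by positivity)]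
    calc ((n : ℝ) + 1 / 2) * sech (((n : ℝ) + 1 / 2) * π) * |cos (((n : ℝ) + 1 / 2) * x)|
        ≤ ((n : ℝ) + 1 / 2) * (21 / 20 * (1 / 20) ^ n * sech (1 / 2 * π))
          * ((2 * n + 1) * cos (x / 2)) := by gcongr
      _ = c * (21 / 20) * (1 / 20) ^ n * (2 * n + 1) ^ 2 := by rw [hc]; ring
      _ ≤ c * (21 / 20) * (1 / 20) ^ n * 9 ^ n := by gcongr
      _ = c * (21 / 20) * (9 / 20) ^ n := by rw [mul_assoc, ← mul_pow]; norm_num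
  have hg : HasSum (fun n : ℕ => c * (21 / 20) * (9 / 20 : ℝ) ^ (n + 1))
      (c * (21 / 20) * (9 / 11)) := by
    have := (hasSum_geometric_of_lt_one (r := (9 / 20 : ℝ)) (by norm_num) (by norm_num)).mul_left
      (c * (21 / 20) * (9 / 20))
    rw [show (1 - 9 / 20 : ℝ)⁻¹ = 20 / 11 by norm_num] at this
    rw [show c * (21 / 20) * (9 / 11) = c * (21 / 20) * (9 / 20) * (20 / 11) by ring]
    refine (funext fun n => ?_ : (fun n : ℕ => c * (21 / 20) * (9 / 20 : ℝ) ^ (n + 1)) = _) ▸ this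
    ring
  have hs : Summable T := by
    refine Summable.of_norm_bounded (g := fun n => c * (21 / 20) * (9 / 20 : ℝ) ^ n) ?_ hb
    exact (summable_geometric_of_lt_one (by norm_num) (by norm_num)).mul_left _
  have h0 : T 0 = c := by
    have e : 1 / 2 * x = x / 2 := by ring
    simp only [hT, hc, Nat.cast_zero, pow_zero, zero_add, one_mul, e]
  have h1 : ‖∑' n, T (n + 1)‖ ≤ c * (21 / 20) * (9 / 11) :=
    tsum_of_norm_bounded hg fun n => hb (n + 1)
  rw [hs.tsum_eq_zero_add, h0]
  have h2 := (abs_le.mp (by simpa using h1 : |∑' n, T (n + 1)| ≤ c * (21 / 20) * (9 / 11))).1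
  linarith

lemma ellA_pi_pos : 0 < ellA π := by
  rw [← ellF1_zero]; exact ellF1_pi_pos ⟨le_rfl, pi_pos⟩

lemma ellF1_pi_pi : ellF1 π π = 0 := by
  rw [ellF1_pi_eq]
  have : ∀ n : ℕ, cos (((n : ℝ) + 1 / 2) * π) = 0 := fun n => by
    rw [cos_eq_zero_iff]; exact ⟨n, by push_cast; ring⟩
  simp only [this, mul_zero, tsum_zero]

lemma integral_Ioo_beta {α β : ℝ} (hα : 0 < α) (hβ : 0 < β) :
    ∫ y in Set.Ioo (0 : ℝ) 1, y ^ (α - 1) * (1 - y) ^ (β - 1)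
      = Gamma α * Gamma β / Gamma (α + β) := by
  have h1 := ProbabilityTheory.beta_eq_betaIntegralReal α β hα hβ
  rw [ProbabilityTheory.beta] at h1
  rw [h1, Complex.betaIntegral, intervalIntegral.integral_of_le zero_le_one,
    MeasureTheory.integral_Ioc_eq_integral_Ioo, ← Complex.ofReal_re
      (∫ y in Set.Ioo (0 : ℝ) 1, y ^ (α - 1) * (1 - y) ^ (β - 1)), ← integral_complex_ofReal]
  congr 1
  refine MeasureTheory.setIntegral_congr_fun measurableSet_Ioo fun y hy => ?_
  have h0 : 0 ≤ y := hy.1.le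
  have h2 : 0 ≤ 1 - y := by linarith [hy.2]
  push_cast [Complex.ofReal_cpow h0, Complex.ofReal_cpow h2]
  rfl

lemma gamma_three_quarters : Gamma (3 / 4) * Gamma (1 / 4) = π * √2 := by
  have h := Gamma_mul_Gamma_one_sub (1 / 4)
  rw [show (1 - 1 / 4 : ℝ) = 3 / 4 by norm_num, show π * (1 / 4) = π / 4 by ring,
    sin_pi_div_four] at h
  rw [mul_comm, h]
  have : √2 * √2 = 2 := mul_self_sqrt (by norm_num)
  have h2 : √2 ≠ 0 := by positivity
  field_simp
  linarith

/-- The lemniscatic evaluation of the first moment. -/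
theorem ellA_pi (hB : ellB π = 0) : ellA π = Gamma (1 / 4) ^ 4 / (16 * π ^ 3) := by
  have hsq : ∀ x, ellF1 π x ^ 2 = ellA π ^ 2 - ellF π x ^ 4 / 4 := fun x => by
    rw [ellF1_sq pi_pos, hB]; ring
  have hcont : Continuous (ellF π) :=
    continuous_iff_continuousAt.mpr fun x => (hasDerivAt_ellF pi_pos x).continuousAt
  have hmono : StrictMonoOn (ellF π) (Set.Icc 0 π) := by
    refine strictMonoOn_of_deriv_pos (convex_Icc _ _) hcont.continuousOn fun x hx => ?_
    rw [interior_Icc] at hx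
    rw [(hasDerivAt_ellF pi_pos x).deriv]
    exact ellF1_pi_pos ⟨hx.1.le, hx.2⟩
  have h0mem : (0 : ℝ) ∈ Set.Icc 0 π := ⟨le_rfl, pi_pos.le⟩
  have hpmem : π ∈ Set.Icc 0 π := ⟨pi_pos.le, le_rfl⟩
  set M := ellF π π with hM
  have hMpos : 0 < M := by
    have := hmono h0mem hpmem pi_pos
    rwa [ellF_zero] at this
  have hMA : M ^ 2 = 2 * ellA π := by
    have h1 := hsq π
    rw [ellF1_pi_pi, ← hM] at h1
    have h2 : (M ^ 2) ^ 2 = (2 * ellA π) ^ 2 := by linarith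
    exact (pow_left_inj₀ (by positivity) (by linarith [ellA_pi_pos]) two_ne_zero).mp h2
  have hpos : ∀ x ∈ Set.Ioo 0 π, 0 < ellF π x := fun x hx => by
    have := hmono h0mem ⟨hx.1.le, hx.2.le⟩ hx.1
    rwa [ellF_zero] at this
  have hφmono : StrictMonoOn (fun x => (ellF π x / M) ^ 4) (Set.Icc 0 π) := by
    intro x hx y hy hxy
    have h1 := hmono hx hy hxy
    have h2 : 0 ≤ ellF π x := by
      have := hmono.monotoneOn h0mem hx hx.1
      rwa [ellF_zero] at this
    simp only
    gcongr
  have himg : (fun x => (ellF π x / M) ^ 4) '' Set.Ioo 0 π = Set.Ioo 0 1 := by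
    rw [ContinuousOn.image_Ioo_of_strictMonoOn pi_pos.le _ hφmono]
    · simp [ellF_zero, ← hM, hMpos.ne']
    · exact ((hcont.div_const _).pow 4).continuousOn
  have hsub := MeasureTheory.integral_image_eq_integral_abs_deriv_smul
    (f := fun x => (ellF π x / M) ^ 4)
    (f' := fun x => 4 * (ellF π x / M) ^ 3 * (ellF1 π x / M)) (s := Set.Ioo 0 π) measurableSet_Ioo
    (fun x _ => by
      have := (((hasDerivAt_ellF pi_pos x).div_const M).pow 4).hasDerivWithinAt
        (s := Set.Ioo 0 π)
      refine this.congr_deriv ?_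
      push_cast; ring)
    (hφmono.injOn.mono Set.Ioo_subset_Icc_self)
    (fun y => y ^ ((1 / 4 : ℝ) - 1) * (1 - y) ^ ((1 / 2 : ℝ) - 1))
  rw [himg, integral_Ioo_beta (by norm_num) (by norm_num)] at hsub
  have hconst : ∀ x ∈ Set.Ioo 0 π, |4 * (ellF π x / M) ^ 3 * (ellF1 π x / M)| •
      (((ellF π x / M) ^ 4) ^ ((1 / 4 : ℝ) - 1) * (1 - (ellF π x / M) ^ 4) ^ ((1 / 2 : ℝ) - 1))
      = 2 * M := by
    intro x hx
    have hf := hpos x hx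
    have hf1 := ellF1_pi_pos ⟨hx.1.le, hx.2⟩
    have e1 : ((ellF π x / M) ^ 4) ^ ((1 / 4 : ℝ) - 1) = ((ellF π x / M) ^ 3)⁻¹ := by
      rw [← rpow_natCast, ← rpow_mul (by positivity), ← rpow_natCast, ← rpow_neg (by positivity)]
      norm_num
    have e2 : 1 - (ellF π x / M) ^ 4 = (2 * ellF1 π x / M ^ 2) ^ 2 := by
      have := hsq x
      have h3 : ellF π x ^ 4 = M ^ 4 - 4 * ellF1 π x ^ 2 := by
        have : M ^ 4 = 4 * ellA π ^ 2 := by rw [show M ^ 4 = (M ^ 2) ^ 2 by ring, hMA]; ring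
        linarith
      rw [div_pow, h3]
      field_simp
      ring
    have e3 : ((2 * ellF1 π x / M ^ 2) ^ 2) ^ ((1 / 2 : ℝ) - 1) = (2 * ellF1 π x / M ^ 2)⁻¹ := by
      rw [← rpow_natCast, ← rpow_mul (by positivity)]
      norm_num
      rw [rpow_neg_one, inv_div]
    rw [e1, e2, e3, abs_of_pos (by positivity), smul_eq_mul]
    field_simp
    ring
  rw [MeasureTheory.setIntegral_congr_fun measurableSet_Ioo hconst] at hsub
  have h34 := gamma_three_quarters
  have hG := Gamma_pos_of_pos (show (0 : ℝ) < 1 / 4 by norm_num)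
  have hG3 := Gamma_pos_of_pos (show (0 : ℝ) < 3 / 4 by norm_num)
  rw [show (1 / 4 + 1 / 2 : ℝ) = 3 / 4 by norm_num, Gamma_one_half_eq] at hsub
  simp only [MeasureTheory.setIntegral_const, MeasureTheory.measureReal_def, Real.volume_Ioo,
    sub_zero, ENNReal.toReal_ofReal pi_pos.le, smul_eq_mul] at hsub
  rw [div_eq_iff hG3.ne'] at hsub
  have h5 : Gamma (1 / 4) ^ 2 * √π = π * (2 * M) * (π * √2) := by
    rw [← h34]
    linear_combination Gamma (1 / 4) * hsub
  have h6 : Gamma (1 / 4) ^ 4 * π = 8 * π ^ 4 * M ^ 2 := by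
    have hp : √π ^ 2 = π := sq_sqrt pi_pos.le
    have h2 : √2 ^ 2 = 2 := sq_sqrt (by norm_num)
    calc Gamma (1 / 4) ^ 4 * π = (Gamma (1 / 4) ^ 2 * √π) ^ 2 := by rw [mul_pow, hp]; ring
      _ = π ^ 4 * 4 * M ^ 2 * √2 ^ 2 := by rw [h5]; ring
      _ = _ := by rw [h2]; ring
  rw [hMA] at h6
  have hpi := pi_pos
  rw [eq_div_iff (by positivity)]
  have : π * (ellA π * (16 * π ^ 3) - Gamma (1 / 4) ^ 4) = 0 := by linarith
  rcases mul_eq_zero.mp this with h | h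
  · exact absurd h hpi.ne'
  · linarith

open MeasureTheory Filter Topology

lemma integral_two_mul_div {τ : ℝ} (hτ : 0 < τ) :
    Integrable (fun s : ℝ => 2 * τ / (s ^ 2 + τ ^ 2)) ∧
      ∫ s : ℝ, 2 * τ / (s ^ 2 + τ ^ 2) = 2 * π := by
  have e : ∀ s : ℝ, 2 * τ / (s ^ 2 + τ ^ 2) = 2 / τ * (1 + (τ⁻¹ * s) ^ 2)⁻¹ := fun s => by
    have : s ^ 2 + τ ^ 2 ≠ 0 := by positivity
    have : 1 + (τ⁻¹ * s) ^ 2 ≠ 0 := by positivity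
    field_simp
    ring
  simp only [e]
  refine ⟨(integrable_inv_one_add_sq.comp_mul_left' (inv_ne_zero hτ.ne')).const_mul _, ?_⟩
  rw [integral_const_mul, Measure.integral_comp_mul_left (fun x : ℝ => (1 + x ^ 2)⁻¹),
    integral_univ_inv_one_add_sq, inv_inv, abs_of_pos hτ, smul_eq_mul]
  field_simp

lemma norm_mul_I_sub_ge (s τ : ℝ) :
    |s| ≤ ‖(s : ℂ) * Complex.I - τ‖ ∧ |τ| ≤ ‖(s : ℂ) * Complex.I - τ‖ := by
  constructor
  · simpa using Complex.abs_im_le_norm ((s : ℂ) * Complex.I - τ)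
  · simpa using Complex.abs_re_le_norm ((s : ℂ) * Complex.I - τ)

lemma norm_mul_I_sub_mul_ge (s : ℝ) {τ : ℝ} (hτ : 0 < τ) :
    min τ 1 * (1 + s ^ 2) ≤ (1 + |s|) * ‖(s : ℂ) * Complex.I - τ‖ := by
  obtain ⟨h1, h2⟩ := norm_mul_I_sub_ge s τ
  rw [abs_of_pos hτ] at h2
  have h3 : s ^ 2 = |s| * |s| := by rw [← sq, sq_abs]
  have h4 : |s| * |s| ≤ |s| * ‖(s : ℂ) * Complex.I - τ‖ := by gcongr
  have h5 : min τ 1 * s ^ 2 ≤ 1 * s ^ 2 := by gcongr; exact min_le_right _ _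
  have h6 := min_le_left τ 1
  nlinarith

lemma integrable_of_norm_le_inv_one_add_sq {E : Type*} [NormedAddCommGroup E] {f : ℝ → E}
    (hf : Continuous f) {C : ℝ} (h : ∀ s, ‖f s‖ ≤ C * (1 + s ^ 2)⁻¹) : Integrable f :=
  (integrable_inv_one_add_sq.const_mul C).mono' hf.aestronglyMeasurable (Eventually.of_forall h)

lemma continuous_comp_mul_I {G : ℂ → ℂ} (hc : ContinuousOn G {σ | 0 ≤ σ.re}) :
    Continuous fun s : ℝ => G (s * Complex.I) :=
  hc.comp_continuous (by fun_prop) fun s => by simp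

lemma mul_I_sub_ne_zero (s : ℝ) {τ : ℝ} (hτ : 0 < τ) : (s : ℂ) * Complex.I - τ ≠ 0 := by
  intro h
  have := congrArg Complex.re h
  simp at this
  exact hτ.ne' this

lemma integrable_div_mul_I_sub {G : ℂ → ℂ} (hc : ContinuousOn G {σ | 0 ≤ σ.re}) {C : ℝ}
    (hb : ∀ σ : ℂ, 0 ≤ σ.re → ‖G σ‖ ≤ C / (1 + ‖σ‖)) {τ : ℝ} (hτ : 0 < τ) :
    Integrable fun s : ℝ => G (s * Complex.I) / (s * Complex.I - τ) := by
  have hC : 0 ≤ C := by simpa using (norm_nonneg _).trans (hb 0 le_rfl)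
  refine integrable_of_norm_le_inv_one_add_sq (C := C * (min τ 1)⁻¹)
    ((continuous_comp_mul_I hc).div (by fun_prop) fun s => mul_I_sub_ne_zero s hτ) fun s => ?_
  have h1 := hb (s * Complex.I) (by simp)
  rw [norm_mul, Complex.norm_I, mul_one, Complex.norm_real, norm_eq_abs] at h1
  have h2 := norm_mul_I_sub_mul_ge s hτ
  have hm : 0 < min τ 1 := lt_min hτ one_pos
  have h3 : 0 < ‖(s : ℂ) * Complex.I - τ‖ := norm_pos_iff.mpr (mul_I_sub_ne_zero s hτ)
  rw [norm_div]
  calc _ ≤ C / (1 + |s|) / ‖(s : ℂ) * Complex.I - τ‖ := by gcongr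
    _ = C / ((1 + |s|) * ‖(s : ℂ) * Complex.I - τ‖) := by rw [div_div]
    _ ≤ C / (min τ 1 * (1 + s ^ 2)) := by gcongr
    _ = _ := by rw [div_eq_mul_inv, mul_inv, mul_assoc]

/-- Cauchy's formula for the right half-plane. -/
theorem integral_halfPlane {G : ℂ → ℂ} (hd : DifferentiableOn ℂ G {σ | 0 < σ.re})
    (hc : ContinuousOn G {σ | 0 ≤ σ.re}) {C : ℝ}
    (hb : ∀ σ : ℂ, 0 ≤ σ.re → ‖G σ‖ ≤ C / (1 + ‖σ‖)) {τ : ℝ} (hτ : 0 < τ) :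
    ∫ s : ℝ, G (s * Complex.I) / (τ - s * Complex.I) = 2 * π * G τ := by
  have hC : 0 ≤ C := by simpa using (norm_nonneg _).trans (hb 0 le_rfl)
  set F : ℂ → ℂ := fun σ => G σ - G τ * (2 * τ / (σ + τ)) with hF
  have hadd : ∀ σ : ℂ, 0 ≤ σ.re → σ + τ ≠ 0 := fun σ hσ h => by
    have := congrArg Complex.re h
    simp at this
    linarith
  have hFτ : F τ = 0 := by
    have : (τ : ℂ) ≠ 0 := by exact_mod_cast hτ.ne'
    simp only [hF]
    field_simp
    ring
  have hopen : IsOpen {σ : ℂ | 0 < σ.re} := isOpen_lt continuous_const Complex.continuous_re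
  have hmem : {σ : ℂ | 0 < σ.re} ∈ 𝓝 (τ : ℂ) := hopen.mem_nhds (by simpa using hτ)
  have hmem' : {σ : ℂ | 0 ≤ σ.re} ∈ 𝓝 (τ : ℂ) :=
    mem_of_superset hmem fun σ (hσ : 0 < σ.re) => hσ.le
  have hFd : DifferentiableOn ℂ F {σ | 0 < σ.re} :=
    hd.sub (DifferentiableOn.const_mul (DifferentiableOn.div (by fun_prop) (by fun_prop)
      fun σ hσ => hadd σ (le_of_lt hσ)) _)
  have hFc : ContinuousOn F {σ | 0 ≤ σ.re} :=
    hc.sub (ContinuousOn.mul continuousOn_const (ContinuousOn.div (by fun_prop) (by fun_prop)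
      fun σ hσ => hadd σ hσ))
  have hDd : DifferentiableOn ℂ (dslope F τ) {σ | 0 < σ.re} :=
    (Complex.differentiableOn_dslope hmem).mpr hFd
  have hDc : ContinuousOn (dslope F τ) {σ | 0 ≤ σ.re} :=
    (continuousOn_dslope hmem').mpr ⟨hFc, hFd.differentiableAt hmem⟩
  have hD : ∀ σ : ℂ, σ - τ ≠ 0 → dslope F τ σ = F σ / (σ - τ) := fun σ hσ => by
    rw [dslope_of_ne _ (sub_ne_zero.mp hσ), slope_def_field, hFτ, sub_zero]
  set C1 := C + 2 * τ * ‖G τ‖ with hC1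
  have hC1' : 0 ≤ C1 := by positivity
  have hFb : ∀ σ : ℂ, 0 ≤ σ.re → 0 < ‖σ‖ → ‖F σ‖ ≤ C1 / ‖σ‖ := fun σ hσ h0 => by
    have h1 : ‖σ‖ ≤ ‖σ + τ‖ := by
      rw [← abs_of_nonneg (norm_nonneg σ), ← abs_of_nonneg (norm_nonneg (σ + τ)), ← sq_le_sq,
        Complex.sq_norm, Complex.sq_norm, Complex.normSq_apply, Complex.normSq_apply]
      simp
      nlinarith
    have h2 : ‖G σ‖ ≤ C / ‖σ‖ := (hb σ hσ).trans (by gcongr; linarith)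
    have h3 : ‖G τ * (2 * τ / (σ + τ))‖ ≤ 2 * τ * ‖G τ‖ / ‖σ‖ := by
      rw [norm_mul, norm_div, norm_mul, Complex.norm_real, Complex.norm_two,
        norm_of_nonneg hτ.le, ← mul_div_assoc, mul_comm ‖G τ‖]
      gcongr
    calc _ ≤ ‖G σ‖ + ‖G τ * (2 * τ / (σ + τ))‖ := norm_sub_le _ _
      _ ≤ C / ‖σ‖ + 2 * τ * ‖G τ‖ / ‖σ‖ := add_le_add h2 h3
      _ = _ := by rw [hC1, add_div]
  have hDb : ∀ R : ℝ, 2 * τ ≤ R → ∀ σ : ℂ, 0 ≤ σ.re → R ≤ ‖σ‖ →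
      ‖dslope F τ σ‖ ≤ 2 * C1 / R ^ 2 := fun R hR σ hσ hn => by
    have hR0 : 0 < R := by linarith
    have h1 : R / 2 ≤ ‖σ - τ‖ := by
      have := norm_sub_norm_le σ (τ : ℂ)
      rw [Complex.norm_real, norm_of_nonneg hτ.le] at this
      linarith
    rw [hD σ (norm_pos_iff.mp (by linarith)), norm_div]
    calc _ ≤ C1 / ‖σ‖ / ‖σ - τ‖ := by gcongr; exact hFb σ hσ (by linarith)
      _ ≤ C1 / R / (R / 2) := by gcongr
      _ = _ := by field_simp
  have hleft : ∀ R : ℝ, 2 * τ ≤ R →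
      ‖∫ s in (-R)..R, dslope F τ (s * Complex.I)‖ ≤ 8 * C1 / R := fun R hR => by
    have hR0 : 0 < R := by linarith
    have hrect := Complex.integral_boundary_rect_eq_zero_of_continuousOn_of_differentiableOn
      (dslope F τ) (⟨0, -R⟩ : ℂ) (⟨R, R⟩ : ℂ)
      (hDc.mono fun σ hσ => by
        have := hσ.1
        simp only [Set.mem_preimage, Set.uIcc_of_le hR0.le] at this
        exact this.1)
      (hDd.mono fun σ hσ => by
        have := hσ.1
        simp only [Set.mem_preimage, min_eq_left hR0.le] at this
        exact this.1)
    simp only [Complex.ofReal_zero, zero_add] at hrect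
    have hb1 : ∀ x ∈ Set.uIoc 0 R, ∀ y : ℝ, |y| = R →
        ‖dslope F τ ((x : ℂ) + y * Complex.I)‖ ≤ 2 * C1 / R ^ 2 := fun x hx y hy => by
      rw [Set.uIoc_of_le hR0.le] at hx
      refine hDb R hR _ (by simpa using hx.1.le) ?_
      have := Complex.abs_im_le_norm ((x : ℂ) + y * Complex.I)
      simp only [Complex.add_im, Complex.ofReal_im, Complex.mul_im, Complex.ofReal_re,
        Complex.I_im, mul_one, Complex.I_re, mul_zero, add_zero, zero_add, hy] at this
      exact this
    have hn1 := intervalIntegral.norm_integral_le_of_norm_le_const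
      fun x hx => hb1 x hx (-R) (by rw [abs_neg, abs_of_pos hR0])
    have hn2 := intervalIntegral.norm_integral_le_of_norm_le_const
      fun x hx => hb1 x hx R (abs_of_pos hR0)
    have hn3 : ‖∫ y in (-R)..R, dslope F τ ((R : ℂ) + y * Complex.I)‖
        ≤ 2 * C1 / R ^ 2 * |R - -R| :=
      intervalIntegral.norm_integral_le_of_norm_le_const fun y _ => by
        refine hDb R hR _ (by simpa using hR0.le) ?_
        have := Complex.abs_re_le_norm ((R : ℂ) + y * Complex.I)
        simpa [abs_of_pos hR0] using this
    rw [sub_zero, abs_of_pos hR0] at hn1 hn2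
    rw [show R - -R = 2 * R by ring, abs_of_pos (by positivity)] at hn3
    have key := eq_of_sub_eq_zero hrect
    have : ‖Complex.I • ∫ s in (-R)..R, dslope F τ (s * Complex.I)‖ ≤ 8 * C1 / R := by
      rw [← key]
      refine (norm_add_le _ _).trans ((add_le_add (norm_sub_le _ _) le_rfl).trans ?_)
      rw [norm_smul, Complex.norm_I, one_mul]
      refine (add_le_add (add_le_add hn1 hn2) hn3).trans (le_of_eq ?_)
      field_simp
      ring
    rwa [norm_smul, Complex.norm_I, one_mul] at this
  have hsplit : ∀ s : ℝ, dslope F τ (s * Complex.I) = G (s * Complex.I) / (s * Complex.I - τ)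
      + G τ * ((2 * τ / (s ^ 2 + τ ^ 2) : ℝ) : ℂ) := fun s => by
    have h1 := mul_I_sub_ne_zero s hτ
    have h2 := hadd (s * Complex.I) (by simp)
    have h3 : ((s : ℂ) ^ 2 + τ ^ 2) = -((s * Complex.I - τ) * (s * Complex.I + τ)) := by
      ring_nf; rw [Complex.I_sq]; ring
    rw [hD _ h1]
    push_cast
    rw [h3]
    simp only [hF]
    field_simp
    ring
  obtain ⟨hi2, hv2⟩ := integral_two_mul_div hτ
  have hi1 := integrable_div_mul_I_sub hc hb hτ
  have hi2' : Integrable fun s : ℝ => G τ * ((2 * τ / (s ^ 2 + τ ^ 2) : ℝ) : ℂ) :=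
    (hi2.ofReal (𝕜 := ℂ)).const_mul (G τ)
  have hint : Integrable fun s : ℝ => dslope F τ (s * Complex.I) := by
    simp only [hsplit]
    exact hi1.add hi2'
  have hlim := intervalIntegral_tendsto_integral hint tendsto_neg_atTop_atBot tendsto_id
  have hzero : ∫ s : ℝ, dslope F τ (s * Complex.I) = 0 := by
    refine tendsto_nhds_unique hlim (squeeze_zero_norm' (a := fun R => 8 * C1 / R) ?_ ?_)
    · filter_upwards [eventually_ge_atTop (2 * τ)] with R hR using hleft R hR
    · exact tendsto_const_nhds.div_atTop tendsto_id
  simp only [hsplit] at hzero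
  rw [integral_add hi1 hi2', integral_const_mul, integral_complex_ofReal, hv2] at hzero
  have hneg : ∀ s : ℝ, G (s * Complex.I) / (τ - s * Complex.I)
      = -(G (s * Complex.I) / (s * Complex.I - τ)) := fun s => by
    rw [← neg_sub, div_neg]
  simp only [hneg]
  rw [integral_neg]
  push_cast at hzero
  linear_combination -hzero

/-- The positive zeros of the cosine. -/
noncomputable def node (n : ℕ) : ℝ := ((n : ℝ) + 1 / 2) * π

lemma succ_le_node (n : ℕ) : (n : ℝ) + 1 ≤ node n := by
  have := pi_gt_three
  have h : (0 : ℝ) ≤ n := n.cast_nonneg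
  rw [node]
  nlinarith

lemma node_pos (n : ℕ) : 0 < node n := by
  have := pi_pos
  rw [node]
  positivity

/-- The principal parts of the secant at `±t`, in the variable `σ = w ^ 2`. -/
noncomputable def polePart (t : ℝ) (σ : ℂ) : ℂ := 2 * t / (t ^ 2 - σ)

/-- The partial fraction expansion of the secant, grouped so as to converge absolutely. -/
noncomputable def secTerm : ℕ → ℂ → ℂ
  | 0, σ => polePart (node 0) σ
  | n + 1, σ => polePart (node (2 * n + 2)) σ - polePart (node (2 * n + 1)) σ

lemma quarter_add_mem_integerComplement {w : ℂ} (h : ∀ n, w ^ 2 ≠ (node n : ℂ) ^ 2) :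
    1 / 4 + w / (2 * π) ∈ Complex.integerComplement := by
  rintro ⟨k, hk⟩
  have hpi : (π : ℂ) ≠ 0 := by exact_mod_cast pi_ne_zero
  have hw : w = 2 * π * (k - 1 / 4) := by
    rw [hk]; field_simp; ring
  rcases le_or_gt k 0 with h0 | h0
  · obtain ⟨m, hm⟩ := Int.eq_ofNat_of_zero_le (neg_nonneg.mpr h0)
    have hk' : (k : ℂ) = -(m : ℂ) := by
      have : k = -(m : ℤ) := by omega
      rw [this]; push_cast; ring
    refine h (2 * m) ?_
    rw [hw, hk', node]
    push_cast
    ring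
  · obtain ⟨m, hm⟩ := Int.eq_ofNat_of_zero_le (show 0 ≤ k - 1 by omega)
    have hk' : (k : ℂ) = (m : ℂ) + 1 := by
      have : k = (m : ℤ) + 1 := by omega
      rw [this]; push_cast; ring
    refine h (2 * m + 1) ?_
    rw [hw, hk', node]
    push_cast
    ring

lemma cot_add_cot_eq_sec {w : ℂ} (h1 : Complex.sin (π / 4 + w / 2) ≠ 0)
    (h2 : Complex.sin (π / 4 - w / 2) ≠ 0) :
    Complex.cot (π / 4 + w / 2) + Complex.cot (π / 4 - w / 2) = 2 / Complex.cos w := by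
  have e1 : Complex.cot (π / 4 + w / 2) + Complex.cot (π / 4 - w / 2)
      = Complex.sin ((π / 4 + w / 2) + (π / 4 - w / 2))
        / (Complex.sin (π / 4 + w / 2) * Complex.sin (π / 4 - w / 2)) := by
    rw [Complex.sin_add, Complex.cot, Complex.cot, div_add_div _ _ h1 h2]
    ring
  have e2 : Complex.cos w = 2 * (Complex.sin (π / 4 + w / 2) * Complex.sin (π / 4 - w / 2)) := by
    have e3 : w = (π / 4 + w / 2) - (π / 4 - w / 2) := by ring
    have e4 := Complex.cos_add (π / 4 + w / 2) (π / 4 - w / 2)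
    rw [show (π / 4 + w / 2 : ℂ) + (π / 4 - w / 2) = π / 2 by ring, Complex.cos_pi_div_two] at e4
    conv_lhs => rw [e3, Complex.cos_sub]
    linear_combination -e4
  rw [e1, e2, show (π / 4 + w / 2 : ℂ) + (π / 4 - w / 2) = π / 2 by ring, Complex.sin_pi_div_two]
  field_simp

lemma hasSum_secTerm {w : ℂ} (h : ∀ n, w ^ 2 ≠ (node n : ℂ) ^ 2) :
    HasSum (fun n => secTerm n (w ^ 2)) (1 / Complex.cos w) := by
  have hpi : (π : ℂ) ≠ 0 := by exact_mod_cast pi_ne_zero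
  have hx := quarter_add_mem_integerComplement h
  have hx' : 1 / 4 + (-w) / (2 * π) ∈ Complex.integerComplement :=
    quarter_add_mem_integerComplement (by simpa using h)
  have hs1 := sin_pi_mul_ne_zero hx
  have hs2 := sin_pi_mul_ne_zero hx'
  have ex : π * (1 / 4 + w / (2 * π)) = π / 4 + w / 2 := by field_simp
  have ex' : π * (1 / 4 + (-w) / (2 * π)) = π / 4 - w / 2 := by field_simp; ring
  have H1 := (summable_cotTerm hx).hasSum
  have H2 := (summable_cotTerm hx').hasSum
  simp only [cotTerm] at H1 H2
  rw [← cot_series_rep' hx, ex] at H1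
  rw [← cot_series_rep' hx', ex'] at H2
  rw [ex] at hs1
  rw [ex'] at hs2
  have H := (H1.add H2).mul_left (1 / (2 * π) : ℂ)
  have hne : ∀ n, ((node n : ℂ) - w) ≠ 0 ∧ ((node n : ℂ) + w) ≠ 0 := fun n =>
    ⟨fun h0 => h n (by rw [← sub_eq_zero.mp h0]),
      fun h0 => h n (by rw [eq_neg_of_add_eq_zero_right h0, neg_sq])⟩
  have hpole : ∀ n, polePart (node n) (w ^ 2) = 1 / (node n - w) + 1 / (node n + w) := fun n => by
    obtain ⟨h1, h2⟩ := hne n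
    rw [polePart, show (node n : ℂ) ^ 2 - w ^ 2 = (node n - w) * (node n + w) by ring]
    field_simp
    ring
  rw [← hasSum_nat_add_iff' 1]
  have hval : 1 / Complex.cos w - ∑ i ∈ Finset.range 1, secTerm i (w ^ 2)
      = (1 / (2 * π) : ℂ) * (π * Complex.cot (π / 4 + w / 2) - 1 / (1 / 4 + w / (2 * π))
        + (π * Complex.cot (π / 4 - w / 2) - 1 / (1 / 4 + (-w) / (2 * π)))) := by
    obtain ⟨h1, h2⟩ := hne 0
    have n1 : (1 / 4 + w / (2 * π) : ℂ) = (node 0 + w) / (2 * π) := by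
      rw [node]; push_cast; field_simp; ring
    have n2 : (1 / 4 + (-w) / (2 * π) : ℂ) = (node 0 - w) / (2 * π) := by
      rw [node]; push_cast; field_simp; ring
    have hc := cot_add_cot_eq_sec hs1 hs2
    rw [Finset.sum_range_one, secTerm, hpole, n1, n2, one_div_div, one_div_div,
      show (1 : ℂ) / Complex.cos w = 1 / 2 * (2 / Complex.cos w) by ring, ← hc]
    field_simp
    ring
  rw [hval]
  refine (funext fun n => ?_ : (fun n : ℕ => secTerm (n + 1) (w ^ 2)) = _) ▸ H
  obtain ⟨a1, a2⟩ := hne (2 * n + 1)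
  obtain ⟨b1, b2⟩ := hne (2 * n + 2)
  have n1 : (1 / 4 + w / (2 * π) - (n + 1) : ℂ) = -((node (2 * n + 1) - w) / (2 * π)) := by
    rw [node]; push_cast; field_simp; ring
  have n2 : (1 / 4 + w / (2 * π) + (n + 1) : ℂ) = (node (2 * n + 2) + w) / (2 * π) := by
    rw [node]; push_cast; field_simp; ring
  have n3 : (1 / 4 + (-w) / (2 * π) - (n + 1) : ℂ) = -((node (2 * n + 1) + w) / (2 * π)) := by
    rw [node]; push_cast; field_simp; ring
  have n4 : (1 / 4 + (-w) / (2 * π) + (n + 1) : ℂ) = (node (2 * n + 2) - w) / (2 * π) := by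
    rw [node]; push_cast; field_simp; ring
  rw [n1, n2, n3, n4, secTerm, hpole, hpole]
  field_simp
  ring

lemma norm_secTerm_succ_le (n : ℕ) (s : ℝ) :
    ‖secTerm (n + 1) (s * Complex.I)‖ ≤ 2 * π * (1 + |s|) / ((n : ℝ) + 1) ^ 2 := by
  set a := node (2 * n + 1) with ha
  set b := node (2 * n + 2) with hb
  have hab : b - a = π := by rw [ha, hb, node, node]; push_cast; ring
  have hn : (0 : ℝ) ≤ n := n.cast_nonneg
  have ha1 : (n : ℝ) + 1 ≤ a := by
    have := succ_le_node (2 * n + 1); push_cast at this; linarith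
  have hb1 : (n : ℝ) + 1 ≤ b := by
    have := succ_le_node (2 * n + 2); push_cast at this; linarith
  have ha0 : 0 < a := by linarith
  have hb0 : 0 < b := by linarith
  have hge : ∀ t : ℝ, t ^ 2 ≤ ‖(t : ℂ) ^ 2 - s * Complex.I‖ := fun t => by
    have := (norm_mul_I_sub_ge s (t ^ 2)).2
    rw [abs_of_nonneg (sq_nonneg t)] at this
    rw [norm_sub_rev]
    exact_mod_cast this
  have hne : ∀ t : ℝ, 0 < t → (t : ℂ) ^ 2 - s * Complex.I ≠ 0 := fun t ht =>
    norm_pos_iff.mp ((pow_pos ht 2).trans_le (hge t))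
  have e : secTerm (n + 1) (s * Complex.I) = -(2 * π * (a * b + s * Complex.I)
      / ((a ^ 2 - s * Complex.I) * (b ^ 2 - s * Complex.I))) := by
    have h1 := hne a ha0
    have h2 := hne b hb0
    rw [secTerm, ← ha, ← hb, polePart, polePart, ← hab]
    push_cast
    field_simp
    ring
  have hnum : ‖(a : ℂ) * b + s * Complex.I‖ ≤ a * b * (1 + |s|) := by
    have h1 : (1 : ℝ) ≤ a * b := by nlinarith
    calc _ ≤ ‖(a : ℂ) * b‖ + ‖(s : ℂ) * Complex.I‖ := norm_add_le _ _
      _ = a * b + |s| := by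
        rw [norm_mul, norm_mul, Complex.norm_I, Complex.norm_real, Complex.norm_real,
          Complex.norm_real, norm_of_nonneg ha0.le, norm_of_nonneg hb0.le, norm_eq_abs, mul_one]
      _ ≤ _ := by nlinarith [abs_nonneg s]
  rw [e, norm_neg, norm_div, norm_mul, norm_mul, norm_mul, Complex.norm_two, Complex.norm_real,
    norm_of_nonneg pi_pos.le]
  calc _ ≤ 2 * π * (a * b * (1 + |s|)) / (a ^ 2 * b ^ 2) := by
        gcongr
        · exact hge a
        · exact hge b
    _ = 2 * π * (1 + |s|) / (a * b) := by field_simp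
    _ ≤ 2 * π * (1 + |s|) / (((n : ℝ) + 1) * ((n : ℝ) + 1)) := by gcongr
    _ = _ := by rw [sq]

/-- Integration of the secant against a function holomorphic on the right half-plane. -/
theorem integral_div_cos {G : ℂ → ℂ} (hd : DifferentiableOn ℂ G {σ | 0 < σ.re})
    (hc : ContinuousOn G {σ | 0 ≤ σ.re}) {C : ℝ}
    (hb : ∀ σ : ℂ, 0 ≤ σ.re → ‖G σ‖ ≤ C / (1 + ‖σ‖) ^ 3) {W : ℝ → ℂ}
    (hW : ∀ s : ℝ, W s ^ 2 = s * Complex.I) :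
    ∫ s : ℝ, G (s * Complex.I) / Complex.cos (W s)
      = 4 * π * ∑' n : ℕ, (-1) ^ n * (node n * G ((node n : ℂ) ^ 2)) := by
  have hC : 0 ≤ C := by simpa using (norm_nonneg _).trans (hb 0 le_rfl)
  have hb' : ∀ σ : ℂ, 0 ≤ σ.re → ‖G σ‖ ≤ C / (1 + ‖σ‖) := fun σ hσ => by
    refine (hb σ hσ).trans ?_
    gcongr
    exact le_self_pow₀ (by linarith [norm_nonneg σ]) (by norm_num)
  have hcast : ∀ t : ℝ, (t : ℂ) ^ 2 = ((t ^ 2 : ℝ) : ℂ) := fun t => by push_cast; rfl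
  have hpole : ∀ (t s : ℝ), G (s * Complex.I) * polePart t (s * Complex.I)
      = 2 * t * (G (s * Complex.I) / (((t ^ 2 : ℝ) : ℂ) - s * Complex.I)) := fun t s => by
    rw [polePart, hcast]; ring
  have hpi : ∀ t : ℝ, 0 < t →
      Integrable fun s : ℝ => G (s * Complex.I) * polePart t (s * Complex.I) := fun t ht => by
    simp only [hpole]
    refine Integrable.const_mul ?_ _
    refine (integrable_div_mul_I_sub hc hb' (pow_pos ht 2)).neg.congr
      (Eventually.of_forall fun s => ?_)
    simp only [Pi.neg_apply]
    rw [← neg_sub, div_neg, neg_neg]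
  have hpv : ∀ t : ℝ, 0 < t →
      ∫ s : ℝ, G (s * Complex.I) * polePart t (s * Complex.I)
        = 4 * π * (t * G ((t : ℂ) ^ 2)) := fun t ht => by
    simp only [hpole]
    rw [integral_const_mul, integral_halfPlane hd hc hb' (pow_pos ht 2), hcast]
    ring
  have hti : ∀ n, Integrable fun s : ℝ => G (s * Complex.I) * secTerm n (s * Complex.I) := by
    rintro (_ | n)
    · exact hpi _ (node_pos 0)
    · simp only [secTerm, mul_sub]
      exact (hpi _ (node_pos _)).sub (hpi _ (node_pos _))
  have hnorm : ∀ (n : ℕ) (s : ℝ), ‖G (s * Complex.I) * secTerm (n + 1) (s * Complex.I)‖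
      ≤ 2 * π * C / ((n : ℝ) + 1) ^ 2 * (1 + s ^ 2)⁻¹ := fun n s => by
    have h1 := hb (s * Complex.I) (by simp)
    rw [norm_mul, Complex.norm_I, mul_one, Complex.norm_real, norm_eq_abs] at h1
    have hp := pi_pos
    have h2 : (1 : ℝ) + s ^ 2 ≤ (1 + |s|) ^ 2 := by
      rw [← sq_abs]; nlinarith [abs_nonneg s]
    rw [norm_mul]
    calc _ ≤ C / (1 + |s|) ^ 3 * (2 * π * (1 + |s|) / ((n : ℝ) + 1) ^ 2) := by
          gcongr
          exact norm_secTerm_succ_le n s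
      _ = 2 * π * C / ((n : ℝ) + 1) ^ 2 * ((1 + |s|) ^ 2)⁻¹ := by field_simp
      _ ≤ _ := by gcongr
  have hsq : Summable fun n : ℕ => 1 / ((n : ℝ) + 1) ^ 2 := by
    have := (summable_nat_add_iff 1).mpr (Real.summable_one_div_nat_pow.mpr one_lt_two)
    simpa using this
  have hsum : Summable fun n => ∫ s : ℝ, ‖G (s * Complex.I) * secTerm n (s * Complex.I)‖ := by
    rw [← summable_nat_add_iff 1]
    refine Summable.of_nonneg_of_le (fun n => integral_nonneg fun s => norm_nonneg _)
      (fun n => integral_mono (hti (n + 1)).norm (integrable_inv_one_add_sq.const_mul _)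
        (hnorm n)) ?_
    simp only [integral_const_mul, integral_univ_inv_one_add_sq]
    refine Summable.mul_right _ ?_
    simpa only [mul_one_div] using hsq.mul_left (2 * π * C)
  have H := hasSum_integral_of_summable_integral_norm hti hsum
  have hpt : ∀ s : ℝ, ∑' n, G (s * Complex.I) * secTerm n (s * Complex.I)
      = G (s * Complex.I) / Complex.cos (W s) := fun s => by
    have h := hasSum_secTerm (w := W s) fun n h0 => by
      rw [hW, hcast] at h0
      exact mul_I_sub_ne_zero s (pow_pos (node_pos n) 2) (sub_eq_zero.mpr h0)
    rw [hW] at h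
    rw [tsum_mul_left, h.tsum_eq, mul_one_div]
  simp only [hpt] at H
  rw [← H.tsum_eq]
  set F : ℕ → ℂ := fun n => (-1) ^ n * (node n * G ((node n : ℂ) ^ 2)) with hF
  have hFs : Summable F := by
    refine Summable.of_norm_bounded (hsq.mul_left C) fun n => ?_
    have h1 := succ_le_node n
    have h0 := node_pos n
    have hn : (0 : ℝ) ≤ n := n.cast_nonneg
    have h2 := hb ((node n : ℂ) ^ 2) (by rw [hcast, Complex.ofReal_re]; positivity)
    rw [hcast, Complex.norm_real, norm_of_nonneg (by positivity), ← hcast] at h2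
    simp only [hF, norm_mul, norm_pow, norm_neg, norm_one, one_pow, one_mul, Complex.norm_real]
    rw [norm_of_nonneg h0.le, mul_one_div]
    have h3 : node n * (node n) ^ 2 ≤ (1 + node n ^ 2) ^ 3 := by
      have h4 : node n ≤ 1 + node n ^ 2 := by nlinarith [sq_nonneg (node n - 1)]
      calc _ ≤ (1 + node n ^ 2) * (1 + node n ^ 2) := by gcongr; linarith
        _ = (1 + node n ^ 2) ^ 2 := by ring
        _ ≤ _ := by gcongr <;> nlinarith
    calc _ ≤ node n * (C / (1 + node n ^ 2) ^ 3) := by gcongr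
      _ ≤ C / node n ^ 2 := by
        rw [← mul_div_assoc, div_le_div_iff₀ (by positivity) (by positivity)]
        nlinarith
      _ ≤ _ := by gcongr
  have hterm : ∀ n, ∫ s : ℝ, G (s * Complex.I) * secTerm (n + 1) (s * Complex.I)
      = 4 * π * (F (2 * n + 1) + F (2 * n + 1 + 1)) := fun n => by
    simp only [secTerm, mul_sub]
    rw [integral_sub (hpi _ (node_pos _)) (hpi _ (node_pos _)), hpv _ (node_pos _),
      hpv _ (node_pos _)]
    have e1 : (-1 : ℂ) ^ (2 * n + 1) = -1 := Odd.neg_one_pow ⟨n, rfl⟩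
    have e2 : (-1 : ℂ) ^ (2 * n + 1 + 1) = 1 := Even.neg_one_pow ⟨n + 1, by ring⟩
    simp only [hF, e1, e2]
    ring
  have hF1 : Summable fun n => F (n + 1) := (summable_nat_add_iff 1).mpr hFs
  have ho : Summable fun n => F (2 * n + 1) :=
    hFs.comp_injective fun a b h => by simpa using h
  have he : Summable fun n => F (2 * n + 1 + 1) :=
    hFs.comp_injective fun a b h => by simpa using h
  rw [H.summable.tsum_eq_zero_add, hFs.tsum_eq_zero_add,
    ← tsum_even_add_odd (f := fun n => F (n + 1)) ho he, ← ho.tsum_add he]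
  simp only [hterm]
  rw [tsum_mul_left, mul_add]
  congr 1
  simp only [secTerm]
  rw [hpv _ (node_pos 0)]
  simp [hF]

/-- The closed sector of half-angle `π / 4` around the positive real axis. -/
def sector : Set ℂ := {w | |w.im| ≤ w.re}

lemma re_nonneg_of_mem_sector {w : ℂ} (hw : w ∈ sector) : 0 ≤ w.re :=
  (abs_nonneg _).trans hw

lemma norm_le_two_mul_re {w : ℂ} (hw : w ∈ sector) : ‖w‖ ≤ 2 * w.re := by
  have h := Complex.norm_le_abs_re_add_abs_im w
  rw [abs_of_nonneg (re_nonneg_of_mem_sector hw)] at h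
  have h' : |w.im| ≤ w.re := hw
  linarith

lemma conj_mem_sector {w : ℂ} (hw : w ∈ sector) : starRingEnd ℂ w ∈ sector := by
  simpa [sector] using hw

lemma exp_le_norm_cosh {w : ℂ} (hw : w ∈ sector) : exp w.re / 4 ≤ ‖Complex.cosh w‖ := by
  have h0 := re_nonneg_of_mem_sector hw
  have h1 : ‖Complex.cosh w‖ ^ 2 = sinh w.re ^ 2 + cos w.im ^ 2 := by
    rw [← Complex.normSq_eq_norm_sq, Complex.normSq_apply]
    have e : Complex.cosh w = (cosh w.re * cos w.im : ℝ) + (sinh w.re * sin w.im : ℝ) * Complex.I := by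
      conv_lhs => rw [← Complex.re_add_im w, Complex.cosh_add, Complex.cosh_mul_I,
        Complex.sinh_mul_I]
      push_cast
      ring
    rw [e]
    simp only [Complex.add_re, Complex.ofReal_re, Complex.mul_re, Complex.I_re, mul_zero,
      Complex.ofReal_im, Complex.I_im, mul_one, sub_self, add_zero, Complex.add_im,
      Complex.mul_im, zero_add]
    linear_combination cos w.im ^ 2 * cosh_sq w.re + sinh w.re ^ 2 * sin_sq w.im
  have h2 : 0 ≤ sinh w.re := sinh_nonneg_iff.mpr h0
  have h3 : (exp w.re / 4) ^ 2 ≤ ‖Complex.cosh w‖ ^ 2 := by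
    rw [h1]
    have hq : w.im ^ 2 ≤ w.re ^ 2 := sq_le_sq.mpr (by rwa [abs_of_nonneg h0])
    have hexp : exp w.re * exp (-w.re) = 1 := by rw [← exp_add]; simp
    have hp := exp_pos (-w.re)
    have he := quadratic_le_exp_of_nonneg (x := 2 * w.re) (by linarith)
    have he2 : exp (2 * w.re) = exp w.re ^ 2 := by rw [← exp_nat_mul]; norm_num
    have hc := one_sub_sq_div_two_le_cos (x := 2 * w.im)
    rw [cos_two_mul] at hc
    rw [sinh_eq]
    rcases le_or_gt (w.re ^ 2) (1 / 2) with h | h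
    · nlinarith
    · have : 1 / 2 ≤ w.re := by nlinarith
      nlinarith [sq_nonneg (cos w.im)]
  exact le_of_sq_le_sq h3 (norm_nonneg _)

/-- The complex hyperbolic secant. -/
noncomputable def csech (w : ℂ) : ℂ := (Complex.cosh w)⁻¹

lemma cosh_ne_zero_of_mem_sector {w : ℂ} (hw : w ∈ sector) : Complex.cosh w ≠ 0 := by
  rw [← norm_pos_iff]
  exact lt_of_lt_of_le (by positivity) (exp_le_norm_cosh hw)

lemma norm_csech_le {w : ℂ} (hw : w ∈ sector) : ‖csech w‖ ≤ 4 * exp (-w.re) := by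
  rw [csech, norm_inv]
  refine (inv_anti₀ (by positivity) (exp_le_norm_cosh hw)).trans_eq ?_
  rw [exp_neg, inv_div]
  ring

lemma norm_tanh_le {w : ℂ} (hw : w ∈ sector) : ‖Complex.tanh w‖ ≤ 4 := by
  have h0 := re_nonneg_of_mem_sector hw
  have h1 : ‖Complex.sinh w‖ ≤ exp w.re := by
    rw [Complex.sinh, norm_div]
    have h2 := norm_sub_le (Complex.exp w) (Complex.exp (-w))
    rw [Complex.norm_exp, Complex.norm_exp, Complex.neg_re] at h2
    have : exp (-w.re) ≤ exp w.re := exp_le_exp.mpr (by linarith)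
    rw [RCLike.norm_ofNat]
    linarith
  rw [Complex.tanh_eq_sinh_div_cosh, norm_div]
  have := exp_le_norm_cosh hw
  rw [div_le_iff₀ (norm_pos_iff.mpr (cosh_ne_zero_of_mem_sector hw))]
  linarith

/-- Functions holomorphic on the sector and decaying exponentially there. -/
def SectorDecay (q : ℂ → ℂ) : Prop :=
  (∀ w ∈ sector, DifferentiableAt ℂ q w) ∧
    ∃ C c : ℝ, 0 < c ∧ ∀ w ∈ sector, ‖q w‖ ≤ C * exp (-c * w.re)

lemma SectorDecay.add {f g : ℂ → ℂ} (hf : SectorDecay f) (hg : SectorDecay g) :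
    SectorDecay fun w => f w + g w := by
  obtain ⟨hf, C, c, hc, hC⟩ := hf
  obtain ⟨hg, D, d, hd, hD⟩ := hg
  refine ⟨fun w hw => (hf w hw).add (hg w hw), |C| + |D|, min c d, lt_min hc hd, fun w hw => ?_⟩
  have h0 := re_nonneg_of_mem_sector hw
  have h1 : exp (-c * w.re) ≤ exp (-min c d * w.re) :=
    exp_le_exp.mpr (mul_le_mul_of_nonneg_right (neg_le_neg (min_le_left _ _)) h0)
  have h2 : exp (-d * w.re) ≤ exp (-min c d * w.re) :=
    exp_le_exp.mpr (mul_le_mul_of_nonneg_right (neg_le_neg (min_le_right _ _)) h0)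
  calc ‖f w + g w‖ ≤ C * exp (-c * w.re) + D * exp (-d * w.re) :=
        (norm_add_le _ _).trans (add_le_add (hC w hw) (hD w hw))
    _ ≤ |C| * exp (-min c d * w.re) + |D| * exp (-min c d * w.re) := by
        gcongr <;> exact le_abs_self _
    _ = _ := by ring

lemma SectorDecay.congr {f g : ℂ → ℂ} (hf : SectorDecay f) (h : ∀ w, g w = f w) :
    SectorDecay g := by
  rwa [funext h]

lemma SectorDecay.mul_of_bound {f g : ℂ → ℂ} (hf : SectorDecay f)
    (hd : ∀ w ∈ sector, DifferentiableAt ℂ g w) {M : ℝ} (hM : ∀ w ∈ sector, ‖g w‖ ≤ M) :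
    SectorDecay fun w => g w * f w := by
  obtain ⟨hf, C, c, hc, hC⟩ := hf
  refine ⟨fun w hw => (hd w hw).mul (hf w hw), M * C, c, hc, fun w hw => ?_⟩
  rw [norm_mul, mul_assoc]
  exact mul_le_mul (hM w hw) (hC w hw) (norm_nonneg _) ((norm_nonneg _).trans (hM w hw))

lemma SectorDecay.const_mul {f : ℂ → ℂ} (hf : SectorDecay f) (a : ℂ) :
    SectorDecay fun w => a * f w :=
  hf.mul_of_bound (g := fun _ => a) (fun _ _ => differentiableAt_const a) fun _ _ => le_rfl

lemma SectorDecay.pow_mul {f : ℂ → ℂ} (hf : SectorDecay f) (k : ℕ) :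
    SectorDecay fun w => w ^ k * f w := by
  obtain ⟨hf, C, c, hc, hC⟩ := hf
  refine ⟨fun w hw => (differentiableAt_pow k).mul (hf w hw),
    2 ^ k * (k.factorial / (c / 2) ^ k) * C, c / 2, half_pos hc, fun w hw => ?_⟩
  have h0 := re_nonneg_of_mem_sector hw
  have h1 := pow_le_mul_exp k (half_pos hc) h0
  have h2 : ‖w ^ k‖ ≤ 2 ^ k * (k.factorial / (c / 2) ^ k * exp (c / 2 * w.re)) := by
    rw [norm_pow]
    calc ‖w‖ ^ k ≤ (2 * w.re) ^ k := pow_le_pow_left₀ (norm_nonneg _) (norm_le_two_mul_re hw) k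
      _ = 2 ^ k * w.re ^ k := mul_pow _ _ _
      _ ≤ _ := by gcongr
  rw [norm_mul]
  refine (mul_le_mul h2 (hC w hw) (norm_nonneg _) (by positivity)).trans_eq ?_
  rw [show -(c / 2) * w.re = c / 2 * w.re + -c * w.re by ring, exp_add]
  ring

lemma differentiableAt_csech {w : ℂ} (hw : w ∈ sector) : DifferentiableAt ℂ csech w :=
  (Complex.differentiable_cosh w).inv (cosh_ne_zero_of_mem_sector hw)

lemma hasDerivAt_csech {w : ℂ} (hw : Complex.cosh w ≠ 0) :
    HasDerivAt csech (-(csech w * Complex.tanh w)) w := by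
  refine ((Complex.hasDerivAt_cosh w).inv hw).congr_deriv ?_
  rw [Complex.tanh_eq_sinh_div_cosh, csech]
  field_simp

lemma hasDerivAt_ctanh {w : ℂ} (hw : Complex.cosh w ≠ 0) :
    HasDerivAt Complex.tanh (csech w ^ 2) w := by
  have h := (Complex.hasDerivAt_sinh w).div (Complex.hasDerivAt_cosh w) hw
  have e : Complex.tanh = fun w => Complex.sinh w / Complex.cosh w :=
    funext Complex.tanh_eq_sinh_div_cosh
  rw [e]
  refine h.congr_deriv ?_
  have := Complex.cosh_sq w
  rw [csech]
  field_simp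
  linear_combination this

lemma ctanh_sq {w : ℂ} (hw : Complex.cosh w ≠ 0) : Complex.tanh w ^ 2 = 1 - csech w ^ 2 := by
  rw [Complex.tanh_eq_sinh_div_cosh, csech]
  have := Complex.cosh_sq w
  field_simp
  linear_combination -this

lemma sectorDecay_csech : SectorDecay csech :=
  ⟨fun _ hw => differentiableAt_csech hw, 4, 1, one_pos, fun w hw => by
    simpa using norm_csech_le hw⟩

lemma SectorDecay.csech_mul {f : ℂ → ℂ} (hf : SectorDecay f) :
    SectorDecay fun w => csech w * f w :=
  hf.mul_of_bound (fun _ hw => differentiableAt_csech hw) (M := 4) fun w hw =>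
    (norm_csech_le hw).trans (by
      have : exp (-w.re) ≤ 1 := exp_le_one_iff.mpr (by linarith [re_nonneg_of_mem_sector hw])
      linarith)

lemma SectorDecay.tanh_mul {f : ℂ → ℂ} (hf : SectorDecay f) :
    SectorDecay fun w => Complex.tanh w * f w :=
  hf.mul_of_bound (fun _ hw => (hasDerivAt_ctanh (cosh_ne_zero_of_mem_sector hw)).differentiableAt)
    fun _ hw => norm_tanh_le hw

lemma cos_eq_cosh_conj {w : ℂ} (h : w.re ^ 2 = w.im ^ 2) :
    Complex.cos w = Complex.cosh (starRingEnd ℂ w) := by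
  rcases sq_eq_sq_iff_eq_or_eq_neg.mp h with h | h
  · rw [← Complex.cosh_mul_I, ← Complex.cosh_neg]
    congr 1
    apply Complex.ext <;> simp [h]
  · rw [← Complex.cosh_mul_I]
    congr 1
    apply Complex.ext <;> simp [h]

/-- The point with parameter `r` on the ray of argument `π / 4`. -/
noncomputable def ray (r : ℝ) : ℂ := (1 + Complex.I) * r

lemma ray_re (r : ℝ) : (ray r).re = r := by simp [ray]

lemma ray_im (r : ℝ) : (ray r).im = r := by simp [ray]

lemma ray_mem_sector {r : ℝ} (hr : 0 ≤ r) : ray r ∈ sector := by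
  simp [sector, ray_re, ray_im, abs_of_nonneg hr]

lemma ray_sq (r : ℝ) : ray r ^ 2 = 2 * (r : ℂ) ^ 2 * Complex.I := by
  rw [ray, mul_pow]
  linear_combination (r : ℂ) ^ 2 * Complex.I_sq

lemma sqrt_sq_of_mem_sector {w : ℂ} (hw : w ∈ sector) : (w ^ 2) ^ (2⁻¹ : ℂ) = w := by
  rcases (re_nonneg_of_mem_sector hw).eq_or_lt with h | h
  · have h1 : |w.im| ≤ w.re := hw
    rw [← h] at h1
    have : w = 0 := Complex.ext h.symm (abs_nonpos_iff.mp h1)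
    simp [this]
  · exact Complex.sq_cpow_two_inv h

lemma sqrt_sq (σ : ℂ) : (σ ^ (2⁻¹ : ℂ)) ^ 2 = σ :=
  Complex.cpow_nat_inv_pow σ two_ne_zero

lemma sqrt_mem_sector {σ : ℂ} (hσ : 0 ≤ σ.re) : σ ^ (2⁻¹ : ℂ) ∈ sector := by
  have h2 : 0 ≤ (σ ^ (2⁻¹ : ℂ)).re := by
    rw [Complex.cpow_inv_two_re]
    exact sqrt_nonneg _
  have h3 := congrArg Complex.re (sqrt_sq σ)
  rw [sq, Complex.mul_re] at h3
  exact abs_le_of_sq_le_sq (by nlinarith) h2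

lemma SectorDecay.comp_sqrt_le {q : ℂ → ℂ} (hq : SectorDecay q) :
    ∃ C : ℝ, ∀ σ : ℂ, 0 ≤ σ.re → ‖q (σ ^ (2⁻¹ : ℂ))‖ ≤ C / (1 + ‖σ‖) ^ 3 := by
  obtain ⟨-, C, c, hc, hC⟩ := hq
  refine ⟨|C| * ((6).factorial / (c / 2) ^ 6 * exp (c / 2)), fun σ hσ => ?_⟩
  have hw := sqrt_mem_sector hσ
  have h1 := hC _ hw
  set w := σ ^ (2⁻¹ : ℂ) with hwd
  have h0 := re_nonneg_of_mem_sector hw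
  have h2 : ‖σ‖ ≤ (2 * w.re) ^ 2 := by
    rw [← sqrt_sq σ, norm_pow]
    exact pow_le_pow_left₀ (norm_nonneg _) (norm_le_two_mul_re hw) 2
  have h3 : (1 + ‖σ‖) ^ 3 ≤ (1 + 2 * w.re) ^ 6 := by
    calc (1 + ‖σ‖) ^ 3 ≤ ((1 + 2 * w.re) ^ 2) ^ 3 := by gcongr; nlinarith
      _ = _ := by ring
  have h4 := pow_le_mul_exp 6 (half_pos hc) (show 0 ≤ 1 + 2 * w.re by linarith)
  rw [le_div_iff₀ (by positivity)]
  calc ‖q w‖ * (1 + ‖σ‖) ^ 3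
      ≤ (|C| * exp (-c * w.re)) *
        ((6).factorial / (c / 2) ^ 6 * exp (c / 2 * (1 + 2 * w.re))) := by
        gcongr
        · exact h1.trans (by gcongr; exact le_abs_self _)
        · exact h3.trans h4
    _ = _ := by
        rw [show c / 2 * (1 + 2 * w.re) = c / 2 + c * w.re by ring, exp_add,
          show -c * w.re = -(c * w.re) by ring, exp_neg]
        field_simp

lemma integral_eq_integral_Ioi_two_mul_sq {f : ℝ → ℂ} (hf : Integrable f) :
    ∫ s, f s = 4 * ∫ r in Set.Ioi (0 : ℝ), (r : ℂ) * (f (2 * r ^ 2) + f (-(2 * r ^ 2))) := by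
  rw [← intervalIntegral.integral_Iic_add_Ioi (b := 0) hf.integrableOn hf.integrableOn]
  have h1 := integral_comp_neg_Ioi 0 f
  rw [neg_zero] at h1
  rw [← h1, add_comm, ← integral_add hf.integrableOn hf.comp_neg.integrableOn]
  have h2 := integral_comp_mul_left_Ioi' (fun s => f s + f (-s)) 0 two_pos
  rw [mul_zero] at h2
  rw [← h2, ← integral_comp_rpow_Ioi_of_pos two_pos, ← integral_const_mul, ← integral_smul]
  refine setIntegral_congr_fun measurableSet_Ioi fun r hr => ?_
  have e : r ^ ((2 : ℝ) - 1) = r := by norm_num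
  simp only [e, rpow_two, Complex.real_smul]
  push_cast
  ring

/-- A summation formula for functions decaying exponentially in the sector. -/
lemma SectorDecay.integral_ray {q : ℂ → ℂ} (hq : SectorDecay q) :
    ∫ r in Set.Ioi (0 : ℝ), (r : ℂ) * (q (ray r) * csech (starRingEnd ℂ (ray r))
      + q (starRingEnd ℂ (ray r)) * csech (ray r))
      = π * ∑' n : ℕ, (-1) ^ n * (node n * q (node n)) := by
  obtain ⟨C, hC⟩ := hq.comp_sqrt_le
  have hsqrt : ContinuousOn (fun σ : ℂ => σ ^ (2⁻¹ : ℂ)) {σ | 0 ≤ σ.re} := fun σ hσ =>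
    (Complex.continuousAt_cpow_const_of_re_pos (Or.inl hσ) (by norm_num)).continuousWithinAt
  have hqs : ContinuousOn q sector := fun w hw => (hq.1 w hw).continuousAt.continuousWithinAt
  have hcs : ContinuousOn csech sector := fun w hw =>
    (differentiableAt_csech hw).continuousAt.continuousWithinAt
  have hmaps : Set.MapsTo (fun σ : ℂ => σ ^ (2⁻¹ : ℂ)) {σ | 0 ≤ σ.re} sector :=
    fun σ hσ => sqrt_mem_sector hσ
  set G : ℂ → ℂ := fun σ => q (σ ^ (2⁻¹ : ℂ)) with hG
  have hGc : ContinuousOn G {σ | 0 ≤ σ.re} := hqs.comp hsqrt hmaps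
  have hGd : DifferentiableOn ℂ G {σ | 0 < σ.re} := fun σ hσ => by
    refine DifferentiableAt.differentiableWithinAt ?_
    exact (hq.1 _ (sqrt_mem_sector (le_of_lt hσ))).comp σ
      (differentiableAt_id.cpow_const (Or.inl hσ))
  set W : ℝ → ℂ := fun s => (s * Complex.I) ^ (2⁻¹ : ℂ) with hW
  have hWsq : ∀ s : ℝ, W s ^ 2 = s * Complex.I := fun s => sqrt_sq _
  have hre : ∀ s : ℝ, 0 ≤ ((s : ℂ) * Complex.I).re := fun s => by simp
  have hWs : ∀ s, W s ∈ sector := fun s => sqrt_mem_sector (hre s)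
  have hcos : ∀ s, (Complex.cos (W s))⁻¹ = csech (starRingEnd ℂ (W s)) := fun s => by
    rw [csech, cos_eq_cosh_conj]
    have h := congrArg Complex.re (hWsq s)
    simp only [sq, Complex.mul_re, Complex.I_re, Complex.I_im, Complex.ofReal_im, mul_zero,
      zero_mul, sub_zero] at h
    linear_combination h
  have key := integral_div_cos hGd hGc hC hWsq
  have hi : Integrable fun s : ℝ => G (s * Complex.I) / Complex.cos (W s) := by
    simp only [div_eq_mul_inv, hcos]
    have c1 : Continuous fun s : ℝ => (s : ℂ) * Complex.I := by fun_prop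
    refine integrable_of_norm_le_inv_one_add_sq (C := |C| * 4) ?_ fun s => ?_
    · refine (hGc.comp_continuous c1 hre).mul (hcs.comp_continuous
        (Complex.continuous_conj.comp (hsqrt.comp_continuous c1 hre)) fun s => ?_)
      exact conj_mem_sector (hWs s)
    · rw [norm_mul]
      have h1 := hC _ (hre s)
      have h2 := norm_csech_le (conj_mem_sector (hWs s))
      have h3 : exp (-(starRingEnd ℂ (W s)).re) ≤ 1 := exp_le_one_iff.mpr
        (by linarith [re_nonneg_of_mem_sector (conj_mem_sector (hWs s))])
      have h4 : ‖(s : ℂ) * Complex.I‖ = |s| := by simp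
      rw [h4] at h1
      have h5 : C / (1 + |s|) ^ 3 ≤ |C| * (1 + s ^ 2)⁻¹ := by
        rw [← div_eq_mul_inv]
        gcongr
        · exact le_abs_self C
        · rw [← sq_abs s]
          nlinarith [abs_nonneg s, pow_nonneg (abs_nonneg s) 3]
      calc _ ≤ (|C| * (1 + s ^ 2)⁻¹) * 4 :=
            mul_le_mul (h1.trans h5) (by linarith) (norm_nonneg _) (by positivity)
        _ = _ := by ring
  rw [integral_eq_integral_Ioi_two_mul_sq hi, mul_assoc] at key
  have h4 : (4 : ℂ) ≠ 0 := by norm_num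
  have key := mul_left_cancel₀ h4 key
  have hn : ∀ n, G ((node n : ℂ) ^ 2) = q (node n) := fun n => by
    simp only [hG]
    rw [sqrt_sq_of_mem_sector]
    simp [sector, (node_pos n).le]
  simp only [hn] at key
  rw [← key]
  refine setIntegral_congr_fun measurableSet_Ioi fun r hr => ?_
  have m1 := ray_mem_sector (le_of_lt hr)
  have w1 : W (2 * r ^ 2) = ray r := by
    simp only [hW]
    rw [show ((2 * r ^ 2 : ℝ) : ℂ) * Complex.I = ray r ^ 2 by rw [ray_sq]; push_cast; ring,
      sqrt_sq_of_mem_sector m1]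
  have w2 : W (-(2 * r ^ 2)) = starRingEnd ℂ (ray r) := by
    simp only [hW]
    rw [show ((-(2 * r ^ 2) : ℝ) : ℂ) * Complex.I = starRingEnd ℂ (ray r) ^ 2 by
      rw [← map_pow, ray_sq]; simp [Complex.conj_ofNat], sqrt_sq_of_mem_sector (conj_mem_sector m1)]
  have g : ∀ s : ℝ, G (s * Complex.I) = q (W s) := fun s => rfl
  have e1 := hcos (2 * r ^ 2)
  have e2 := hcos (-(2 * r ^ 2))
  rw [w1] at e1
  rw [w2, Complex.conj_conj] at e2
  simp only [g, div_eq_mul_inv, w1, w2, e1, e2]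

lemma conj_ray (r : ℝ) : starRingEnd ℂ (ray r) = (1 + -Complex.I) * r := by
  simp [ray]

/-- The derivatives of the complex hyperbolic secant, up to the fourth. -/
noncomputable def csechD : ℕ → ℂ → ℂ
  | 0 => csech
  | 1 => fun t => -(csech t * Complex.tanh t)
  | 2 => fun t => csech t - 2 * csech t ^ 3
  | 3 => fun t => -(csech t * Complex.tanh t) + 6 * (csech t ^ 3 * Complex.tanh t)
  | 4 => fun t => csech t - 20 * csech t ^ 3 + 24 * csech t ^ 5
  | _ => 0

lemma csechD_ofReal (j : ℕ) (t : ℝ) : csechD j t = (sechD j t : ℂ) := by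
  match j with
  | 0 | 1 | 2 | 3 | 4 => simp [csechD, sechD, csech, sech]
  | _ + 5 => simp [csechD, sechD]

lemma hasDerivAt_csechD {j : ℕ} (hj : j < 4) {w : ℂ} (hw : w ∈ sector) :
    HasDerivAt (csechD j) (csechD (j + 1) w) w := by
  have hc := cosh_ne_zero_of_mem_sector hw
  have h1 := hasDerivAt_csech hc
  have h2 := hasDerivAt_ctanh hc
  have h3 := ctanh_sq hc
  interval_cases j
  · exact h1
  · refine (h1.mul h2).neg.congr_deriv ?_
    simp only [csechD]
    linear_combination csech w * h3
  · refine (h1.sub ((h1.pow 3).const_mul 2)).congr_deriv ?_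
    simp only [csechD]; push_cast; ring
  · refine ((h1.mul h2).neg.add (((h1.pow 3).mul h2).const_mul 6)).congr_deriv ?_
    simp only [csechD, Pi.pow_apply]; push_cast
    linear_combination (csech w - 18 * csech w ^ 3) * h3

lemma sectorDecay_csechD (j : ℕ) : SectorDecay (csechD j) := by
  have h1 := sectorDecay_csech
  have h3 := h1.csech_mul.csech_mul
  have h5 := h3.csech_mul.csech_mul
  match j with
  | 0 => exact h1
  | 1 => exact (h1.tanh_mul.const_mul (-1)).congr fun w => by simp only [csechD]; ring
  | 2 => exact (h1.add (h3.const_mul (-2))).congr fun w => by simp only [csechD]; ring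
  | 3 =>
    exact ((h1.tanh_mul.const_mul (-1)).add (h3.tanh_mul.const_mul 6)).congr fun w => by
      simp only [csechD]; ring
  | 4 =>
    exact ((h1.add (h3.const_mul (-20))).add (h5.const_mul 24)).congr fun w => by
      simp only [csechD]; ring
  | _ + 5 => exact (h1.const_mul 0).congr fun w => by simp [csechD]

lemma sgn_neg_one_sub (n : ℤ) : sgn (-1 - n) = -sgn n := by
  rw [sgn, sgn, zpow_sub₀ (by norm_num), zpow_neg_one]
  rcases Int.even_or_odd n with h | h <;> simp [h.neg_one_zpow]

lemma sechD_neg (j : ℕ) (t : ℝ) : sechD j (-t) = (-1) ^ j * sechD j t := by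
  match j with
  | 0 | 1 | 2 => simp [sechD, sech_neg]
  | 3 | 4 => simp only [sechD, sech_neg, tanh_neg]; ring
  | _ + 5 => simp [sechD]

lemma hasSum_node {k j : ℕ} (hkj : Even (k + j)) :
    HasSum (fun n : ℕ => (-1 : ℂ) ^ n * (node n * ((node n : ℂ) ^ k * csechD j (node n))))
      ((π ^ (k + 1) / 2 * moment (k + 1) (sechD j) π : ℝ) : ℂ) := by
  set F : ℤ → ℝ := fun n => sgn n * ((n : ℝ) + 1 / 2) ^ (k + 1) * sechD j (((n : ℝ) + 1 / 2) * π)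
    with hF
  have hs : Summable F := by
    refine (expDecay_sechD j).summable spaced_half pi_pos (k := k + 1) fun n => ?_
    rw [abs_mul, abs_pow, sgn, abs_zpow]
    simp
  have hsym : ∀ n, F (-1 - n) = F n := fun n => by
    have e : (-1 : ℝ) ^ (k + 1) * (-1) ^ j = -1 := by
      rw [← pow_add, show k + 1 + j = k + j + 1 by ring, hkj.add_one.neg_one_pow]
    simp only [hF, sgn_neg_one_sub, freq_neg, neg_mul, sechD_neg]
    rw [neg_pow ((n : ℝ) + 1 / 2)]
    linear_combination -sgn n * ((n : ℝ) + 1 / 2) ^ (k + 1) * sechD j (((n : ℝ) + 1 / 2) * π) * e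
  have h1 := tsum_int_eq_two_mul hs hsym
  have h2 : HasSum (fun n : ℕ => F n) (∑' n : ℕ, F n) :=
    (hs.comp_injective Nat.cast_injective).hasSum
  have h3 : (∑' n : ℕ, F n) = moment (k + 1) (sechD j) π / 2 := by
    have : moment (k + 1) (sechD j) π = ∑' n : ℤ, F n := rfl
    rw [this, h1]; ring
  rw [h3] at h2
  have h4 := Complex.hasSum_ofReal.mpr (h2.mul_left (π ^ (k + 1)))
  convert h4 using 1
  · funext n
    simp only [hF, csechD_ofReal, sgn, Int.cast_natCast, zpow_natCast]
    rw [show (n : ℝ) + 1 / 2 = node n / π by rw [node]; field_simp]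
    have : (π : ℂ) ≠ 0 := by exact_mod_cast pi_ne_zero
    rw [div_mul_cancel₀ _ pi_ne_zero]
    push_cast
    rw [div_pow]
    field_simp
    ring
  · push_cast; ring

lemma SectorDecay.ray_le {f g : ℂ → ℂ} (hf : SectorDecay f) (hg : SectorDecay g) :
    ∃ C c : ℝ, 0 < c ∧ ∀ r : ℝ, 0 ≤ r →
      ‖f (ray r) * g (starRingEnd ℂ (ray r))‖ ≤ C * exp (-c * r) := by
  obtain ⟨-, C, c, hc, hC⟩ := hf
  obtain ⟨-, D, d, hd, hD⟩ := hg
  refine ⟨C * D, c + d, add_pos hc hd, fun r hr => ?_⟩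
  have h1 := hC _ (ray_mem_sector hr)
  have h2 := hD _ (conj_mem_sector (ray_mem_sector hr))
  rw [Complex.conj_re, ray_re] at h2
  rw [ray_re] at h1
  rw [norm_mul]
  refine (mul_le_mul h1 h2 (norm_nonneg _) ((norm_nonneg _).trans h1)).trans_eq ?_
  rw [show -(c + d) * r = -c * r + -d * r by ring, exp_add]
  ring

lemma SectorDecay.integrableOn_ray {f g : ℂ → ℂ} (hf : SectorDecay f) (hg : SectorDecay g) :
    IntegrableOn (fun r : ℝ => f (ray r) * g (starRingEnd ℂ (ray r))) (Set.Ioi 0) := by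
  obtain ⟨C, c, hc, hC⟩ := hf.ray_le hg
  have hray : Continuous ray := by unfold ray; fun_prop
  refine ((exp_neg_integrableOn_Ioi 0 hc).const_mul C).mono'
    (ContinuousOn.aestronglyMeasurable (fun r hr => ?_) measurableSet_Ioi)
    ((ae_restrict_iff' measurableSet_Ioi).mpr (Eventually.of_forall fun r hr => hC r (le_of_lt hr)))
  have h1 := ray_mem_sector (le_of_lt hr)
  refine ContinuousAt.continuousWithinAt ?_
  exact (ContinuousAt.comp (hf.1 _ h1).continuousAt hray.continuousAt).mul
    (ContinuousAt.comp (f := fun r => starRingEnd ℂ (ray r)) (hg.1 _ (conj_mem_sector h1)).continuousAt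
      (Complex.continuous_conj.comp hray).continuousAt)

lemma SectorDecay.tendsto_ray {f g : ℂ → ℂ} (hf : SectorDecay f) (hg : SectorDecay g) :
    Tendsto (fun r : ℝ => f (ray r) * g (starRingEnd ℂ (ray r))) atTop (𝓝 0) := by
  obtain ⟨C, c, hc, hC⟩ := hf.ray_le hg
  refine squeeze_zero_norm' ((eventually_ge_atTop 0).mono fun r hr => hC r hr) ?_
  have h := (tendsto_exp_neg_atTop_nhds_zero.comp (tendsto_id.const_mul_atTop hc)).const_mul C
  simpa [Function.comp_def] using h

lemma ofReal_eq_mul_ray (r : ℝ) : (r : ℂ) = (1 + Complex.I)⁻¹ * ray r := by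
  have : (1 + Complex.I) ≠ 0 := fun h => by simpa using congrArg Complex.re h
  rw [ray]
  field_simp

lemma SectorDecay.integrableOn_mul_ray {f g : ℂ → ℂ} (hf : SectorDecay f) (hg : SectorDecay g)
    (k : ℕ) :
    IntegrableOn (fun r : ℝ => (r : ℂ) ^ k * (f (ray r) * g (starRingEnd ℂ (ray r))))
      (Set.Ioi 0) := by
  refine (((hf.pow_mul k).const_mul ((1 + Complex.I)⁻¹ ^ k)).integrableOn_ray hg).congr_fun
    (fun r _ => ?_) measurableSet_Ioi
  simp only [ofReal_eq_mul_ray r, mul_pow]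
  ring

lemma SectorDecay.integrableOn_mul_ray_symm {f g : ℂ → ℂ} (hf : SectorDecay f)
    (hg : SectorDecay g) :
    IntegrableOn (fun r : ℝ => (r : ℂ) * (f (ray r) * g (starRingEnd ℂ (ray r))
      + f (starRingEnd ℂ (ray r)) * g (ray r))) (Set.Ioi 0) := by
  refine ((hf.integrableOn_mul_ray hg 1).add (hg.integrableOn_mul_ray hf 1)).congr_fun
    (fun r _ => ?_) measurableSet_Ioi
  simp only [Pi.add_apply]
  ring

lemma ellB_pi : ellB π = 0 := by
  have h1 := ((sectorDecay_csechD 0).pow_mul 2).integral_ray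
  rw [(hasSum_node (k := 2) (j := 0) (by decide)).tsum_eq] at h1
  have h2 : ∀ r : ℝ, (r : ℂ) * (ray r ^ 2 * csechD 0 (ray r) * csech (starRingEnd ℂ (ray r))
      + starRingEnd ℂ (ray r) ^ 2 * csechD 0 (starRingEnd ℂ (ray r)) * csech (ray r)) = 0 := by
    intro r
    have h3 : starRingEnd ℂ (ray r) ^ 2 = -ray r ^ 2 := by
      rw [← map_pow, ray_sq]; simp [Complex.conj_ofNat]
    simp only [h3, csechD]
    ring
  simp only [h2, integral_zero] at h1
  have h4 : π * (π ^ 3 / 2 * moment 3 sech π) = 0 := by exact_mod_cast h1.symm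
  rw [moment_three pi_pos] at h4
  simpa [ellA_pi_pos.ne', pi_ne_zero] using h4

lemma ray_eq (r : ℝ) : ray r = (1 + Complex.I) * r := rfl

lemma hasDerivAt_comp_ray {f : ℂ → ℂ} {f' e : ℂ} {r : ℝ} (h : HasDerivAt f f' ((1 + e) * r)) :
    HasDerivAt (fun r : ℝ => f ((1 + e) * r)) (f' * (1 + e)) r := by
  have h1 : HasDerivAt (fun r : ℝ => (1 + e) * (r : ℂ)) (1 + e) r := by
    simpa using (Complex.ofRealCLM.hasDerivAt (x := r)).const_mul (1 + e)
  exact h.comp r h1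

lemma sechSqSum_pi : sechSqSum π = 1 / π := by
  have d0 := sectorDecay_csechD 0
  have hq : SectorDecay fun w => w ^ 1 * csechD 1 w + w ^ 0 * csechD 0 w :=
    ((sectorDecay_csechD 1).pow_mul 1).add (d0.pow_mul 0)
  have h1 := hq.integral_ray
  have hs := (hasSum_node (k := 1) (j := 1) (by decide)).add
    (hasSum_node (k := 0) (j := 0) (by decide))
  simp only [← mul_add] at hs
  rw [hs.tsum_eq] at h1
  have hder : ∀ r ∈ Set.Ici (0 : ℝ), HasDerivAt
      (fun r : ℝ => (r : ℂ) ^ 2 * (csechD 0 (ray r) * csechD 0 (starRingEnd ℂ (ray r))))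
      ((r : ℂ) * ((ray r ^ 1 * csechD 1 (ray r) + ray r ^ 0 * csechD 0 (ray r)) *
          csech (starRingEnd ℂ (ray r))
        + (starRingEnd ℂ (ray r) ^ 1 * csechD 1 (starRingEnd ℂ (ray r))
          + starRingEnd ℂ (ray r) ^ 0 * csechD 0 (starRingEnd ℂ (ray r))) * csech (ray r))) r := by
    intro r hr
    have m1 := ray_mem_sector hr
    have m2 := conj_mem_sector m1
    simp only [conj_ray] at m2 ⊢
    simp only [ray_eq] at m1 ⊢
    refine (((Complex.ofRealCLM.hasDerivAt (x := r)).pow 2).mul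
      ((hasDerivAt_comp_ray (hasDerivAt_csechD (j := 0) (by norm_num) m1)).mul
        (hasDerivAt_comp_ray (hasDerivAt_csechD (j := 0) (by norm_num) m2)))).congr_deriv ?_
    simp only [csechD, Complex.ofRealCLM_apply, Complex.ofReal_one, Pi.pow_apply, Pi.mul_apply]
    push_cast
    ring
  have h2 := integral_Ioi_of_hasDerivAt_of_tendsto' hder (hq.integrableOn_mul_ray_symm d0)
    (m := 0) ?_
  · rw [h1] at h2
    have h3 : π * (π ^ 2 / 2 * moment 2 (sechD 1) π + π / 2 * ellA π) = 0 := by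
      simp only [zero_pow, ne_eq, OfNat.ofNat_ne_zero, not_false_eq_true, Complex.ofReal_zero,
        zero_mul, sub_zero, zero_add, pow_one, Nat.reduceAdd] at h2
      exact_mod_cast h2
    have h4 := (hasDerivAt_moment (expDecay_sechD 0) (expDecay_sechD 1)
      (hasDerivAt_sechD (j := 0) (by norm_num)) 1 pi_pos).unique (hasDerivAt_ellA pi_pos)
    have hA := ellA_pi_pos
    have hp := pi_pos
    simp only [Nat.reduceAdd, ellB_pi] at h4
    rw [h4] at h3
    have h5 : π ^ 2 * ellA π / 2 * (1 - π * sechSqSum π) = 0 := by linear_combination h3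
    rw [eq_div_iff hp.ne']
    rcases mul_eq_zero.mp h5 with h | h
    · exact absurd h (by positivity)
    · linear_combination -h
  · refine ((((d0.pow_mul 2).const_mul ((1 + Complex.I)⁻¹ ^ 2)).tendsto_ray d0)).congr fun r => ?_
    simp only [ofReal_eq_mul_ray r, mul_pow]
    ring

/-- The function `w ^ n * (csech w - csech'' w) / 2`, which equals `w ^ n * csech w ^ 3`. -/
noncomputable def cubeFun (m : ℕ) (w : ℂ) : ℂ :=
  1 / 2 * (w ^ (m + 3) * (csechD 0 w - csechD 2 w))

/-- The derivative of `cubeFun`. -/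
noncomputable def cubeFunDeriv (m : ℕ) (w : ℂ) : ℂ :=
  1 / 2 * ((m + 3) * (w ^ (m + 2) * (csechD 0 w - csechD 2 w))
    + w ^ (m + 3) * (csechD 1 w - csechD 3 w))

/-- The quotient by the variable of `cubeFun m` plus its second derivative. -/
noncomputable def cubeKernel (m : ℕ) (w : ℂ) : ℂ :=
  1 / 2 * (w ^ (m + 2) * csechD 0 w + -1 * (w ^ (m + 2) * csechD 4 w)
    + 2 * (m + 3) * (w ^ (m + 1) * csechD 1 w) + -(2 * (m + 3)) * (w ^ (m + 1) * csechD 3 w)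
    + (m + 3) * (m + 2) * (w ^ m * csechD 0 w) + -((m + 3) * (m + 2)) * (w ^ m * csechD 2 w))

lemma hasDerivAt_cubeFun (m : ℕ) {w : ℂ} (hw : w ∈ sector) :
    HasDerivAt (cubeFun m) (cubeFunDeriv m w) w := by
  have h0 := hasDerivAt_csechD (j := 0) (by norm_num) hw
  have h2 := hasDerivAt_csechD (j := 2) (by norm_num) hw
  refine (((hasDerivAt_pow (m + 3) w).mul (h0.sub h2)).const_mul (1 / 2)).congr_deriv ?_
  simp only [cubeFunDeriv, Nat.add_succ_sub_one, Pi.sub_apply]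
  push_cast
  ring

lemma hasDerivAt_cubeFunDeriv (m : ℕ) {w : ℂ} (hw : w ∈ sector) :
    HasDerivAt (cubeFunDeriv m) (w * cubeKernel m w - cubeFun m w) w := by
  have h0 := hasDerivAt_csechD (j := 0) (by norm_num) hw
  have h1 := hasDerivAt_csechD (j := 1) (by norm_num) hw
  have h2 := hasDerivAt_csechD (j := 2) (by norm_num) hw
  have h3 := hasDerivAt_csechD (j := 3) (by norm_num) hw
  refine (((((hasDerivAt_pow (m + 2) w).mul (h0.sub h2)).const_mul (m + 3 : ℂ)).add
    ((hasDerivAt_pow (m + 3) w).mul (h1.sub h3))).const_mul (1 / 2)).congr_deriv ?_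
  simp only [cubeFun, cubeKernel, Nat.add_succ_sub_one, Pi.sub_apply]
  push_cast
  ring

lemma sectorDecay_cubeKernel (m : ℕ) : SectorDecay (cubeKernel m) := by
  have h := fun k j => (sectorDecay_csechD j).pow_mul k
  exact ((((((h (m + 2) 0).add ((h (m + 2) 4).const_mul _)).add ((h (m + 1) 1).const_mul _)).add
    ((h (m + 1) 3).const_mul _)).add ((h m 0).const_mul _)).add ((h m 2).const_mul _)).const_mul _

lemma sectorDecay_cubeFun (m : ℕ) : SectorDecay (cubeFun m) :=
  (((((sectorDecay_csechD 0).add ((sectorDecay_csechD 2).const_mul (-1))).pow_mul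
    (m + 3))).const_mul (1 / 2)).congr fun w => by rw [cubeFun]; ring

lemma sectorDecay_cubeFunDeriv (m : ℕ) : SectorDecay (cubeFunDeriv m) :=
  ((((((sectorDecay_csechD 0).add ((sectorDecay_csechD 2).const_mul (-1))).pow_mul
    (m + 2)).const_mul (m + 3)).add
    (((sectorDecay_csechD 1).add ((sectorDecay_csechD 3).const_mul (-1))).pow_mul
    (m + 3))).const_mul (1 / 2)).congr fun w => by rw [cubeFunDeriv]; ring

lemma cubeFun_eq (m : ℕ) (w : ℂ) : cubeFun m w = w ^ (m + 3) * csech w ^ 3 := by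
  simp only [cubeFun, csechD]; ring

/-- The value of the alternating sum of `cubeKernel` over the nodes. -/
noncomputable def cubeValue (m : ℕ) : ℝ :=
  1 / 2 * (π ^ (m + 3) / 2 * moment (m + 3) (sechD 0) π
    + -1 * (π ^ (m + 3) / 2 * moment (m + 3) (sechD 4) π)
    + 2 * (m + 3) * (π ^ (m + 2) / 2 * moment (m + 2) (sechD 1) π)
    + -(2 * (m + 3)) * (π ^ (m + 2) / 2 * moment (m + 2) (sechD 3) π)
    + (m + 3) * (m + 2) * (π ^ (m + 1) / 2 * moment (m + 1) (sechD 0) π)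
    + -((m + 3) * (m + 2)) * (π ^ (m + 1) / 2 * moment (m + 1) (sechD 2) π))

lemma integral_cubeKernel {m : ℕ} (hm : Even m) :
    ∫ r in Set.Ioi (0 : ℝ), (r : ℂ) * (cubeKernel m (ray r) * csech (starRingEnd ℂ (ray r))
      + cubeKernel m (starRingEnd ℂ (ray r)) * csech (ray r)) = π * (cubeValue m : ℂ) := by
  rw [(sectorDecay_cubeKernel m).integral_ray]
  congr 1
  have h := fun k j (hkj : Even (k + j)) => hasSum_node hkj
  have s := ((((((h (m + 2) 0 (by grind)).add ((h (m + 2) 4 (by grind)).mul_left (-1 : ℂ))).add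
    ((h (m + 1) 1 (by grind)).mul_left (2 * (m + 3) : ℂ))).add
    ((h (m + 1) 3 (by grind)).mul_left (-(2 * (m + 3)) : ℂ))).add
    ((h m 0 (by grind)).mul_left ((m + 3) * (m + 2) : ℂ))).add
    ((h m 2 (by grind)).mul_left (-((m + 3) * (m + 2)) : ℂ))).mul_left (1 / 2 : ℂ)
  refine (tsum_congr fun n => ?_).trans (s.tsum_eq.trans ?_)
  · rw [cubeKernel]
    ring
  · rw [cubeValue]
    push_cast
    ring

lemma hasDerivAt_ray_cube (m : ℕ) {e : ℂ} (he : e * e = -1) {r : ℝ}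
    (m1 : (1 + e) * (r : ℂ) ∈ sector) (m2 : (1 + -e) * (r : ℂ) ∈ sector) :
    HasDerivAt (fun r : ℝ => e / 2 * (cubeFunDeriv m ((1 + e) * r) * csechD 0 ((1 + -e) * r)
        + e * (cubeFun m ((1 + e) * r) * csechD 1 ((1 + -e) * r))))
      (2 * ((1 + e) ^ (m + 2) * (r : ℂ) ^ (m + 3) *
          (csech ((1 + e) * r) * csech ((1 + -e) * r)) ^ 3)
        - r * (cubeKernel m ((1 + e) * r) * csech ((1 + -e) * r))) r := by
  have c0 := hasDerivAt_comp_ray (hasDerivAt_csechD (j := 0) (by norm_num) m2)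
  have c1 := hasDerivAt_comp_ray (hasDerivAt_csechD (j := 1) (by norm_num) m2)
  have f0 := hasDerivAt_comp_ray (hasDerivAt_cubeFun m m1)
  have f1 := hasDerivAt_comp_ray (hasDerivAt_cubeFunDeriv m m1)
  refine (((f1.mul c0).add ((f0.mul c1).const_mul e)).const_mul (e / 2)).congr_deriv ?_
  simp only [cubeFun_eq, csechD, zero_add, Nat.reduceAdd]
  set s := csech ((1 + e) * r)
  set t := csech ((1 + -e) * r)
  set T := Complex.tanh ((1 + -e) * r)
  set q := cubeKernel m ((1 + e) * r)
  set D := cubeFunDeriv m ((1 + e) * r)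
  have e2 : ((1 + e) * (r : ℂ)) ^ (m + 3) = (1 + e) * ((1 + e) ^ (m + 2) * (r : ℂ) ^ (m + 3)) := by
    rw [mul_pow]; ring
  rw [e2]
  set P := (1 + e) ^ (m + 2) * (r : ℂ) ^ (m + 3)
  have he3 : e ^ 2 = -1 := by rw [sq, he]
  have he4 : e ^ 3 = -e := by rw [pow_succ, he3]; ring
  have he5 : e ^ 4 = 1 := by linear_combination (e ^ 2 - 1) * he3
  ring_nf
  simp only [he3, he4, he5]
  ring

lemma integral_cube {p : ℕ} (hp : 0 < p) :
    ∫ r in Set.Ioi (0 : ℝ), (r : ℂ) ^ (4 * p + 1) *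
      (csech (ray r) * csech (starRingEnd ℂ (ray r))) ^ 3
      = π * (cubeValue (4 * p - 2) : ℂ) / (4 * (-4) ^ p) := by
  obtain ⟨m, hm⟩ : ∃ m, m = 4 * p - 2 := ⟨_, rfl⟩
  have hm3 : 4 * p + 1 = m + 3 := by omega
  rw [← hm, hm3, ← integral_cubeKernel (m := m) ⟨2 * p - 1, by omega⟩]
  have hI : (1 + Complex.I) ^ (m + 2) = (-4) ^ p := by
    have : (1 + Complex.I) ^ 4 = -4 := by
      linear_combination (Complex.I ^ 2 + 4 * Complex.I + 5) * Complex.I_sq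
    rw [show m + 2 = 4 * p by omega, pow_mul, this]
  have hI' : (1 + -Complex.I) ^ (m + 2) = (-4) ^ p := by
    have : (1 + -Complex.I) ^ 4 = -4 := by
      linear_combination (Complex.I ^ 2 - 4 * Complex.I + 5) * Complex.I_sq
    rw [show m + 2 = 4 * p by omega, pow_mul, this]
  have h4 : (4 * (-4) ^ p : ℂ) ≠ 0 := by simp
  rw [eq_div_iff h4, mul_comm, ← integral_const_mul]
  set f : ℝ → ℂ := fun r => 4 * (-4) ^ p * ((r : ℂ) ^ (m + 3) *
      (csech (ray r) * csech (starRingEnd ℂ (ray r))) ^ 3) with hf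
  set g : ℝ → ℂ := fun r => (r : ℂ) * (cubeKernel m (ray r) * csech (starRingEnd ℂ (ray r))
      + cubeKernel m (starRingEnd ℂ (ray r)) * csech (ray r)) with hg
  have h3 : SectorDecay fun w => csech w * (csech w * csech w) :=
    sectorDecay_csech.csech_mul.csech_mul
  have hfi : IntegrableOn f (Set.Ioi 0) :=
    IntegrableOn.congr_fun ((h3.integrableOn_mul_ray h3 (m + 3)).const_mul (4 * (-4) ^ p))
      (fun r _ => by simp only [hf]; ring) measurableSet_Ioi
  have hgi : IntegrableOn g (Set.Ioi 0) :=
    (sectorDecay_cubeKernel m).integrableOn_mul_ray_symm sectorDecay_csech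
  rw [← sub_eq_zero, ← integral_sub hfi hgi]
  set Ψ : ℂ → (ℝ → ℂ) → (ℝ → ℂ) → ℝ → ℂ := fun e u v r =>
    e / 2 * (cubeFunDeriv m (u r) * csechD 0 (v r) + e * (cubeFun m (u r) * csechD 1 (v r)))
    with hΨ
  have hder : ∀ r ∈ Set.Ici (0 : ℝ), HasDerivAt
      (fun r => Ψ Complex.I ray (fun r => starRingEnd ℂ (ray r)) r
        + Ψ (-Complex.I) (fun r => starRingEnd ℂ (ray r)) ray r) (f r - g r) r := by
    intro r hr
    have m1 := ray_mem_sector hr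
    have m2 := conj_mem_sector m1
    rw [conj_ray] at m2
    rw [ray_eq] at m1
    have d1 := hasDerivAt_ray_cube m Complex.I_mul_I m1 m2
    have d2 := hasDerivAt_ray_cube m (e := -Complex.I) (by simp) m2 (by rwa [neg_neg])
    simp only [neg_neg] at d2
    simp only [hΨ, hf, hg, conj_ray]
    simp only [ray_eq]
    refine (d1.add d2).congr_deriv ?_
    rw [hI, hI']
    ring
  have hF := sectorDecay_cubeFun m
  have hD := sectorDecay_cubeFunDeriv m
  have hc := sectorDecay_csechD
  have hlim : Tendsto (fun r => Ψ Complex.I ray (fun r => starRingEnd ℂ (ray r)) r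
      + Ψ (-Complex.I) (fun r => starRingEnd ℂ (ray r)) ray r) atTop (𝓝 0) := by
    have l1 := (((hD.tendsto_ray (hc 0)).add
      ((hF.tendsto_ray (hc 1)).const_mul Complex.I)).const_mul (Complex.I / 2)).add
      (((((hc 0).tendsto_ray hD)).add
      (((hc 1).tendsto_ray hF).const_mul (-Complex.I))).const_mul (-Complex.I / 2))
    simp only [mul_zero, add_zero] at l1
    refine l1.congr fun r => ?_
    simp only [hΨ]
    ring
  rw [integral_Ioi_of_hasDerivAt_of_tendsto' hder (hfi.sub hgi) hlim]
  simp [hΨ, cubeFun, cubeFunDeriv, ray]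

theorem integral_eq_cubeValue {p : ℕ} (hp : 0 < p) :
    ∫ z in Set.Ioi (0 : ℝ), z ^ (4 * p + 1) / (cos z + cosh z) ^ 3
      = 2 ^ (4 * p - 1) * (π * cubeValue (4 * p - 2) / (4 * (-4) ^ p)) := by
  have h2 := integral_comp_mul_left_Ioi' (fun z => z ^ (4 * p + 1) / (cos z + cosh z) ^ 3) 0
    two_pos
  rw [mul_zero] at h2
  rw [← h2, smul_eq_mul, ← integral_const_mul]
  apply Complex.ofReal_injective
  rw [← integral_complex_ofReal]
  push_cast
  rw [← integral_cube hp, ← integral_const_mul]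
  refine setIntegral_congr_fun measurableSet_Ioi fun r hr => ?_
  have m1 := ray_mem_sector (le_of_lt hr)
  have hc : Complex.cosh (ray r) * Complex.cosh (starRingEnd ℂ (ray r))
      = (Complex.cos (2 * r) + Complex.cosh (2 * r)) / 2 := by
    have a1 := Complex.cosh_add (ray r) (starRingEnd ℂ (ray r))
    have a2 := Complex.cosh_sub (ray r) (starRingEnd ℂ (ray r))
    rw [conj_ray, ray_eq] at a1 a2 ⊢
    rw [show (1 + Complex.I) * (r : ℂ) + (1 + -Complex.I) * r = 2 * r by ring] at a1
    rw [show (1 + Complex.I) * (r : ℂ) - (1 + -Complex.I) * r = 2 * r * Complex.I by ring,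
      Complex.cosh_mul_I] at a2
    linear_combination -(a1 + a2) / 2
  have e : csech (ray r) * csech (starRingEnd ℂ (ray r))
      = 2 / (Complex.cos (2 * r) + Complex.cosh (2 * r)) := by
    rw [csech, csech, ← mul_inv, hc, inv_div]
  simp only [e]
  rw [div_pow, mul_pow, show 4 * p + 1 = (4 * p - 1) + 2 by omega, pow_add 2]
  ring

lemma pi_pow_mul_moment_mem {V : Submodule ℚ ℝ} {l j : ℕ} (hj : j ≤ 4)
    (hV : ∀ e ≤ j, e % 2 = (l + j) % 2 →
      Gamma (1 / 4) ^ (4 * (l + 1 + j - e)) / π ^ (l + 1 + 2 * j - 2 * e) ∈ V) :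
    π ^ (2 * l + 2 + j) * moment (2 * l + 1 + j) (sechD j) π ∈ V := by
  have h := moment_sechD_mem_span l j hj ellA_pi_pos.ne' ellB_pi
  suffices H : Submodule.span ℚ {y : ℝ | ∃ i e : ℕ, i + e = l + 1 + j ∧ e ≤ j ∧
      e % 2 = (l + j) % 2 ∧ y = ellA π ^ i * sechSqSum π ^ e} ≤
      V.comap (LinearMap.mulLeft ℚ (π ^ (2 * l + 2 + j))) from H h
  rw [Submodule.span_le]
  rintro y ⟨i, e, hi, he, hp, rfl⟩
  simp only [SetLike.mem_coe, Submodule.mem_comap, LinearMap.mulLeft_apply]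
  have := V.smul_mem ((1 / 16) ^ i) (hV e he hp)
  convert this using 1
  rw [ellA_pi ellB_pi, sechSqSum_pi, Rat.smul_def, show l + 1 + j - e = i by omega, pow_mul,
    div_pow, mul_pow, div_pow, one_pow, ← pow_mul]
  push_cast
  have hpi := pi_ne_zero
  rw [div_pow, one_pow]
  field_simp
  rw [← pow_mul, ← pow_add, ← pow_add]
  congr 1
  omega

lemma integral_mem_span {p : ℕ} (hp : 0 < p) :
    ∫ z in Set.Ioi (0 : ℝ), z ^ (4 * p + 1) / (cos z + cosh z) ^ 3 ∈
      Submodule.span ℚ (Set.range ![Gamma (1 / 4) ^ (8 * p - 4) / π ^ (2 * p - 1),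
        Gamma (1 / 4) ^ (8 * p + 4) / π ^ (2 * p + 3),
        Gamma (1 / 4) ^ (8 * p + 4) / π ^ (2 * p + 2),
        Gamma (1 / 4) ^ (8 * p + 4) / π ^ (2 * p + 1),
        Gamma (1 / 4) ^ (8 * p + 12) / π ^ (2 * p + 7)]) := by
  set v := ![Gamma (1 / 4) ^ (8 * p - 4) / π ^ (2 * p - 1),
        Gamma (1 / 4) ^ (8 * p + 4) / π ^ (2 * p + 3),
        Gamma (1 / 4) ^ (8 * p + 4) / π ^ (2 * p + 2),
        Gamma (1 / 4) ^ (8 * p + 4) / π ^ (2 * p + 1),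
        Gamma (1 / 4) ^ (8 * p + 12) / π ^ (2 * p + 7)] with hv
  set V := Submodule.span ℚ (Set.range v)
  have hmem : ∀ (i : Fin 5) {a b : ℕ}, v i = Gamma (1 / 4) ^ a / π ^ b →
      ∀ {c d : ℕ}, c = a → d = b → Gamma (1 / 4) ^ c / π ^ d ∈ V := by
    rintro i a b h c d rfl rfl
    exact h ▸ Submodule.subset_span ⟨i, rfl⟩
  have v1 := @hmem 0 _ _ rfl
  have v2 := @hmem 1 _ _ rfl
  have v3 := @hmem 2 _ _ rfl
  have v4 := @hmem 3 _ _ rfl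
  have v5 := @hmem 4 _ _ rfl
  have m0 : π ^ (4 * p + 2) * moment (4 * p + 1) (sechD 0) π ∈ V := by
    have := pi_pow_mul_moment_mem (V := V) (l := 2 * p) (j := 0) (by norm_num) fun e he h =>
      v4 (by omega) (by omega)
    convert this using 3 <;> ring
  have m4 : π ^ (4 * p + 2) * moment (4 * p + 1) (sechD 4) π ∈ V := by
    have := pi_pow_mul_moment_mem (V := V) (l := 2 * p - 2) (j := 4) (by norm_num) fun e he h => by
      obtain rfl | rfl | rfl : e = 0 ∨ e = 2 ∨ e = 4 := by omega
      · exact v5 (by omega) (by omega)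
      · exact v2 (by omega) (by omega)
      · exact v1 (by omega) (by omega)
    convert this using 3 <;> omega
  have m1 : π ^ (4 * p + 1) * moment (4 * p) (sechD 1) π ∈ V := by
    have := pi_pow_mul_moment_mem (V := V) (l := 2 * p - 1) (j := 1) (by norm_num) fun e he h =>
      v3 (by omega) (by omega)
    convert this using 3 <;> omega
  have m3 : π ^ (4 * p + 1) * moment (4 * p) (sechD 3) π ∈ V := by
    have := pi_pow_mul_moment_mem (V := V) (l := 2 * p - 2) (j := 3) (by norm_num) fun e he h => by
      obtain rfl | rfl : e = 1 ∨ e = 3 := by omega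
      · exact v2 (by omega) (by omega)
      · exact v1 (by omega) (by omega)
    convert this using 3 <;> omega
  have m0' : π ^ (4 * p) * moment (4 * p - 1) (sechD 0) π ∈ V := by
    have := pi_pow_mul_moment_mem (V := V) (l := 2 * p - 1) (j := 0) (by norm_num) fun e he h => by
      omega
    convert this using 3 <;> omega
  have m2 : π ^ (4 * p) * moment (4 * p - 1) (sechD 2) π ∈ V := by
    have := pi_pow_mul_moment_mem (V := V) (l := 2 * p - 2) (j := 2) (by norm_num) fun e he h => by
      obtain rfl | rfl : e = 0 ∨ e = 2 := by omega
      · exact v2 (by omega) (by omega)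
      · exact v1 (by omega) (by omega)
    convert this using 3 <;> omega
  obtain ⟨m, hm⟩ : ∃ m, 4 * p = m + 2 := ⟨4 * p - 2, by omega⟩
  rw [show 4 * p + 1 = m + 3 by omega, show 4 * p + 2 = m + 4 by omega] at m0 m4
  rw [show 4 * p + 1 = m + 3 by omega, hm] at m1 m3
  rw [show 4 * p - 1 = m + 1 by omega, hm] at m0' m2
  have key := V.smul_mem (2 ^ (m + 1) / (16 * (-4) ^ p) : ℚ) (add_mem (add_mem
    (sub_mem m0 m4) (V.smul_mem (2 * (m + 3)) (sub_mem m1 m3)))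
    (V.smul_mem ((m + 3) * (m + 2)) (sub_mem m0' m2)))
  convert key using 1
  rw [integral_eq_cubeValue hp, show 4 * p - 1 = m + 1 by omega, show 4 * p - 2 = m by omega,
    cubeValue]
  simp only [Rat.smul_def]
  push_cast
  have h4 : (-4 : ℝ) ^ p ≠ 0 := by simp
  field_simp
  ring

end BerndtIntegral

theorem berndt_type_integral_order_three_plus (p : ℕ) (hp : 0 < p) :
    ∃ q1 q2 q3 q4 q5 : ℚ,
      (∫ z in Set.Ioi (0:ℝ), z ^ (4*p+1) / (Real.cos z + Real.cosh z) ^ 3) =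
        (q1 : ℝ) * Real.Gamma (1/4) ^ (8*p-4) / π ^ (2*p-1)
      + (q2 : ℝ) * Real.Gamma (1/4) ^ (8*p+4) / π ^ (2*p+3)
      + (q3 : ℝ) * Real.Gamma (1/4) ^ (8*p+4) / π ^ (2*p+2)
      + (q4 : ℝ) * Real.Gamma (1/4) ^ (8*p+4) / π ^ (2*p+1)
      + (q5 : ℝ) * Real.Gamma (1/4) ^ (8*p+12) / π ^ (2*p+7) := by
  obtain ⟨c, hc⟩ := (Submodule.mem_span_range_iff_exists_fun ℚ).mp
    (BerndtIntegral.integral_mem_span hp)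
  refine ⟨c 0, c 1, c 2, c 3, c 4, ?_⟩
  rw [← hc, Fin.sum_univ_five]
  simp [Rat.smul_def, mul_div_assoc]
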